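/- arXiv:1903.06087 — 7 statements merged into one kernel-verified Lean document; each statement's English description precedes it below -/
import Mathlib

section
/- Let G be a finite simple graph with maximum degree Δ. If G is triangle-free (contains no cycle on 3 vertices), then 4·ω₂'(G) ≤ 5·Δ², i.e., the strong clique number of G is at most (5/4)Δ². -/
open SimpleGraph

/-- `G.ContainsSub H` means `G` contains a copy of `H` as a (not necessarily induced)
subgraph, i.e. there is an injective graph homomorphism from `H` to `G`. -/
def SimpleGraph.ContainsSub {V W : Type*} (G : SimpleGraph V) (H : SimpleGraph W) : Prop :=
  ∃ f : W → V, Function.Injective f ∧ ∀ a b, H.Adj a b → G.Adj (f a) (f b)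

/-- A strong clique of `G`: a set of edges of `G` any two distinct members of which
either share an endpoint or have endpoints joined by an edge of `G`. -/
def SimpleGraph.IsStrongClique {V : Type*} (G : SimpleGraph V) (F : Finset (Sym2 V)) : Prop :=
  (F : Set (Sym2 V)) ⊆ G.edgeSet ∧
    ∀ e ∈ F, ∀ f ∈ F, e ≠ f → ∃ x ∈ e, ∃ y ∈ f, x = y ∨ G.Adj x y

/-- The strong clique number `ω₂'(G)`: the largest cardinality of a strong clique. -/
noncomputable def SimpleGraph.strongCliqueNumber {V : Type*} (G : SimpleGraph V) : ℕ :=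
  sSup {n | ∃ F : Finset (Sym2 V), G.IsStrongClique F ∧ F.card = n}

/-- The edges `s(z, w)` with `z ∈ C` and `w ∈ S z`. -/
def starFam {V : Type*} [DecidableEq V] (C : Finset V) (S : V → Finset V) : Finset (Sym2 V) :=
  C.biUnion fun z => (S z).image fun w => s(z, w)

theorem starFam_card_le {V : Type*} [DecidableEq V] (C : Finset V) (S : V → Finset V) (k : ℕ)
    (h : ∀ z ∈ C, (S z).card ≤ k) : (starFam C S).card ≤ C.card * k := by
  unfold starFam
  exact Finset.card_biUnion_le_card_mul _ _ _ fun z hz => Finset.card_image_le.trans (h z hz)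

theorem mem_starFam {V : Type*} [DecidableEq V] {C : Finset V} {S : V → Finset V} {a b : V}
    (ha : a ∈ C) (hb : b ∈ S a) : s(a, b) ∈ starFam C S := by
  unfold starFam
  exact Finset.mem_biUnion.2 ⟨a, ha, Finset.mem_image.2 ⟨b, hb, rfl⟩⟩

theorem mem_starFam' {V : Type*} [DecidableEq V] {C : Finset V} {S : V → Finset V} {a b : V}
    (ha : a ∈ C) (hb : b ∈ S a) : s(b, a) ∈ starFam C S := by
  rw [Sym2.eq_swap]; exact mem_starFam ha hb

/-- Neighbours of `z` through edges in `E`. -/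
def nbE {V : Type*} [Fintype V] [DecidableEq V] (E : Finset (Sym2 V)) (z : V) : Finset V :=
  Finset.univ.filter fun w => s(z, w) ∈ E

theorem mem_nbE {V : Type*} [Fintype V] [DecidableEq V] {E : Finset (Sym2 V)} {z w : V} :
    w ∈ nbE E z ↔ s(z, w) ∈ E := by simp [nbE]

theorem final_arith (f r Δ D M i z k : ℕ) (h1 : f ≤ Δ * D + r) (h2 : r ≤ i * M + z * M + M * k)
    (h3 : i + z + k + M + D ≤ 2 * Δ) (h4 : D ≤ Δ) : 4 * f ≤ 5 * Δ ^ 2 := by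
  have c6 := Nat.mul_le_mul_left M h3
  have c7 := Nat.mul_le_mul h4 h4
  zify at *
  nlinarith [sq_nonneg (2 * (M : ℤ) - (2 * Δ - D))]

set_option maxHeartbeats 1000000 in
theorem clique_bound {V : Type*} [Fintype V] [DecidableEq V]
    (G : SimpleGraph V) [DecidableRel G.Adj] (Δ : ℕ) (hΔ : ∀ v, (G.neighborFinset v).card ≤ Δ)
    (htri : ∀ a b c, G.Adj a b → G.Adj b c → G.Adj a c → False)
    (F : Finset (Sym2 V)) (hF : G.IsStrongClique F) : 4 * F.card ≤ 5 * Δ ^ 2 := by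
  classical
  obtain ⟨hFE, hFl⟩ := hF
  have hadj : ∀ {a b}, s(a, b) ∈ F → G.Adj a b := fun {a b} h => by
    have := hFE (Finset.mem_coe.2 h); simpa using this
  have hlink : ∀ a b c d, s(a, b) ∈ F → s(c, d) ∈ F → s(a, b) ≠ s(c, d) →
      (a = c ∨ G.Adj a c) ∨ (a = d ∨ G.Adj a d) ∨ (b = c ∨ G.Adj b c) ∨ (b = d ∨ G.Adj b d) := by
    intro a b c d h1 h2 h3
    obtain ⟨x, hx, y, hy, h⟩ := hFl _ h1 _ h2 h3
    rw [Sym2.mem_iff] at hx hy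
    rcases hx with rfl | rfl <;> rcases hy with rfl | rfl <;> tauto
  rcases isEmpty_or_nonempty V with hV | hV
  · have : F = ∅ := by
      ext e
      induction e with
      | _ a b => exact (hV.false a).elim
    subst this; simp
  obtain ⟨v, hv⟩ := Finite.exists_max fun z => (nbE F z).card
  set N := nbE F v with hN
  set D := N.card with hD
  -- edges avoiding the neighbourhood of `v`
  set R := F.filter (fun e => ∀ z ∈ e, ¬ G.Adj v z) with hR
  have hRm : ∀ {a b}, s(a, b) ∈ R ↔ s(a, b) ∈ F ∧ ¬ G.Adj v a ∧ ¬ G.Adj v b := by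
    intro a b
    simp [hR]
  have hNadj : ∀ {u}, u ∈ N → G.Adj v u := fun {u} hu => hadj (mem_nbE.1 hu)
  have hDΔ : D ≤ Δ := (Finset.card_le_card (fun u hu => by simpa using hNadj hu)).trans (hΔ v)
  have h1 : F.card ≤ Δ * D + R.card := by
    have hsub : F ⊆ starFam (G.neighborFinset v) (nbE F) ∪ R := by
      intro e
      induction e with
      | _ a b =>
        intro h
        rw [Finset.mem_union]
        by_cases ha : G.Adj v a
        · exact Or.inl (mem_starFam (by simpa using ha) (mem_nbE.2 h))
        by_cases hb : G.Adj v b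
        · exact Or.inl (mem_starFam' (by simpa using hb) (mem_nbE.2 (by rwa [Sym2.eq_swap])))
        exact Or.inr (hRm.2 ⟨h, ha, hb⟩)
    have := starFam_card_le (G.neighborFinset v) (nbE F) D (fun z _ => hv z)
    calc F.card ≤ _ := Finset.card_le_card hsub
      _ ≤ _ := Finset.card_union_le _ _
      _ ≤ _ := by
        have := Nat.mul_le_mul_right D (hΔ v)
        omega
  rcases R.eq_empty_or_nonempty with hRe | hRne
  · rw [hRe, Finset.card_empty] at h1
    nlinarith
  -- every edge of `R` meets the neighbourhood of every `u ∈ N`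
  have hcov : ∀ u ∈ N, ∀ a b, s(a, b) ∈ R → G.Adj a u ∨ G.Adj b u := by
    intro u hu a b hab
    obtain ⟨h, ha, hb⟩ := hRm.1 hab
    have huF := mem_nbE.1 hu
    have hvu := hNadj hu
    have hva : v ≠ a := by rintro rfl; exact hb (hadj h)
    have hvb : v ≠ b := by rintro rfl; exact ha (hadj h).symm
    have hua : u ≠ a := by rintro rfl; exact ha hvu
    have hub : u ≠ b := by rintro rfl; exact hb hvu
    have hne : s(v, u) ≠ s(a, b) := by
      intro h'
      rw [Sym2.eq_iff] at h'
      tauto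
    have := hlink _ _ _ _ huF h hne
    have s1 := G.adj_comm u a
    have s2 := G.adj_comm u b
    tauto
  obtain ⟨x, hx⟩ := Finite.exists_max fun z => (nbE R z).card
  set Y := nbE R x with hY
  set M := Y.card with hM
  have hYne : Y.Nonempty := by
    rw [← Finset.card_pos]
    obtain ⟨e, he⟩ := hRne
    induction e with
    | _ a b => exact lt_of_lt_of_le (Finset.card_pos.2 ⟨b, mem_nbE.2 he⟩) (hx a)
  obtain ⟨y0, hy0⟩ := hYne
  have hxy0 := mem_nbE.1 hy0
  obtain ⟨hxyF, hvx, hvy0⟩ := hRm.1 hxy0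
  set A := N.filter (fun u => G.Adj x u) with hA
  set B := N.filter (fun u => ¬ G.Adj x u) with hB
  have hABc : A.card + B.card = D := Finset.card_filter_add_card_filter_not _
  have hYadj : ∀ {y}, y ∈ Y → G.Adj x y ∧ ¬ G.Adj v y := fun {y} hy =>
    ⟨hadj (hRm.1 (mem_nbE.1 hy)).1, (hRm.1 (mem_nbE.1 hy)).2.2⟩
  have hYB : ∀ y ∈ Y, ∀ u ∈ B, G.Adj y u := by
    intro y hy u hu
    obtain ⟨huN, hxu⟩ := Finset.mem_filter.1 hu
    exact (hcov u huN x y (mem_nbE.1 hy)).resolve_left hxu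
  -- neighbours of `x` outside `N(v)` and not in `Y`
  set Z := (G.neighborFinset x).filter (fun z => ¬ G.Adj v z ∧ z ∉ Y) with hZ
  have hZc : Z.card + M + A.card ≤ Δ := by
    have d1 : Disjoint Z Y := Finset.disjoint_left.2 fun z hz hz' => (Finset.mem_filter.1 hz).2.2 hz'
    have d2 : Disjoint (Z ∪ Y) A := Finset.disjoint_left.2 fun z hz hz' => by
      have hvz := hNadj (Finset.mem_filter.1 hz').1
      rcases Finset.mem_union.1 hz with h | h
      · exact (Finset.mem_filter.1 h).2.1 hvz
      · exact (hYadj h).2 hvz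
    rw [← Finset.card_union_of_disjoint d1, ← Finset.card_union_of_disjoint d2]
    refine (Finset.card_le_card ?_).trans (hΔ x)
    intro z hz
    rw [mem_neighborFinset]
    rcases Finset.mem_union.1 hz with h | h
    · rcases Finset.mem_union.1 h with h | h
      · simpa using (Finset.mem_filter.1 h).1
      · exact (hYadj h).1
    · exact (Finset.mem_filter.1 h).2
  rcases B.eq_empty_or_nonempty with hBe | ⟨t, ht⟩
  · -- `x` is adjacent to all of `N`
    rw [hBe, Finset.card_empty] at hABc
    have hRle : R.card ≤ Δ * M := by
      rcases N.eq_empty_or_nonempty with hNe | ⟨u, hu⟩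
      · exfalso
        have h := hv x
        have hD0 : D = 0 := by rw [hD, hNe]; rfl
        have h : (nbE F x).card ≤ D := h
        have := Finset.card_pos.2 ⟨y0, mem_nbE.2 hxyF⟩
        omega
      have hsub : R ⊆ starFam (G.neighborFinset u) (nbE R) := by
        intro e
        induction e with
        | _ a b =>
          intro h
          rcases hcov u hu a b h with h' | h'
          · exact mem_starFam (by simpa using h'.symm) (mem_nbE.2 h)
          · exact mem_starFam' (by simpa using h'.symm) (mem_nbE.2 (by rwa [Sym2.eq_swap]))
      exact (Finset.card_le_card hsub).trans
        ((starFam_card_le _ _ M fun z _ => hx z).trans (Nat.mul_le_mul_right _ (hΔ u)))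
    have : D + M ≤ Δ := by omega
    have := Nat.mul_le_mul_left Δ this
    nlinarith
  -- main case
  set I := Finset.univ.filter (fun z => ¬ G.Adj v z ∧ ∀ y ∈ Y, G.Adj y z) with hI
  have hWc : ∀ y ∈ Y, (nbE R y \ I).card + I.card + B.card ≤ Δ := by
    intro y hy
    have d1 : Disjoint (nbE R y \ I) I := Finset.sdiff_disjoint
    have d2 : Disjoint ((nbE R y \ I) ∪ I) B := Finset.disjoint_left.2 fun z hz hz' => by
      have hvz := hNadj (Finset.mem_filter.1 hz').1
      rcases Finset.mem_union.1 hz with h | h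
      · exact (hRm.1 (mem_nbE.1 (Finset.mem_sdiff.1 h).1)).2.2 hvz
      · exact (Finset.mem_filter.1 h).2.1 hvz
    rw [← Finset.card_union_of_disjoint d1, ← Finset.card_union_of_disjoint d2]
    refine (Finset.card_le_card ?_).trans (hΔ y)
    intro z hz
    rw [mem_neighborFinset]
    rcases Finset.mem_union.1 hz with h | h
    · rcases Finset.mem_union.1 h with h | h
      · exact hadj (hRm.1 (mem_nbE.1 (Finset.mem_sdiff.1 h).1)).1
      · exact (Finset.mem_filter.1 h).2.2 y hy
    · exact hYB y hy z h
  have hsub : R ⊆ starFam I (nbE R) ∪ starFam Z (nbE R) ∪ starFam Y (fun y => nbE R y \ I) := by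
    intro e
    induction e with
    | _ a b =>
      intro h
      have hs : s(b, a) ∈ R := by rwa [Sym2.eq_swap]
      obtain ⟨hab, hva, hvb⟩ := hRm.1 h
      simp only [Finset.mem_union]
      by_cases ha : a ∈ I
      · exact Or.inl (Or.inl (mem_starFam ha (mem_nbE.2 h)))
      by_cases hb : b ∈ I
      · exact Or.inl (Or.inl (mem_starFam' hb (mem_nbE.2 hs)))
      by_cases haY : a ∈ Y
      · exact Or.inr (mem_starFam haY (Finset.mem_sdiff.2 ⟨mem_nbE.2 h, hb⟩))
      by_cases hbY : b ∈ Y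
      · exact Or.inr (mem_starFam' hbY (Finset.mem_sdiff.2 ⟨mem_nbE.2 hs, ha⟩))
      by_cases hxa : G.Adj x a
      · exact Or.inl (Or.inr (mem_starFam (Finset.mem_filter.2 ⟨by simpa using hxa, hva, haY⟩)
          (mem_nbE.2 h)))
      by_cases hxb : G.Adj x b
      · exact Or.inl (Or.inr (mem_starFam' (Finset.mem_filter.2 ⟨by simpa using hxb, hvb, hbY⟩)
          (mem_nbE.2 hs)))
      exfalso
      have hnxa : x ≠ a := by rintro rfl; exact hxb (hadj hab)
      have hnxb : x ≠ b := by rintro rfl; exact hxa (hadj hab).symm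
      have hor : ∀ y ∈ Y, G.Adj y a ∨ G.Adj y b := by
        intro y hy
        have hne : s(x, y) ≠ s(a, b) := by
          intro h'
          rw [Sym2.eq_iff] at h'
          tauto
        have hya : y ≠ a := by rintro rfl; exact haY hy
        have hyb : y ≠ b := by rintro rfl; exact hbY hy
        have := hlink _ _ _ _ (hRm.1 (mem_nbE.1 hy)).1 hab hne
        tauto
      have htN := (Finset.mem_filter.1 ht).1
      rcases hcov t htN a b h with hta | htb
      · -- no `y` is adjacent to `a`
        refine hb (Finset.mem_filter.2 ⟨Finset.mem_univ _, hvb, fun y hy => ?_⟩)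
        exact (hor y hy).resolve_left fun hya => htri y a t hya hta (hYB y hy t ht)
      · refine ha (Finset.mem_filter.2 ⟨Finset.mem_univ _, hva, fun y hy => ?_⟩)
        exact (hor y hy).resolve_right fun hyb => htri y b t hyb htb (hYB y hy t ht)
  have hW0 := hWc y0 hy0
  obtain ⟨k, hk⟩ : ∃ k, k + I.card + B.card = Δ := ⟨Δ - I.card - B.card, by omega⟩
  have c1 := starFam_card_le I (nbE R) M fun z _ => hx z
  have c2 := starFam_card_le Z (nbE R) M fun z _ => hx z
  have c3 := starFam_card_le Y (fun y => nbE R y \ I) k fun y hy => by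
    have := hWc y hy
    omega
  have c4 : R.card ≤ I.card * M + Z.card * M + M * k :=
    (Finset.card_le_card hsub).trans ((Finset.card_union_le _ _).trans
      (Nat.add_le_add ((Finset.card_union_le _ _).trans (Nat.add_le_add c1 c2)) c3))
  have c5 : I.card + Z.card + k + M + D ≤ 2 * Δ := by omega
  exact final_arith F.card R.card Δ D M I.card Z.card k h1 c4 c5 hDΔ

/-- Theorem 1.4(1): if `G` is triangle-free with maximum degree `Δ`,
then `ω₂'(G) ≤ (5/4)Δ²`. -/
theorem strongCliqueNumber_le_of_triangleFree {V : Type*} [Fintype V] [DecidableEq V]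
    (G : SimpleGraph V) [DecidableRel G.Adj] (Δ : ℕ) (hΔ : G.maxDegree = Δ)
    (hfree : ¬ G.ContainsSub (cycleGraph 3)) :
    4 * G.strongCliqueNumber ≤ 5 * Δ ^ 2 := by
  have htri : ∀ a b c, G.Adj a b → G.Adj b c → G.Adj a c → False := by
    intro a b c hab hbc hac
    apply hfree
    refine ⟨![a, b, c], ?_, ?_⟩
    · intro i j h
      have := hab.ne
      have := hbc.ne
      have := hac.ne
      fin_cases i <;> fin_cases j <;> simp_all
    · intro i j h
      have hij := h.ne
      have := hab.symm
      have := hbc.symm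
      have := hac.symm
      fin_cases i <;> fin_cases j <;> simp_all
  have hmem : G.strongCliqueNumber ∈
      {n | ∃ F : Finset (Sym2 V), G.IsStrongClique F ∧ F.card = n} := by
    refine Nat.sSup_mem ⟨0, ∅, ⟨by simp, by simp⟩, rfl⟩ ⟨Fintype.card (Sym2 V), ?_⟩
    rintro n ⟨F, -, rfl⟩
    exact Finset.card_le_univ F
  obtain ⟨F, hF, hc⟩ := hmem
  rw [← hc]
  exact clique_bound G Δ (fun v => by
    rw [card_neighborFinset_eq_degree, ← hΔ]; exact G.degree_le_maxDegree v) htri F hF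
end

section
/- Let k ≥ 3 be an integer and let G be a finite simple graph with maximum degree Δ satisfying Δ ≥ 3k² + 10k. If G is C_{2k+1}-free (contains no cycle on 2k+1 vertices as a subgraph), then ω₂'(G) ≤ Δ². -/
open SimpleGraph

set_option linter.unusedSectionVars false

namespace StrongCliqueAux

variable {V : Type*} [Fintype V] [DecidableEq V]

/-- A nodup closed chain yields a copy of a cycle. -/
theorem containsSub_of_list (G : SimpleGraph V) (n : ℕ) (hn : 3 ≤ n) (v : V) (c : List V)
    (hlen : c.length = n) (hnd : c.Nodup) (hch : c.IsChain G.Adj)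
    (hhead : c.head? = some v) (hlast : ∀ w ∈ c.getLast?, G.Adj w v) :
    G.ContainsSub (cycleGraph n) := by
  subst hlen
  have h0 : c.get ⟨0, by omega⟩ = v := by
    rw [List.head?_eq_getElem?] at hhead
    rw [List.getElem?_eq_getElem (by omega)] at hhead
    simpa using hhead
  have hl : G.Adj (c.get ⟨c.length - 1, by omega⟩) v := by
    apply hlast
    rw [List.getLast?_eq_getElem?, List.getElem?_eq_getElem (by omega)]
    simp
  have key : ∀ i j : Fin c.length, (j.val = i.val + 1 ∨ (i.val = c.length - 1 ∧ j.val = 0)) →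
      G.Adj (c.get i) (c.get j) := by
    rintro ⟨i, hi⟩ ⟨j, hj⟩ h
    simp only at h
    rcases h with h | ⟨h, h'⟩
    · subst h
      exact List.isChain_iff_getElem.1 hch i (by omega)
    · subst h h'
      rw [← h0] at hl
      exact hl
  refine ⟨c.get, List.nodup_iff_injective_get.1 hnd, ?_⟩
  intro a b hab
  rw [cycleGraph_adj'] at hab
  rcases hab with h | h
  · apply SimpleGraph.Adj.symm
    apply key
    have ha := a.2
    have hb := b.2
    rw [Fin.sub_def] at h
    simp only at h
    rcases Nat.lt_or_ge (c.length - b.val + a.val) c.length with h1 | h1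
    · rw [Nat.mod_eq_of_lt h1] at h; omega
    · rw [Nat.mod_eq_sub_mod h1, Nat.mod_eq_of_lt (by omega)] at h; omega
  · apply key
    have ha := a.2
    have hb := b.2
    rw [Fin.sub_def] at h
    simp only at h
    rcases Nat.lt_or_ge (c.length - a.val + b.val) c.length with h1 | h1
    · rw [Nat.mod_eq_of_lt h1] at h; omega
    · rw [Nat.mod_eq_sub_mod h1, Nat.mod_eq_of_lt (by omega)] at h; omega

/-- `FPath G F r h W`: a path with `r` edges from `h`, avoiding `W` afterwards, whose last edge
lies in `F`. -/
def FPath (G : SimpleGraph V) (F : Finset (Sym2 V)) : ℕ → V → Finset V → Prop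
  | 0, _, _ => False
  | 1, h, W => ∃ b, b ∉ W ∧ s(h, b) ∈ F
  | r + 2, h, W => ∃ b, b ∉ W ∧ G.Adj h b ∧ FPath G F (r + 1) b (insert b W)

theorem FPath.step {G : SimpleGraph V} {F : Finset (Sym2 V)} {r : ℕ} {h b : V} {W : Finset V}
    (hb : b ∉ W) (hadj : G.Adj h b) (hp : FPath G F r b (insert b W)) :
    FPath G F (r + 1) h W := by
  cases r with
  | zero => exact hp.elim
  | succ r => exact ⟨b, hb, hadj, hp⟩

theorem FPath.exists_list {G : SimpleGraph V} {F : Finset (Sym2 V)} (hF : (F : Set (Sym2 V)) ⊆ G.edgeSet) :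
    ∀ (r : ℕ) (h : V) (W : Finset V), h ∈ W → FPath G F r h W →
    ∃ (p : List V) (a b : V), p.length + 1 = r ∧ (p ++ [a, b]).IsChain G.Adj ∧
      (p ++ [a, b]).Nodup ∧ (p ++ [a]).head? = some h ∧ s(a, b) ∈ F ∧
      ∀ z ∈ p ++ [a, b], z = h ∨ z ∉ W := by
  intro r
  induction r with
  | zero => intro h W _ hp; exact hp.elim
  | succ r ih =>
    intro h W hW hp
    cases r with
    | zero =>
      obtain ⟨b, hb, hbF⟩ := hp
      have hadj : G.Adj h b := hF hbF
      refine ⟨[], h, b, rfl, by simpa using hadj, by simpa using hadj.ne, rfl, hbF, ?_⟩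
      intro z hz
      simp at hz
      rcases hz with rfl | rfl
      · exact Or.inl rfl
      · exact Or.inr hb
    | succ r =>
      obtain ⟨b, hb, hadj, hp'⟩ := hp
      obtain ⟨p, a, c, h1, h2, h3, h4, h5, h6⟩ := ih b (insert b W) (by simp) hp'
      have h6' : ∀ z ∈ p ++ [a, c], z ∉ W := by
        intro z hz
        rcases h6 z hz with rfl | h
        · exact hb
        · exact fun h' => h (Finset.mem_insert_of_mem h')
      refine ⟨h :: p, a, c, by simpa using h1, ?_, ?_, by simp, h5, ?_⟩
      · rw [List.cons_append, List.isChain_cons]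
        refine ⟨?_, h2⟩
        intro y hy
        have : (p ++ [a, c]).head? = some b := by
          cases p <;> simpa using h4
        rw [this] at hy
        simp at hy
        exact hy ▸ hadj
      · rw [List.cons_append, List.nodup_cons]
        exact ⟨fun hm => h6' h hm hW, h3⟩
      · intro z hz
        rw [List.cons_append, List.mem_cons] at hz
        rcases hz with hz | hz
        · exact Or.inl hz
        · exact Or.inr (h6' z hz)

/-- Neighbours in `F`. -/
def nF (F : Finset (Sym2 V)) (w : V) : Finset V := Finset.univ.filter (fun b => s(w, b) ∈ F)

theorem mem_nF {F : Finset (Sym2 V)} {w b : V} : b ∈ nF F w ↔ s(w, b) ∈ F := by simp [nF]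

theorem card_inc_le (F : Finset (Sym2 V)) (w : V) :
    (F.filter (fun e => w ∈ e)).card ≤ (nF F w).card := by
  have : F.filter (fun e => w ∈ e) ⊆ (nF F w).image (fun b => s(w, b)) := by
    intro e he
    rw [Finset.mem_filter] at he
    obtain ⟨he, b, rfl⟩ := he
    exact Finset.mem_image.2 ⟨b, mem_nF.2 he, rfl⟩
  exact (Finset.card_le_card this).trans Finset.card_image_le

theorem cover (F F' : Finset (Sym2 V)) (X : Finset V) (hs : F' ⊆ F)
    (h : ∀ f ∈ F', ∃ w ∈ X, w ∈ f) :
    F'.card ≤ ∑ w ∈ X, (nF F w).card := by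
  have : F' ⊆ X.biUnion (fun w => F.filter (fun e => w ∈ e)) := by
    intro f hf
    obtain ⟨w, hw, hwf⟩ := h f hf
    exact Finset.mem_biUnion.2 ⟨w, hw, Finset.mem_filter.2 ⟨hs hf, hwf⟩⟩
  refine (Finset.card_le_card this).trans (Finset.card_biUnion_le.trans ?_)
  exact Finset.sum_le_sum fun w _ => card_inc_le F w

theorem heavy_count (F : Finset (Sym2 V)) (X : Finset V) (Δ s m : ℕ)
    (hd : ∀ w, (nF F w).card ≤ Δ) (hX : X.card ≤ m) :
    ∑ w ∈ X, (nF F w).card ≤ (X.filter (fun w => s ≤ (nF F w).card)).card * Δ + m * s := by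
  rw [← Finset.sum_filter_add_sum_filter_not X (fun w => s ≤ (nF F w).card)]
  apply Nat.add_le_add
  · exact Finset.sum_le_card_nsmul _ _ _ (fun w _ => hd w)
  · refine (Finset.sum_le_card_nsmul _ _ s ?_).trans ?_
    · intro w hw
      rw [Finset.mem_filter] at hw
      omega
    · exact Nat.mul_le_mul_right _ ((Finset.card_filter_le _ _).trans hX)

theorem exists_notMem {A B : Finset V} (h : B.card < A.card) : ∃ a ∈ A, a ∉ B :=
  Finset.exists_mem_notMem_of_card_lt_card h

/-- Strong clique condition on pairs. -/
theorem clique_pair {G : SimpleGraph V} {F : Finset (Sym2 V)} (hF : G.IsStrongClique F)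
    {a b c d : V} (h1 : s(a, b) ∈ F) (h2 : s(c, d) ∈ F) (hac : a ≠ c) (had : a ≠ d)
    (hbc : b ≠ c) (hbd : b ≠ d) :
    G.Adj a c ∨ G.Adj a d ∨ G.Adj b c ∨ G.Adj b d := by
  have hne : s(a, b) ≠ s(c, d) := by
    intro h
    rw [Sym2.eq_iff] at h
    rcases h with h | h
    · exact hac h.1
    · exact had h.1
  obtain ⟨x, hx, y, hy, h⟩ := hF.2 _ h1 _ h2 hne
  simp only [Sym2.mem_iff] at hx hy
  rcases hx with rfl | rfl <;> rcases hy with rfl | rfl <;> tauto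

/-- Path growth, when many heavy vertices have many heavy neighbours. -/
theorem grow1 {G : SimpleGraph V} [DecidableRel G.Adj] {F : Finset (Sym2 V)}
    (hF : G.IsStrongClique F) (P : ℕ) (Hv Q : Finset V)
    (hHv : ∀ w ∈ Hv, P ≤ (nF F w).card)
    (hQ : ∀ z ∈ Q, z ∈ Hv ∧ P ≤ (G.neighborFinset z ∩ Hv).card)
    (hQP : P ≤ Q.card) :
    ∀ (n : ℕ) (h : V) (W : Finset V), h ∈ Hv → h ∈ W → W.card + (2 * n + 1) ≤ P →
      FPath G F (2 * n + 1) h W := by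
  intro n
  induction n using Nat.strong_induction_on with
  | _ n ih =>
  intro h W hh hW hc
  have hh' := hHv h hh
  obtain ⟨y, hy, hyW⟩ := exists_notMem (A := nF F h) (B := W) (by omega)
  rw [mem_nF] at hy
  rcases n with _ | n
  · exact ⟨y, hyW, hy⟩
  have hWy : (insert y W).card ≤ W.card + 1 := Finset.card_insert_le _ _
  obtain ⟨z, hz, hzW⟩ := exists_notMem (A := Q) (B := insert y W) (by omega)
  obtain ⟨hzH, hzN⟩ := hQ z hz
  have hz' := hHv z hzH
  have hWz : (insert z (insert y W)).card ≤ W.card + 2 := (Finset.card_insert_le _ _).trans (by omega)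
  obtain ⟨y', hy', hyW'⟩ := exists_notMem (A := nF F z) (B := insert z (insert y W)) (by omega)
  rw [mem_nF] at hy'
  simp only [Finset.mem_insert, not_or] at hzW hyW'
  have a1 : G.Adj h y := hF.1 hy
  have a2 : G.Adj z y' := hF.1 hy'
  have c1 : ∀ a b : V, (insert a (insert b W)).card ≤ W.card + 2 := fun a b =>
    (Finset.card_insert_le _ _).trans (by have := Finset.card_insert_le b W; omega)
  have hne1 : h ≠ z := by rintro rfl; exact hzW.2 hW
  have hne2 : h ≠ y' := by rintro rfl; exact hyW'.2.2 hW
  have e1 : 2 * (n + 1) + 1 = (2 * n + 1) + 1 + 1 := by ring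
  rw [e1]
  rcases clique_pair hF hy hy' hne1 hne2 (Ne.symm hzW.1) (Ne.symm hyW'.2.1) with h1 | h1 | h1 | h1
  · obtain ⟨w, hw, hwW⟩ := exists_notMem (A := G.neighborFinset z ∩ Hv) (B := insert z W)
      (by have := Finset.card_insert_le z W; omega)
    rw [Finset.mem_inter, mem_neighborFinset] at hw
    refine FPath.step hzW.2 h1 (FPath.step hwW hw.1 (ih n (by omega) w _ hw.2 (by simp) ?_))
    have := c1 w z; omega
  · refine FPath.step hyW'.2.2 h1 (FPath.step (b := z) ?_ a2.symm (ih n (by omega) z _ hzH (by simp) ?_))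
    · simp [hzW.2, Ne.symm hyW'.1]
    · have := c1 z y'; omega
  · refine FPath.step hyW a1 (FPath.step (b := z) ?_ h1 (ih n (by omega) z _ hzH (by simp) ?_))
    · simp [hzW.2, hzW.1]
    · have := c1 z y; omega
  · refine FPath.step hyW a1 (FPath.step (b := y') ?_ h1 ?_)
    · simp [hyW'.2.2, hyW'.2.1]
    have hzn : z ∉ insert y' (insert y W) := by
      simp [hzW.2, hzW.1, Ne.symm hyW'.1]
    rcases n with _ | n
    · exact ⟨z, hzn, by rwa [Sym2.eq_swap]⟩
    · have e2 : 2 * (n + 1) + 1 = (2 * n + 1) + 1 + 1 := by ring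
      rw [e2]
      have c2 : (insert z (insert y' (insert y W))).card ≤ W.card + 3 :=
        (Finset.card_insert_le _ _).trans (by have := c1 y' y; omega)
      obtain ⟨w, hw, hwW⟩ := exists_notMem (A := G.neighborFinset z ∩ Hv)
        (B := insert z (insert y' (insert y W))) (by omega)
      rw [Finset.mem_inter, mem_neighborFinset] at hw
      refine FPath.step hzn a2.symm (FPath.step hwW hw.1 (ih n (by omega) w _ hw.2 (by simp) ?_))
      have := Finset.card_insert_le w (insert z (insert y' (insert y W))); omega

/-- Path growth, when few heavy vertices have many heavy neighbours. -/
theorem grow2 {G : SimpleGraph V} [DecidableRel G.Adj] {F : Finset (Sym2 V)}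
    (hF : G.IsStrongClique F) (P Δ : ℕ) (Hv Q : Finset V)
    (hHv : ∀ w ∈ Hv, P ≤ (nF F w).card)
    (hQ : ∀ z ∈ Hv, z ∉ Q → (G.neighborFinset z ∩ Hv).card < P)
    (hQP : Q.card < P) (hΔ : 5 * P ≤ Δ)
    (hN : ∀ a b, s(a, b) ∈ F →
      Δ < ((G.neighborFinset a ∪ G.neighborFinset b) ∩ Hv).card + 2 * P) :
    ∀ (n : ℕ) (h : V) (W : Finset V), h ∈ Hv → h ∉ Q → h ∈ W → W.card + (2 * n + 1) ≤ P →
      FPath G F (2 * n + 1) h W := by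
  intro n
  induction n with
  | zero =>
    intro h W hh _ hW hc
    have hh' := hHv h hh
    obtain ⟨y, hy, hyW⟩ := exists_notMem (A := nF F h) (B := W) (by omega)
    exact ⟨y, hyW, mem_nF.1 hy⟩
  | succ n ih =>
    intro h W hh hhQ hW hc
    have hh' := hHv h hh
    obtain ⟨y, hy, hyW⟩ := exists_notMem (A := nF F h) (B := W) (by omega)
    rw [mem_nF] at hy
    have a1 : G.Adj h y := hF.1 hy
    have h1 := hN h y hy
    have h2 := hQ h hh hhQ
    rw [Finset.union_inter_distrib_right] at h1
    have h3 := Finset.card_union_le (G.neighborFinset h ∩ Hv) (G.neighborFinset y ∩ Hv)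
    have h4 : (insert y W ∪ Q).card ≤ W.card + 1 + Q.card :=
      (Finset.card_union_le _ _).trans (by have := Finset.card_insert_le y W; omega)
    obtain ⟨w, hw, hwW⟩ := exists_notMem (A := G.neighborFinset y ∩ Hv) (B := insert y W ∪ Q)
      (by omega)
    rw [Finset.mem_inter, mem_neighborFinset] at hw
    rw [Finset.mem_union, not_or] at hwW
    have e1 : 2 * (n + 1) + 1 = (2 * n + 1) + 1 + 1 := by ring
    rw [e1]
    refine FPath.step hyW a1 (FPath.step hwW.1 hw.1 (ih w _ hw.2 hwW.2 (by simp) ?_))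
    have := Finset.card_insert_le w (insert y W)
    have := Finset.card_insert_le y W
    omega

/-- The cycle obtained from a path and a 5-cycle. -/
theorem close_cycle {G : SimpleGraph V} {F : Finset (Sym2 V)}
    (hF : G.IsStrongClique F) (k : ℕ) (hk : 3 ≤ k) (v x y u' : V) (Ux : Finset V)
    (hxy : s(x, y) ∈ F) (hvx : v ≠ x) (hvy : v ≠ y) (hvu : G.Adj v u') (hyu : G.Adj y u')
    (hxu : x ≠ u')
    (hUx : ∀ u ∈ Ux, G.Adj v u ∧ G.Adj x u ∧ u ≠ y) (hc : 2 * k < Ux.card)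
    (hp : FPath G F (2 * k - 2) v {v, x, y, u'}) : G.ContainsSub (cycleGraph (2 * k + 1)) := by
  obtain ⟨p, a, b, h1, h2, h3, h4, h5, h6⟩ := FPath.exists_list hF.1 _ _ _ (by simp) hp
  have axy : G.Adj x y := hF.1 hxy
  have hav : ∀ z ∈ p ++ [a, b], z ≠ x ∧ z ≠ y ∧ z ≠ u' := by
    intro z hz
    rcases h6 z hz with rfl | h
    · exact ⟨hvx, hvy, hvu.ne⟩
    · simp at h; tauto
  obtain ⟨w, hw, hwp⟩ := exists_notMem (A := Ux) (B := (p ++ [a, b]).toFinset) (by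
    have := List.toFinset_card_le (p ++ [a, b])
    have h7 : (p ++ [a, b]).length = p.length + 2 := by simp
    omega)
  obtain ⟨hvw, hxw, hwy⟩ := hUx w hw
  rw [List.mem_toFinset] at hwp
  have ha := hav a (by simp)
  have hb := hav b (by simp)
  have hpav : ∀ z ∈ p, z ≠ x ∧ z ≠ y ∧ z ≠ u' := fun z hz => hav z (by simp [hz])
  have hpx : x ∉ p := fun h => (hpav x h).1 rfl
  have hpy : y ∉ p := fun h => (hpav y h).2.1 rfl
  have hpu : u' ∉ p := fun h => (hpav u' h).2.2 rfl
  simp only [List.mem_append, List.mem_cons, List.not_mem_nil, or_false, not_or] at hwp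
  -- general closing
  have gen : ∀ c d e : V, G.Adj a c → G.Adj c d → G.Adj d e → G.Adj e v →
      c ∉ p ∧ d ∉ p ∧ e ∉ p → c ≠ a ∧ d ≠ a ∧ e ≠ a → c ≠ d ∧ c ≠ e ∧ d ≠ e →
      G.ContainsSub (cycleGraph (2 * k + 1)) := by
    intro c d e hac hcd hde hev hm hn hn'
    refine containsSub_of_list G (2 * k + 1) (by omega) v (p ++ [a] ++ [c, d, e]) ?_ ?_ ?_ ?_ ?_
    · simp; omega
    · have h3' : (p ++ [a]).Nodup := by
        have : p ++ [a, b] = (p ++ [a]) ++ [b] := by simp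
        rw [this] at h3
        exact (List.nodup_append.1 h3).1
      rw [List.nodup_append]
      refine ⟨h3', by simp; tauto, ?_⟩
      intro z hz z' hz' heq
      subst heq
      simp at hz hz'
      rcases hz' with rfl | rfl | rfl <;> rcases hz with hz | hz <;> tauto
    · have h2' : (p ++ [a]).IsChain G.Adj := by
        have : p ++ [a, b] = (p ++ [a]) ++ [b] := by simp
        rw [this] at h2
        exact (List.isChain_append.1 h2).1
      rw [List.isChain_append]
      refine ⟨h2', by simp [hcd, hde], ?_⟩
      simpa using hac
    · rw [List.head?_append, h4]; rfl
    · simpa using hev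
  have hab : G.Adj a b := hF.1 h5
  have hbp : b ∉ p := by
    intro h
    rw [List.nodup_append] at h3
    exact h3.2.2 b h b (by simp) rfl
  have hwx : w ≠ x := hxw.ne'
  have hyu' := hyu.ne
  have hxy' := axy.ne
  have hab' := hab.ne
  rcases clique_pair hF h5 hxy ha.1 ha.2.1 hb.1 hb.2.1 with h | h | h | h
  · exact gen x y u' h axy hyu hvu.symm (by tauto) (by tauto) (by tauto)
  · exact gen y x w h axy.symm hxw hvw.symm (by tauto) (by tauto) (by tauto)
  · exact gen b x w hab h hxw hvw.symm (by tauto) (by tauto) (by tauto)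
  · exact gen b y u' hab h hyu hvu.symm (by tauto) (by tauto) (by tauto)

/-- Sum over members of an edge. -/
theorem sum_mem_edge (f : V → ℕ) {x y : V} (h : x ≠ y) :
    ∑ z ∈ Finset.univ.filter (fun z => z ∈ s(x, y)), f z = f x + f y := by
  have : Finset.univ.filter (fun z => z ∈ s(x, y)) = {x, y} := by
    ext z; simp
  rw [this, Finset.sum_pair h]

theorem sum_swap (R : Finset (Sym2 V)) (f : V → ℕ) :
    ∑ e ∈ R, ∑ z ∈ Finset.univ.filter (fun z => z ∈ e), f z
      = ∑ z, (R.filter (fun e => z ∈ e)).card * f z := by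
  simp only [Finset.sum_filter]
  rw [Finset.sum_comm]
  refine Finset.sum_congr rfl fun z _ => ?_
  rw [← Finset.sum_filter, Finset.sum_const, smul_eq_mul]

/-- The edges away from `N(v)` number at most `2Δ²/3`. -/
theorem card_far_le {G : SimpleGraph V} [DecidableRel G.Adj] {F : Finset (Sym2 V)}
    (hF : G.IsStrongClique F) (R : Finset (Sym2 V)) (U : Finset V) (Δ d : ℕ) (hd0 : 0 < d)
    (hR : R ⊆ F) (hU : U.card = d) (hdeg : ∀ w, (G.neighborFinset w).card ≤ Δ)
    (hd : ∀ w, (nF F w).card ≤ d)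
    (hr : ∀ z, (R.filter (fun e => z ∈ e)).card + (G.neighborFinset z ∩ U).card ≤ Δ)
    (hcov : ∀ x y, s(x, y) ∈ R → U ⊆ G.neighborFinset x ∪ G.neighborFinset y) :
    3 * R.card ≤ 2 * Δ ^ 2 := by
  set t : V → ℕ := fun z => (G.neighborFinset z ∩ U).card with ht
  set r : V → ℕ := fun z => (R.filter (fun e => z ∈ e)).card with hrdef
  have hsum : ∀ x y, s(x, y) ∈ R → d ≤ t x + t y := by
    intro x y h
    have h1 : U ⊆ (G.neighborFinset x ∩ U) ∪ (G.neighborFinset y ∩ U) := by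
      intro u hu
      have := hcov x y h hu
      rw [Finset.mem_union] at this
      simp only [Finset.mem_union, Finset.mem_inter]
      tauto
    rw [← hU]
    exact (Finset.card_le_card h1).trans (Finset.card_union_le _ _)
  have h1 : R.card * d ≤ ∑ z, r z * t z := by
    rw [← sum_swap R t, ← smul_eq_mul]
    apply Finset.card_nsmul_le_sum
    intro e he
    induction e using Sym2.ind with
    | _ x y =>
      rw [sum_mem_edge t (G.ne_of_adj (hF.1 (hR he)))]
      exact hsum x y he
  have h2 : R.card * d ^ 2 ≤ ∑ z, r z * (2 * t z ^ 2) := by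
    rw [← sum_swap R (fun z => 2 * t z ^ 2), ← smul_eq_mul]
    apply Finset.card_nsmul_le_sum
    intro e he
    induction e using Sym2.ind with
    | _ x y =>
      rw [sum_mem_edge _ (G.ne_of_adj (hF.1 (hR he)))]
      have h := Nat.pow_le_pow_left (hsum x y he) 2
      refine h.trans ?_
      zify
      nlinarith [sq_nonneg ((t x : ℤ) - t y)]
  have h3 : ∑ z, r z * (2 * t z ^ 2) ≤ d * ∑ z, 2 * t z ^ 2 := by
    rw [Finset.mul_sum]
    refine Finset.sum_le_sum fun z _ => Nat.mul_le_mul_right _ ?_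
    refine le_trans ?_ (hd z)
    exact (Finset.card_le_card (Finset.filter_subset_filter _ hR)).trans (card_inc_le F z)
  have h4 : R.card * d ≤ ∑ z, 2 * t z ^ 2 := by
    have : d * (R.card * d) ≤ d * ∑ z, 2 * t z ^ 2 := by
      calc d * (R.card * d) = R.card * d ^ 2 := by ring
        _ ≤ _ := h2.trans h3
    exact Nat.le_of_mul_le_mul_left this hd0
  have h5 : ∑ z, t z ≤ d * Δ := by
    have : ∑ z, t z = ∑ u ∈ U, (G.neighborFinset u).card := by
      have h : ∀ z, t z = ∑ u ∈ U, if G.Adj z u then 1 else 0 := by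
        intro z
        rw [← Finset.card_filter]
        simp only [ht]
        congr 1
        ext u
        simp [and_comm]
      simp only [h]
      rw [Finset.sum_comm]
      refine Finset.sum_congr rfl fun u _ => ?_
      rw [← Finset.card_filter]
      congr 1
      ext z
      simp [G.adj_comm]
    rw [this, ← hU, ← smul_eq_mul]
    exact Finset.sum_le_card_nsmul _ _ _ (fun u _ => hdeg u)
  have h6 : 2 * ∑ z, r z * t z + ∑ z, 2 * t z ^ 2 ≤ 2 * Δ * ∑ z, t z := by
    rw [Finset.mul_sum, Finset.mul_sum, ← Finset.sum_add_distrib]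
    refine Finset.sum_le_sum fun z _ => ?_
    have := Nat.mul_le_mul_right (2 * t z) (hr z)
    calc 2 * (r z * t z) + 2 * t z ^ 2 = (r z + t z) * (2 * t z) := by ring
      _ ≤ Δ * (2 * t z) := this
      _ = _ := by ring
  have h7 : 2 * Δ * ∑ z, t z ≤ 2 * Δ * (d * Δ) := Nat.mul_le_mul_left _ h5
  have h8 : d * (3 * R.card) ≤ d * (2 * Δ ^ 2) := by nlinarith
  exact Nat.le_of_mul_le_mul_left h8 hd0

theorem main {G : SimpleGraph V} [DecidableRel G.Adj] (k : ℕ) (hk : 3 ≤ k) (Δ : ℕ)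
    (hdeg : ∀ w, (G.neighborFinset w).card ≤ Δ) (hΔ' : 3 * k ^ 2 + 10 * k ≤ Δ)
    (hfree : ¬ G.ContainsSub (cycleGraph (2 * k + 1))) {F : Finset (Sym2 V)}
    (hF : G.IsStrongClique F) : F.card ≤ Δ ^ 2 := by
  by_contra! hn
  have hΔk : 19 * k ≤ Δ := by nlinarith
  have hΔk' : 12 * k + 21 ≤ Δ := by nlinarith
  -- a vertex of maximum `F`-degree
  have hFne : F.Nonempty := by
    rw [← Finset.card_pos]; omega
  obtain ⟨e0, he0⟩ := hFne
  obtain ⟨v0, y0, rfl⟩ : ∃ a b, e0 = s(a, b) := by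
    induction e0 using Sym2.ind with
    | _ a b => exact ⟨a, b, rfl⟩
  obtain ⟨v, -, hvmax⟩ := Finset.exists_max_image Finset.univ (fun w => (nF F w).card)
    ⟨v0, Finset.mem_univ _⟩
  set U := nF F v with hUdef
  set d := U.card with hddef
  have hd : ∀ w, (nF F w).card ≤ d := fun w => hvmax w (Finset.mem_univ _)
  have hsub : ∀ w, nF F w ⊆ G.neighborFinset w := by
    intro w b hb
    rw [mem_neighborFinset]
    exact hF.1 (mem_nF.1 hb)
  have hdF : ∀ w, (nF F w).card ≤ Δ := fun w => (Finset.card_le_card (hsub w)).trans (hdeg w)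
  have hdΔ : d ≤ Δ := hdF v
  -- neighbourhoods of an edge of `F` meet all of `F`
  have hcov : ∀ a b, s(a, b) ∈ F →
      F.card ≤ ∑ w ∈ G.neighborFinset a ∪ G.neighborFinset b, (nF F w).card := by
    intro a b hab
    have aab : G.Adj a b := hF.1 hab
    refine cover F F _ subset_rfl fun f hf => ?_
    by_cases hfe : s(a, b) = f
    · exact ⟨a, by simp [aab.symm], by simp [← hfe]⟩
    · obtain ⟨x, hx, y, hy, h⟩ := hF.2 _ hab _ hf hfe
      rw [Sym2.mem_iff] at hx
      rcases h with rfl | h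
      · refine ⟨x, ?_, hy⟩
        rcases hx with rfl | rfl
        · simp [aab.symm]
        · simp [aab]
      · refine ⟨y, ?_, hy⟩
        rcases hx with rfl | rfl <;> simp [h]
  have hcard2 : ∀ a b, (G.neighborFinset a ∪ G.neighborFinset b).card ≤ 2 * Δ := fun a b =>
    (Finset.card_union_le _ _).trans (by have := hdeg a; have := hdeg b; omega)
  have hd2 : Δ < 2 * d := by
    have h1 := hcov _ _ he0
    have h2 := Finset.sum_le_card_nsmul (G.neighborFinset v0 ∪ G.neighborFinset y0)
      (fun w => (nF F w).card) d (fun w _ => hd w)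
    rw [smul_eq_mul] at h2
    have h3 := Nat.mul_le_mul_right d (hcard2 v0 y0)
    by_contra! h
    have : Δ * (2 * d) ≤ Δ * Δ := Nat.mul_le_mul_left _ h
    nlinarith
  -- far edges
  set R := F.filter (fun e => ∀ z ∈ e, z ∉ G.neighborFinset v) with hRdef
  have hRF : R ⊆ F := Finset.filter_subset _ _
  have hsplit : F.card ≤ ∑ w ∈ G.neighborFinset v, (nF F w).card + R.card := by
    have h1 := cover F (F \ R) (G.neighborFinset v) Finset.sdiff_subset (by
      intro f hf
      rw [Finset.mem_sdiff, hRdef, Finset.mem_filter] at hf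
      have h := hf.2
      push Not at h
      obtain ⟨z, hz, hz'⟩ := h hf.1
      exact ⟨z, hz', hz⟩)
    have h2 := Finset.card_sdiff_add_card_eq_card hRF
    omega
  have hRmem : ∀ x y, s(x, y) ∈ R → s(x, y) ∈ F ∧ ¬ G.Adj v x ∧ ¬ G.Adj v y ∧ v ≠ x ∧ v ≠ y := by
    intro x y h
    rw [hRdef, Finset.mem_filter] at h
    have axy : G.Adj x y := hF.1 h.1
    have hx := h.2 x (by simp)
    have hy := h.2 y (by simp)
    rw [mem_neighborFinset] at hx hy
    refine ⟨h.1, hx, hy, ?_, ?_⟩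
    · rintro rfl; exact hy axy
    · rintro rfl; exact hx axy.symm
  have hUv : ∀ u ∈ U, G.Adj v u := fun u hu => hF.1 (mem_nF.1 hu)
  have hRU : ∀ x y, s(x, y) ∈ R → U ⊆ G.neighborFinset x ∪ G.neighborFinset y := by
    intro x y h u hu
    obtain ⟨hxyF, hvx, hvy, hvx', hvy'⟩ := hRmem x y h
    have avu := hUv u hu
    have := clique_pair hF (mem_nF.1 hu) hxyF hvx' hvy'
      (by rintro rfl; exact hvx avu) (by rintro rfl; exact hvy avu)
    simp only [Finset.mem_union, mem_neighborFinset]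
    rcases this with h | h | h | h
    · exact absurd h hvx
    · exact absurd h hvy
    · exact Or.inl h.symm
    · exact Or.inr h.symm
  have hr : ∀ z, (R.filter (fun e => z ∈ e)).card + (G.neighborFinset z ∩ U).card ≤ Δ := by
    intro z
    have h1 := card_inc_le R z
    have hdisj : Disjoint (nF R z) (G.neighborFinset z ∩ U) := by
      rw [Finset.disjoint_left]
      intro b hb hb'
      rw [Finset.mem_inter] at hb'
      exact (hRmem z b (mem_nF.1 hb)).2.2.1 (hUv b hb'.2)
    have h2 : nF R z ∪ (G.neighborFinset z ∩ U) ⊆ G.neighborFinset z := by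
      apply Finset.union_subset
      · intro b hb
        exact hsub z (mem_nF.2 (hRF (mem_nF.1 hb)))
      · exact Finset.inter_subset_left
    have h3 := Finset.card_le_card h2
    rw [Finset.card_union_of_disjoint hdisj] at h3
    have := hdeg z
    omega
  have hR3 : 3 * R.card ≤ 2 * Δ ^ 2 :=
    card_far_le hF R U Δ d (by omega) hRF rfl hdeg hd hr hRU
  -- a far edge neither end of which dominates `U`
  obtain ⟨x, y, hxyR, hxD, hyD⟩ : ∃ x y, s(x, y) ∈ R ∧ ¬ U ⊆ G.neighborFinset x ∧
      ¬ U ⊆ G.neighborFinset y := by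
    by_contra! hcon
    set D := Finset.univ.filter (fun z => U ⊆ G.neighborFinset z) with hD
    have hDc : D.card ≤ Δ := by
      obtain ⟨u, hu⟩ : U.Nonempty := by rw [← Finset.card_pos]; omega
      refine le_trans (Finset.card_le_card ?_) (hdeg u)
      intro z hz
      rw [hD, Finset.mem_filter] at hz
      have := hz.2 hu
      rw [mem_neighborFinset] at this ⊢
      exact this.symm
    have h1 : R.card ≤ ∑ z ∈ D, (R.filter (fun e => z ∈ e)).card := by
      have : R ⊆ D.biUnion (fun z => R.filter (fun e => z ∈ e)) := by
        intro e he
        induction e using Sym2.ind with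
        | _ a b =>
          rw [Finset.mem_biUnion]
          by_cases ha : U ⊆ G.neighborFinset a
          · exact ⟨a, by simp [hD, ha], by simp [he]⟩
          · exact ⟨b, by simp [hD, hcon a b he ha], by simp [he]⟩
      exact (Finset.card_le_card this).trans Finset.card_biUnion_le
    have h2 : ∑ z ∈ D, (R.filter (fun e => z ∈ e)).card ≤ D.card * (Δ - d) := by
      rw [← smul_eq_mul]
      apply Finset.sum_le_card_nsmul
      intro z hz
      rw [hD, Finset.mem_filter] at hz
      have := hr z
      rw [Finset.inter_eq_right.2 hz.2] at this
      omega
    have h3 : D.card * (Δ - d) ≤ Δ * (Δ - d) := Nat.mul_le_mul_right _ hDc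
    have h4 : ∑ w ∈ G.neighborFinset v, (nF F w).card ≤ Δ * d := by
      refine (Finset.sum_le_card_nsmul _ _ d (fun w _ => hd w)).trans ?_
      exact Nat.mul_le_mul_right _ (hdeg v)
    have h5 : Δ * d + Δ * (Δ - d) = Δ ^ 2 := by
      rw [← Nat.mul_add, Nat.add_sub_cancel' hdΔ, sq]
    omega
  -- orient the edge
  obtain ⟨x, y, hxyR, hxD, hUx⟩ : ∃ x y, s(x, y) ∈ R ∧ ¬ U ⊆ G.neighborFinset x ∧
      d ≤ 2 * (G.neighborFinset x ∩ U).card := by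
    have h1 : U ⊆ (G.neighborFinset x ∩ U) ∪ (G.neighborFinset y ∩ U) := by
      intro u hu
      have := hRU x y hxyR hu
      rw [Finset.mem_union] at this
      simp only [Finset.mem_union, Finset.mem_inter]
      tauto
    have h2 := (Finset.card_le_card h1).trans (Finset.card_union_le _ _)
    by_cases h : d ≤ 2 * (G.neighborFinset x ∩ U).card
    · exact ⟨x, y, hxyR, hxD, h⟩
    · exact ⟨y, x, by rwa [Sym2.eq_swap], hyD, by omega⟩
  obtain ⟨u', hu'U, hu'x⟩ := Finset.not_subset.1 hxD
  have hu'y : G.Adj y u' := by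
    have := hRU x y hxyR hu'U
    rw [Finset.mem_union] at this
    rcases this with h | h
    · exact absurd h hu'x
    · rwa [mem_neighborFinset] at h
  obtain ⟨hxyF, hvx, hvy, hvx', hvy'⟩ := hRmem x y hxyR
  apply hfree
  refine close_cycle hF k hk v x y u' (G.neighborFinset x ∩ U) hxyF hvx' hvy' (hUv u' hu'U) hu'y
    (by rintro rfl; exact hvx (hUv _ hu'U)) ?_ (by omega) ?_
  · intro u hu
    rw [Finset.mem_inter, mem_neighborFinset] at hu
    exact ⟨hUv u hu.2, hu.1, by rintro rfl; exact hvy (hUv _ hu.2)⟩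
  -- find the path
  set P := 2 * k + 2 with hP
  set Hv := Finset.univ.filter (fun w => P ≤ (nF F w).card) with hHvdef
  have hHv : ∀ w ∈ Hv, P ≤ (nF F w).card := by
    intro w hw
    rw [hHvdef, Finset.mem_filter] at hw
    exact hw.2
  have hfilt : ∀ X : Finset V, X.filter (fun w => P ≤ (nF F w).card) = X ∩ Hv := by
    intro X; ext w; simp [hHvdef]
  have hN : ∀ a b, s(a, b) ∈ F →
      Δ < ((G.neighborFinset a ∪ G.neighborFinset b) ∩ Hv).card + 2 * P := by
    intro a b hab
    have h1 := hcov a b hab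
    have h2 := heavy_count F _ Δ P (2 * Δ) hdF (hcard2 a b)
    rw [hfilt] at h2
    have h3 : Δ * Δ < Δ * (((G.neighborFinset a ∪ G.neighborFinset b) ∩ Hv).card + 2 * P) := by
      nlinarith
    exact Nat.lt_of_mul_lt_mul_left h3
  have hNv : Δ < 3 * ((G.neighborFinset v ∩ Hv).card + P) := by
    have h2 := heavy_count F _ Δ P Δ hdF (hdeg v)
    rw [hfilt] at h2
    have h3 : Δ * Δ < Δ * (3 * ((G.neighborFinset v ∩ Hv).card + P)) := by
      nlinarith
    exact Nat.lt_of_mul_lt_mul_left h3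
  set Q := Hv.filter (fun z => P ≤ (G.neighborFinset z ∩ Hv).card) with hQdef
  have hW4 : ({v, x, y, u'} : Finset V).card ≤ 4 := Finset.card_le_four
  have er : 2 * k - 2 = (2 * (k - 2) + 1) + 1 := by omega
  rw [er]
  by_cases hQP : P ≤ Q.card
  · obtain ⟨h, hh, hhW⟩ := exists_notMem (A := G.neighborFinset v ∩ Hv)
      (B := ({v, x, y, u'} : Finset V)) (by omega)
    rw [Finset.mem_inter, mem_neighborFinset] at hh
    refine FPath.step hhW hh.1 (grow1 hF P Hv Q hHv ?_ hQP _ _ _ hh.2 (by simp) ?_)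
    · intro z hz
      rw [hQdef, Finset.mem_filter] at hz
      exact hz
    · have := Finset.card_insert_le h ({v, x, y, u'} : Finset V)
      omega
  · push Not at hQP
    have h5 := Finset.card_union_le ({v, x, y, u'} : Finset V) Q
    obtain ⟨h, hh, hhW⟩ := exists_notMem (A := G.neighborFinset v ∩ Hv)
      (B := ({v, x, y, u'} : Finset V) ∪ Q) (by omega)
    rw [Finset.mem_inter, mem_neighborFinset] at hh
    rw [Finset.mem_union, not_or] at hhW
    refine FPath.step hhW.1 hh.1 (grow2 hF P Δ Hv Q hHv ?_ hQP (by omega) hN _ _ _ hh.2 hhW.2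
      (by simp) ?_)
    · intro z hz hzQ
      rw [hQdef, Finset.mem_filter, not_and] at hzQ
      have := hzQ hz
      omega
    · have := Finset.card_insert_le h ({v, x, y, u'} : Finset V)
      omega

end StrongCliqueAux

/-- Theorem 1.4(3): if `k ≥ 3` and `G` is `C_{2k+1}`-free with maximum degree
`Δ ≥ 3k² + 10k`, then `ω₂'(G) ≤ Δ²`. -/
theorem strongCliqueNumber_le_of_oddCycleFree {V : Type*} [Fintype V] [DecidableEq V]
    (k : ℕ) (hk : 3 ≤ k) (G : SimpleGraph V) [DecidableRel G.Adj]
    (Δ : ℕ) (hΔ : G.maxDegree = Δ) (hΔ' : 3 * k ^ 2 + 10 * k ≤ Δ)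
    (hfree : ¬ G.ContainsSub (cycleGraph (2 * k + 1))) :
    G.strongCliqueNumber ≤ Δ ^ 2 := by
  unfold SimpleGraph.strongCliqueNumber
  refine csSup_le ⟨0, ∅, ⟨by simp, by simp⟩, rfl⟩ ?_
  rintro n ⟨F, hF, rfl⟩
  refine StrongCliqueAux.main k hk Δ (fun w => ?_) hΔ' hfree hF
  rw [G.card_neighborFinset_eq_degree, ← hΔ]
  exact G.degree_le_maxDegree w
end

section
/- Let G be a finite simple graph with maximum degree Δ ≥ 4. If G is C₄-free (contains no cycle on 4 vertices as a subgraph), then ω₂'(G) ≤ 3(Δ − 1). -/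
open SimpleGraph

namespace SCProof

variable {V : Type*} [Fintype V] [DecidableEq V] (G : SimpleGraph V) [DecidableRel G.Adj]

/-- usable form of C4-freeness -/
def NoC4 : Prop := ∀ a b c d : V, a ≠ c → b ≠ d → G.Adj a b → G.Adj b c → G.Adj c d →
  G.Adj d a → False

theorem noC4_of (hfree : ¬ G.ContainsSub (cycleGraph 4)) : NoC4 G := by
  intro a b c d hac hbd hab hbc hcd hda
  apply hfree
  refine ⟨![a, b, c, d], ?_, ?_⟩
  · have h1 := hab.ne
    have h2 := hbc.ne
    have h3 := hcd.ne
    have h4 := hda.ne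
    intro i j
    fin_cases i <;> fin_cases j <;> simp <;> grind
  · intro i j h
    have h1 := hab.symm
    have h2 := hbc.symm
    have h3 := hcd.symm
    have h4 := hda.symm
    fin_cases i <;> fin_cases j <;> first | assumption | (exfalso; revert h; simp [cycleGraph_adj]; try decide)

/-- strong clique in pair form -/
def Cl (F : Finset (Sym2 V)) : Prop :=
  (∀ x y, s(x, y) ∈ F → G.Adj x y) ∧
  ∀ x y z w, s(x, y) ∈ F → s(z, w) ∈ F → s(x, y) ≠ s(z, w) →
    (x = z ∨ x = w ∨ y = z ∨ y = w) ∨ G.Adj x z ∨ G.Adj x w ∨ G.Adj y z ∨ G.Adj y w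

theorem cl_of (F : Finset (Sym2 V)) (h : G.IsStrongClique F) : Cl G F := by
  refine ⟨fun x y hxy => h.1 hxy, ?_⟩
  intro x y z w h1 h2 h3
  obtain ⟨p, hp, q, hq, hpq⟩ := h.2 _ h1 _ h2 h3
  simp only [Sym2.mem_iff] at hp hq
  rcases hp with rfl | rfl <;> rcases hq with rfl | rfl <;> tauto

def I (F : Finset (Sym2 V)) (v : V) : Finset (Sym2 V) := F.filter (fun e => v ∈ e)
def M (F : Finset (Sym2 V)) (v : V) : Finset (Sym2 V) := F.filter (fun e => ∀ x ∈ e, G.Adj v x)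
def P (F : Finset (Sym2 V)) (v : V) : Finset (V × V) :=
  Finset.univ.filter (fun p => s(p.1, p.2) ∈ F ∧ G.Adj v p.1 ∧ p.2 ≠ v ∧ ¬ G.Adj v p.2)
def Far (F : Finset (Sym2 V)) (v : V) : Finset (Sym2 V) :=
  F.filter (fun e => ∀ x ∈ e, x ≠ v ∧ ¬ G.Adj v x)

theorem mem_P {F : Finset (Sym2 V)} {v x y : V} :
    (x, y) ∈ P G F v ↔ s(x, y) ∈ F ∧ G.Adj v x ∧ y ≠ v ∧ ¬ G.Adj v y := by
  simp [P]

theorem decomp (F : Finset (Sym2 V)) (v : V) :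
    F.card ≤ (I F v).card + (M G F v).card + (P G F v).card + (Far G F v).card := by
  have hsub : F ⊆ I F v ∪ M G F v ∪ (P G F v).image (fun p => s(p.1, p.2)) ∪ Far G F v := by
    intro e
    induction e with
    | _ x y =>
    intro he
    simp only [Finset.mem_union, I, M, Far, Finset.mem_filter, Finset.mem_image, he, true_and,
      Sym2.mem_iff]
    by_cases hx : v = x
    · simp [hx]
    by_cases hy : v = y
    · simp [hy]
    by_cases ax : G.Adj v x <;> by_cases ay : G.Adj v y
    · left; left; right
      rintro z (rfl | rfl) <;> assumption
    · left; right
      exact ⟨(x, y), (mem_P G).2 ⟨he, ax, fun h => hy h.symm, ay⟩, rfl⟩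
    · left; right
      exact ⟨(y, x), (mem_P G).2 ⟨by rwa [Sym2.eq_swap], ay, fun h => hx h.symm, ax⟩, Sym2.eq_swap⟩
    · right
      rintro z (rfl | rfl)
      · exact ⟨fun h => hx h.symm, ax⟩
      · exact ⟨fun h => hy h.symm, ay⟩
  calc F.card ≤ _ := Finset.card_le_card hsub
    _ ≤ _ := by
      refine (Finset.card_union_le _ _).trans (Nat.add_le_add_right ?_ _)
      refine (Finset.card_union_le _ _).trans (Nat.add_le_add ?_ Finset.card_image_le)
      exact Finset.card_union_le _ _

theorem I_le (F : Finset (Sym2 V)) (hF : Cl G F) (v : V) : (I F v).card ≤ G.degree v := by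
  rw [← G.card_incidenceFinset_eq_degree v]
  apply Finset.card_le_card
  intro e
  induction e with
  | _ x y =>
  intro he
  simp only [I, Finset.mem_filter] at he
  rw [SimpleGraph.mem_incidenceFinset]
  exact ⟨hF.1 _ _ he.1, he.2⟩

theorem M_le (hc : NoC4 G) (F : Finset (Sym2 V)) (hF : Cl G F) (v : V) : (M G F v).card ≤ 1 := by
  rw [Finset.card_le_one]
  intro e he f hf
  induction e with
  | _ x y =>
  induction f with
  | _ z w =>
  simp only [M, Finset.mem_filter, Sym2.mem_iff, forall_eq_or_imp, forall_eq] at he hf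
  obtain ⟨he, hx, hy⟩ := he
  obtain ⟨hf, hz, hw⟩ := hf
  by_contra hne
  have axy := hF.1 _ _ he
  have azw := hF.1 _ _ hf
  -- in N(v) degrees are at most one
  have key : ∀ a b c, G.Adj v a → G.Adj v b → G.Adj v c → G.Adj a b → G.Adj a c → b = c := by
    intro a b c ha hb hc' hab hac
    by_contra hbc
    exact hc v b a c ha.ne hbc hb hab.symm hac hc'.symm
  have sxy := axy.symm
  have szw := azw.symm
  have hne' : ¬ (x = z ∧ y = w) ∧ ¬ (x = w ∧ y = z) := by
    rw [Sym2.eq_iff] at hne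
    tauto
  rcases hF.2 _ _ _ _ he hf hne with (h | h | h | h) | h | h | h | h
  · subst h; have := key _ _ _ hx hy hw axy azw; tauto
  · subst h; have := key _ _ _ hx hy hz axy szw; tauto
  · subst h; have := key _ _ _ hy hx hw sxy azw; tauto
  · subst h; have := key _ _ _ hy hx hz sxy szw; tauto
  · have e1 := key _ _ _ hx hy hz axy h
    have e2 := key _ _ _ hz hw hx azw h.symm
    exact hne'.2 ⟨e2.symm, e1⟩
  · have e1 := key _ _ _ hx hy hw axy h
    have e2 := key _ _ _ hw hz hx szw h.symm
    exact hne'.1 ⟨e2.symm, e1⟩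
  · have e1 := key _ _ _ hy hx hz sxy h
    have e2 := key _ _ _ hz hw hy azw h.symm
    exact hne'.1 ⟨e1, e2.symm⟩
  · have e1 := key _ _ _ hy hx hw sxy h
    have e2 := key _ _ _ hw hz hy szw h.symm
    exact hne'.2 ⟨e1, e2.symm⟩

/-- outer ends over distinct inner ends are distinct -/
theorem P_ne (hc : NoC4 G) {F : Finset (Sym2 V)} (hF : Cl G F) {v x y x' y' : V}
    (h : (x, y) ∈ P G F v) (h' : (x', y') ∈ P G F v) (hx : x ≠ x') : y ≠ y' := by
  rw [mem_P] at h h'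
  rintro rfl
  exact hc v x y x' h.2.2.1.symm hx h.2.1 (hF.1 _ _ h.1) (hF.1 _ _ h'.1).symm h'.2.1.symm

theorem P_adj (hc : NoC4 G) {F : Finset (Sym2 V)} (hF : Cl G F) {v x y x' y' : V}
    (h : (x, y) ∈ P G F v) (h' : (x', y') ∈ P G F v) (hx : x ≠ x') (ha : ¬ G.Adj x x') :
    G.Adj y y' := by
  have hyy := P_ne G hc hF h h' hx
  rw [mem_P] at h h'
  obtain ⟨h1, h2, h3, h4⟩ := h
  obtain ⟨h1', h2', h3', h4'⟩ := h'
  have a1 := hF.1 _ _ h1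
  have a2 := hF.1 _ _ h1'
  have hne : s(x, y) ≠ s(x', y') := by
    rw [Ne, Sym2.eq_iff]
    rintro (⟨h, -⟩ | ⟨h, -⟩)
    · exact hx h
    · subst h; exact h4' h2
  rcases hF.2 _ _ _ _ h1 h1' hne with (h | h | h | h) | h | h | h | h
  · exact absurd h hx
  · subst h; exact absurd h2 h4'
  · subst h; exact absurd h2' h4
  · exact absurd h hyy
  · exact absurd h ha
  · exact (hc v x y' x' h3'.symm hx h2 h a2.symm h2'.symm).elim
  · exact (hc v x y x' h3.symm hx h2 a1 h h2'.symm).elim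
  · exact h

theorem P_single (hc : NoC4 G) {F : Finset (Sym2 V)} (hF : Cl G F) {v x y x' y' z : V}
    (h : (x, y) ∈ P G F v) (h' : (x', y') ∈ P G F v) (hx : x ≠ x') (ha : ¬ G.Adj x x')
    (hz : (x, z) ∈ P G F v) : z = y := by
  have a1 := P_adj G hc hF h h' hx ha
  have a2 := P_adj G hc hF hz h' hx ha
  by_contra hne
  have b1 := hF.1 _ _ ((mem_P G).1 h).1
  have b2 := hF.1 _ _ ((mem_P G).1 hz).1
  have hxy' : x ≠ y' := by
    rintro rfl
    exact ((mem_P G).1 h').2.2.2 ((mem_P G).1 h).2.1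
  exact hc x z y' y hxy' hne b2 a2 a1.symm b1.symm

theorem P_struct_aux (hc : NoC4 G) {F : Finset (Sym2 V)} (hF : Cl G F) (v : V)
    (h4 : 4 ≤ (P G F v).card) : ∀ x y x' y', (x, y) ∈ P G F v → (x', y') ∈ P G F v →
      x = x' ∨ G.Adj x x' := by
  intro x y x' y' hp hq
  by_contra hcon
  push Not at hcon
  obtain ⟨hx, ha⟩ := hcon
  have ha' : ¬ G.Adj x' x := fun h => ha h.symm
  have hcard : 2 ≤ (((P G F v).erase (x, y)).erase (x', y')).card := by
    have := Finset.pred_card_le_card_erase (s := P G F v) (a := (x, y))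
    have := Finset.pred_card_le_card_erase (s := (P G F v).erase (x, y)) (a := (x', y'))
    omega
  obtain ⟨⟨x1, y1⟩, hr, ⟨x2, y2⟩, hs, hrs⟩ := Finset.one_lt_card.1 hcard
  simp only [Finset.mem_erase] at hr hs
  obtain ⟨hr1, hr2, hr⟩ := hr
  obtain ⟨hs1, hs2, hs⟩ := hs
  have n1 : x1 ≠ x := by
    rintro rfl
    exact hr2 (by rw [P_single G hc hF hp hq hx ha hr])
  have n2 : x1 ≠ x' := by
    rintro rfl
    exact hr1 (by rw [P_single G hc hF hq hp hx.symm ha' hr])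
  have n3 : x2 ≠ x := by
    rintro rfl
    exact hs2 (by rw [P_single G hc hF hp hq hx ha hs])
  have n4 : x2 ≠ x' := by
    rintro rfl
    exact hs1 (by rw [P_single G hc hF hq hp hx.symm ha' hs])
  have key : ∀ a b c, G.Adj v a → G.Adj v b → G.Adj v c → b ≠ c → G.Adj a b → ¬ G.Adj a c := by
    intro a b c ha hb hc' hbc hab hac
    exact hc v b a c ha.ne hbc hb hab.symm hac hc'.symm
  have vx := ((mem_P G).1 hp).2.1
  have vx' := ((mem_P G).1 hq).2.1
  have v1 := ((mem_P G).1 hr).2.1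
  have v2 := ((mem_P G).1 hs).2.1
  have n5 : x1 ≠ x2 := by
    rintro rfl
    by_cases h : G.Adj x1 x
    · have h' := key _ _ _ v1 vx vx' hx h
      exact hrs (by rw [P_single G hc hF hr hq n2 h' hs])
    · exact hrs (by rw [P_single G hc hF hr hp n1 h hs])
  have yq := P_ne G hc hF hp hq hx
  have yr := P_ne G hc hF hp hr n1.symm
  have ys := P_ne G hc hF hp hs n3.symm
  have yqr := P_ne G hc hF hq hr n2.symm
  have yqs := P_ne G hc hF hq hs n4.symm
  have yrs := P_ne G hc hF hr hs n5
  have A1 := P_adj G hc hF hp hq hx ha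
  have A2 := P_adj G hc hF hp hr n1.symm
  have A3 := P_adj G hc hF hp hs n3.symm
  have A4 := P_adj G hc hF hq hr n2.symm
  have A5 := P_adj G hc hF hq hs n4.symm
  have A6 := P_adj G hc hF hr hs n5
  by_cases c1 : G.Adj x x1
  · have d1 := key _ _ _ vx v1 v2 n5 c1
    have d2 := key _ _ _ v1 vx vx' hx c1.symm
    have d3 := key _ _ _ v1 vx v2 n3.symm c1.symm
    exact hc y y' y1 y2 yr yqs A1 (A4 fun h => d2 h.symm) (A6 d3) (A3 d1).symm
  by_cases c2 : G.Adj x x2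
  · have d2 := key _ _ _ v2 vx vx' hx c2.symm
    have d3 := key _ _ _ v2 vx v1 n1.symm c2.symm
    exact hc y y' y2 y1 ys yqr A1 (A5 fun h => d2 h.symm) (A6 fun h => d3 h.symm).symm (A2 c1).symm
  by_cases c3 : G.Adj x' x1
  · have d1 := key _ _ _ vx' v1 v2 n5 c3
    have d3 := key _ _ _ v1 vx' v2 n4.symm c3.symm
    exact hc y' y y1 y2 yqr ys A1.symm (A2 c1) (A6 d3) (A5 d1).symm
  by_cases c4 : G.Adj x' x2
  · have d3 := key _ _ _ v2 vx' v1 n2.symm c4.symm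
    exact hc y' y y2 y1 yqs yr A1.symm (A3 c2) (A6 fun h => d3 h.symm).symm (A4 c3).symm
  exact hc y y1 y' y2 yq yrs (A2 c1) (A4 c3).symm (A5 c4) (A3 c2).symm

def fib (F : Finset (Sym2 V)) (v x : V) : Finset (V × V) := (P G F v).filter (fun p => p.1 = x)

theorem P_struct (hc : NoC4 G) {F : Finset (Sym2 V)} (hF : Cl G F) (v : V) :
    (P G F v).card ≤ 3 ∨ (∃ x, (P G F v).card ≤ (fib G F v x).card ∧ G.Adj v x) ∨
    ∃ x x', G.Adj v x ∧ G.Adj v x' ∧ G.Adj x x' ∧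
      (P G F v).card ≤ (fib G F v x).card + (fib G F v x').card := by
  by_cases h4 : (P G F v).card ≤ 3
  · exact Or.inl h4
  right
  have h4 : 4 ≤ (P G F v).card := by omega
  have aux := P_struct_aux G hc hF v h4
  obtain ⟨⟨x, y⟩, hp⟩ := Finset.card_pos.1 (show 0 < (P G F v).card by omega)
  have vx := ((mem_P G).1 hp).2.1
  by_cases hall : ∀ q ∈ P G F v, q.1 = x
  · left
    refine ⟨x, Finset.card_le_card ?_, vx⟩
    intro q hq
    simp [fib, hq, hall q hq]
  · right
    push Not at hall
    obtain ⟨⟨x', y'⟩, hq, hne⟩ := hall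
    have vx' := ((mem_P G).1 hq).2.1
    have axx : G.Adj x x' := (aux _ _ _ _ hp hq).resolve_left (fun h => hne h.symm)
    refine ⟨x, x', vx, vx', axx, ?_⟩
    refine le_trans (Finset.card_le_card ?_) (Finset.card_union_le _ _)
    rintro ⟨z, w⟩ hz
    simp only [fib, Finset.mem_union, Finset.mem_filter, hz, true_and]
    by_contra hcon
    push Not at hcon
    have a1 := (aux _ _ _ _ hp hz).resolve_left (fun h => hcon.1 h.symm)
    have a2 := (aux _ _ _ _ hq hz).resolve_left (fun h => hcon.2 h.symm)
    exact hc v x z x' ((mem_P G).1 hz).2.1.ne axx.ne vx a1 a2.symm vx'.symm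

theorem fib_le_I (F : Finset (Sym2 V)) (v x : V) : (fib G F v x).card ≤ (I F x).card := by
  apply Finset.card_le_card_of_injOn (fun p => s(x, p.2))
  · rintro ⟨a, b⟩ h
    simp only [fib, Finset.coe_filter, Set.mem_ofPred_eq] at h
    obtain ⟨h, rfl⟩ := h
    simp [I, ((mem_P G).1 h).1]
  · rintro ⟨a, b⟩ h ⟨a', b'⟩ h' heq
    simp only [fib, Finset.coe_filter, Set.mem_ofPred_eq] at h h'
    simp only [Sym2.congr_right] at heq
    rw [h.2, h'.2, heq]

theorem fib_le_of {F : Finset (Sym2 V)} (hF : Cl G F) (v x : V) (S : Finset V)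
    (hS : ∀ y, G.Adj x y → y ≠ v → ¬ G.Adj v y → y ∈ S) : (fib G F v x).card ≤ S.card := by
  apply Finset.card_le_card_of_injOn (fun p => p.2)
  · rintro ⟨a, b⟩ h
    simp only [fib, Finset.coe_filter, Set.mem_ofPred_eq] at h
    obtain ⟨h, rfl⟩ := h
    have := (mem_P G).1 h
    exact hS _ (hF.1 _ _ this.1) this.2.2.1 this.2.2.2
  · rintro ⟨a, b⟩ h ⟨a', b'⟩ h' heq
    simp only [fib, Finset.coe_filter, Set.mem_ofPred_eq] at h h'
    simp only at heq
    rw [h.2, h'.2, heq]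

theorem fib_le1 {F : Finset (Sym2 V)} (hF : Cl G F) (v x : V) (hvx : G.Adj v x) :
    (fib G F v x).card ≤ G.degree x - 1 := by
  rw [← G.card_neighborFinset_eq_degree x,
    ← Finset.card_erase_of_mem ((G.mem_neighborFinset x v).2 hvx.symm)]
  apply fib_le_of G hF
  intro y h1 h2 h3
  simp [h1, h2]

theorem fib_le2 {F : Finset (Sym2 V)} (hF : Cl G F) (v x x' : V) (hvx : G.Adj v x)
    (hvx' : G.Adj v x') (hxx : G.Adj x x') :
    (fib G F v x).card ≤ G.degree x - 2 := by
  have h : G.degree x - 2 = (((G.neighborFinset x).erase v).erase x').card := by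
    rw [Finset.card_erase_of_mem, Finset.card_erase_of_mem, G.card_neighborFinset_eq_degree]
    · omega
    · simpa using hvx.symm
    · simp [hxx, hvx'.ne.symm]
  rw [h]
  apply fib_le_of G hF
  intro y h1 h2 h3
  have : y ≠ x' := by rintro rfl; exact h3 hvx'
  simp [h1, h2, this]

theorem mem_I_exists {F : Finset (Sym2 V)} {v : V} {e : Sym2 V} (h : e ∈ I F v) :
    ∃ a, e = s(v, a) ∧ s(v, a) ∈ F := by
  simp only [I, Finset.mem_filter] at h
  obtain ⟨h, a, rfl⟩ := h
  exact ⟨a, rfl, h⟩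

theorem far_link {F : Finset (Sym2 V)} (hF : Cl G F) {v a x y : V} (ha : s(v, a) ∈ F)
    (h : s(x, y) ∈ Far G F v) : G.Adj a x ∨ G.Adj a y := by
  simp only [Far, Finset.mem_filter, Sym2.mem_iff, forall_eq_or_imp, forall_eq] at h
  obtain ⟨h, ⟨hx, hx'⟩, hy, hy'⟩ := h
  have hva := hF.1 _ _ ha
  have hne : s(v, a) ≠ s(x, y) := by
    rw [Ne, Sym2.eq_iff]
    rintro (⟨h, -⟩ | ⟨h, -⟩)
    · exact hx h.symm
    · exact hy h.symm
  rcases hF.2 _ _ _ _ ha h hne with (h | h | h | h) | h | h | h | h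
  · exact absurd h.symm hx
  · exact absurd h.symm hy
  · subst h; exact absurd hva hx'
  · subst h; exact absurd hva hy'
  · exact absurd h hx'
  · exact absurd h hy'
  · exact Or.inl h
  · exact Or.inr h

theorem far_one (hc : NoC4 G) {v a b x : V} (hx : x ≠ v) (ha : G.Adj v a)
    (hb : G.Adj v b) (hab : a ≠ b) (h1 : G.Adj a x) : ¬ G.Adj b x :=
  fun h2 => hc v a x b hx.symm hab ha h1 h2.symm hb.symm

theorem far_zero (hc : NoC4 G) {F : Finset (Sym2 V)} (hF : Cl G F) (v : V)
    (h3 : 3 ≤ (I F v).card) : (Far G F v).card = 0 := by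
  rw [Finset.card_eq_zero, Finset.eq_empty_iff_forall_notMem]
  intro e he
  obtain ⟨e1, e2, e3, h1, h2, h3, n12, n13, n23⟩ := Finset.two_lt_card_iff.1 h3
  obtain ⟨a, rfl, ha⟩ := mem_I_exists h1
  obtain ⟨b, rfl, hb⟩ := mem_I_exists h2
  obtain ⟨c, rfl, hcF⟩ := mem_I_exists h3
  have nab : a ≠ b := fun h => n12 (by rw [h])
  have nac : a ≠ c := fun h => n13 (by rw [h])
  have nbc : b ≠ c := fun h => n23 (by rw [h])
  induction e with
  | _ x y =>
  have la := far_link G hF ha he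
  have lb := far_link G hF hb he
  have lc := far_link G hF hcF he
  simp only [Far, Finset.mem_filter, Sym2.mem_iff, forall_eq_or_imp, forall_eq] at he
  obtain ⟨-, ⟨hx, -⟩, hy, -⟩ := he
  have va := hF.1 _ _ ha
  have vb := hF.1 _ _ hb
  have vc := hF.1 _ _ hcF
  have := far_one G hc hx va vb nab
  have := far_one G hc hy va vb nab
  have := far_one G hc hx va vc nac
  have := far_one G hc hy va vc nac
  have := far_one G hc hx vb vc nbc
  have := far_one G hc hy vb vc nbc
  clear hc hF n12 n13 n23
  grind

theorem far_two (hc : NoC4 G) {F : Finset (Sym2 V)} (hF : Cl G F) (v : V)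
    (h2 : 2 ≤ (I F v).card) : (Far G F v).card ≤ 2 := by
  by_contra hcon
  obtain ⟨e1, h1, e2, h2, n12⟩ := Finset.one_lt_card.1 h2
  obtain ⟨a, rfl, ha⟩ := mem_I_exists h1
  obtain ⟨b, rfl, hb⟩ := mem_I_exists h2
  have nab : a ≠ b := fun h => n12 (by rw [h])
  have va := hF.1 _ _ ha
  have vb := hF.1 _ _ hb
  have orient : ∀ e ∈ Far G F v, ∃ x y, e = s(x, y) ∧ s(x, y) ∈ F ∧ G.Adj a x ∧ G.Adj b y ∧
      ¬ G.Adj b x ∧ ¬ G.Adj a y ∧ x ≠ b ∧ y ≠ a := by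
    intro e he
    induction e with
    | _ x y =>
    have la := far_link G hF ha he
    have lb := far_link G hF hb he
    simp only [Far, Finset.mem_filter, Sym2.mem_iff, forall_eq_or_imp, forall_eq] at he
    obtain ⟨he, ⟨hx, hx'⟩, hy, hy'⟩ := he
    have f1 := far_one G hc hx va vb nab
    have f2 := far_one G hc hy va vb nab
    have xb : x ≠ b := by rintro rfl; exact hx' vb
    have yb : y ≠ b := by rintro rfl; exact hy' vb
    have xa : x ≠ a := by rintro rfl; exact hx' va
    have ya : y ≠ a := by rintro rfl; exact hy' va
    rcases la with la | la
    · exact ⟨x, y, rfl, he, la, by tauto, by tauto, by tauto, xb, ya⟩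
    · exact ⟨y, x, Sym2.eq_swap, by rwa [Sym2.eq_swap], la, by tauto, by tauto, by tauto, yb, xa⟩
  have link : ∀ x y x' y', s(x, y) ∈ F → G.Adj a x → G.Adj b y → ¬ G.Adj b x → ¬ G.Adj a y →
      x ≠ b → y ≠ a → s(x', y') ∈ F → G.Adj a x' → G.Adj b y' → ¬ G.Adj b x' → ¬ G.Adj a y' →
      x' ≠ b → y' ≠ a → s(x, y) ≠ s(x', y') → x ≠ x' ∧ y ≠ y' ∧ (G.Adj x x' ∨ G.Adj y y') := by
    intro x y x' y' h ax bx nbx nay xb ya h' ax' bx' nbx' nay' xb' ya' hne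
    have xy := hF.1 _ _ h
    have xy' := hF.1 _ _ h'
    have hx : x ≠ x' := by
      rintro rfl
      have : y ≠ y' := by rintro rfl; exact hne rfl
      exact hc x y b y' xb this xy bx.symm bx' xy'.symm
    have hy : y ≠ y' := by
      rintro rfl
      exact hc y x a x' ya hx xy.symm ax.symm ax' xy'
    refine ⟨hx, hy, ?_⟩
    rcases hF.2 _ _ _ _ h h' hne with (h | h | h | h) | h | h | h | h
    · exact absurd h hx
    · subst h; exact absurd bx' nbx
    · subst h; exact absurd ax' nay
    · exact absurd h hy
    · exact Or.inl h
    · exact (hc a x y' x' ya'.symm hx ax h xy'.symm ax'.symm).elim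
    · exact (hc a x y x' ya.symm hx ax xy h ax'.symm).elim
    · exact Or.inr h
  have hcard : 2 < (Far G F v).card := by omega
  obtain ⟨e1, e2, e3, h1, h2, h3, n12, n13, n23⟩ := Finset.two_lt_card_iff.1 hcard
  obtain ⟨x1, y1, rfl, f1, a1, b1, c1, d1, p1, q1⟩ := orient _ h1
  obtain ⟨x2, y2, rfl, f2, a2, b2, c2, d2, p2, q2⟩ := orient _ h2
  obtain ⟨x3, y3, rfl, f3, a3, b3, c3, d3, p3, q3⟩ := orient _ h3
  obtain ⟨x12, y12, l12⟩ := link _ _ _ _ f1 a1 b1 c1 d1 p1 q1 f2 a2 b2 c2 d2 p2 q2 n12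
  obtain ⟨x13, y13, l13⟩ := link _ _ _ _ f1 a1 b1 c1 d1 p1 q1 f3 a3 b3 c3 d3 p3 q3 n13
  obtain ⟨x23, y23, l23⟩ := link _ _ _ _ f2 a2 b2 c2 d2 p2 q2 f3 a3 b3 c3 d3 p3 q3 n23
  have key : ∀ u p q r, G.Adj u p → G.Adj u q → G.Adj u r → q ≠ r → G.Adj p q → ¬ G.Adj p r := by
    intro u p q r hp hq hr hqr h1 h2
    exact hc u q p r hp.ne hqr hq h1.symm h2 hr.symm
  have k1 := key a x1 x2 x3 a1 a2 a3 x23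
  have k2 := key a x2 x1 x3 a2 a1 a3 x13
  have k3 := key a x3 x1 x2 a3 a1 a2 x12
  have k4 := key b y1 y2 y3 b1 b2 b3 y23
  have k5 := key b y2 y1 y3 b2 b1 b3 y13
  have k6 := key b y3 y1 y2 b3 b1 b2 y12
  rw [G.adj_comm x2 x1] at k2
  rw [G.adj_comm x3 x1, G.adj_comm x3 x2] at k3
  rw [G.adj_comm y2 y1] at k5
  rw [G.adj_comm y3 y1, G.adj_comm y3 y2] at k6
  clear link orient key hc hF
  rcases l12 with l12 | l12 <;> rcases l13 with l13 | l13 <;> rcases l23 with l23 | l23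
  · exact k1 l12 l13
  · exact k1 l12 l13
  · exact k2 l12 l23
  · exact k6 l13 l23
  · exact k3 l13 l23
  · exact k5 l12 l23
  · exact k4 l12 l13
  · exact k4 l12 l13

/-- far edges of `v` are near edges of `u`, when `uv ∈ F` -/
theorem far_matching {F : Finset (Sym2 V)} (hF : Cl G F) (v u : V)
    (huv : s(v, u) ∈ F) : (Far G F v).card ≤ (M G F u).card + (P G F u).card := by
  have hsub : Far G F v ⊆ M G F u ∪ (P G F u).image (fun p => s(p.1, p.2)) := by
    intro e he
    induction e with
    | _ x y =>
    have l := far_link G hF huv he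
    simp only [Far, Finset.mem_filter, Sym2.mem_iff, forall_eq_or_imp, forall_eq] at he
    obtain ⟨he, ⟨hx, hx'⟩, hy, hy'⟩ := he
    have vu := hF.1 _ _ huv
    have xu : x ≠ u := by rintro rfl; exact hx' vu
    have yu : y ≠ u := by rintro rfl; exact hy' vu
    simp only [Finset.mem_union, M, Finset.mem_filter, Finset.mem_image, he, true_and,
      Sym2.mem_iff]
    by_cases ax : G.Adj u x <;> by_cases ay : G.Adj u y
    · left
      rintro z (rfl | rfl) <;> assumption
    · right
      exact ⟨(x, y), (mem_P G).2 ⟨he, ax, yu, ay⟩, rfl⟩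
    · right
      exact ⟨(y, x), (mem_P G).2 ⟨by rwa [Sym2.eq_swap], ay, xu, ax⟩, Sym2.eq_swap⟩
    · tauto
  refine (Finset.card_le_card hsub).trans ((Finset.card_union_le _ _).trans ?_)
  exact Nat.add_le_add_left Finset.card_image_le _

theorem P_le_K (hc : NoC4 G) {F : Finset (Sym2 V)} (hF : Cl G F) (v : V) (K : ℕ)
    (hK : ∀ x, (I F x).card ≤ K) : (P G F v).card ≤ max 3 (2 * K) := by
  rcases P_struct G hc hF v with h | ⟨x, h, -⟩ | ⟨x, x', -, -, -, h⟩
  · omega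
  · have := (fib_le_I G F v x).trans (hK x)
    omega
  · have := (fib_le_I G F v x).trans (hK x)
    have := (fib_le_I G F v x').trans (hK x')
    omega

theorem main (hc : NoC4 G) {F : Finset (Sym2 V)} (hF : Cl G F) (D : ℕ) (hD : 4 ≤ D)
    (hdeg : ∀ v, G.degree v ≤ D) : F.card ≤ 3 * (D - 1) := by
  by_cases h3 : ∃ v, 3 ≤ (I F v).card
  · obtain ⟨v, hv⟩ := h3
    have e1 := decomp G F v
    have e2 := far_zero G hc hF v hv
    have e3 := M_le G hc F hF v
    have e4 := (I_le G F hF v).trans (hdeg v)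
    have e5 : (P G F v).card ≤ 2 * (D - 2) := by
      rcases P_struct G hc hF v with h | ⟨x, h, hx⟩ | ⟨x, x', hx, hx', hxx, h⟩
      · omega
      · have := fib_le1 G hF v x hx
        have := hdeg x
        omega
      · have := fib_le2 G hF v x x' hx hx' hxx
        have := fib_le2 G hF v x' x hx' hx hxx.symm
        have := hdeg x
        have := hdeg x'
        omega
    omega
  push Not at h3
  by_cases h2 : ∃ v, 2 ≤ (I F v).card
  · obtain ⟨v, hv⟩ := h2
    have e1 := decomp G F v
    have e2 := far_two G hc hF v hv
    have e3 := M_le G hc F hF v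
    have e4 := h3 v
    have e5 := P_le_K G hc hF v 2 (fun x => by have := h3 x; omega)
    omega
  push Not at h2
  rcases F.eq_empty_or_nonempty with rfl | ⟨e, he⟩
  · simp
  induction e with
  | _ v u =>
  have e1 := decomp G F v
  have e2 := far_matching G hF v u he
  have e3 := M_le G hc F hF v
  have e3' := M_le G hc F hF u
  have e4 := h2 v
  have e5 := P_le_K G hc hF v 1 (fun x => by have := h2 x; omega)
  have e5' := P_le_K G hc hF u 1 (fun x => by have := h2 x; omega)
  omega

end SCProof

/-- Theorem 1.5(1): if `G` is `C₄`-free with maximum degree `Δ ≥ 4`,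
then `ω₂'(G) ≤ 3(Δ - 1)`. -/
theorem strongCliqueNumber_le_of_c4Free {V : Type*} [Fintype V] [DecidableEq V]
    (G : SimpleGraph V) [DecidableRel G.Adj] (Δ : ℕ) (hΔ : G.maxDegree = Δ) (hΔ' : 4 ≤ Δ)
    (hfree : ¬ G.ContainsSub (cycleGraph 4)) :
    G.strongCliqueNumber ≤ 3 * (Δ - 1) := by
  apply csSup_le
  · exact ⟨0, ∅, ⟨by simp, by simp⟩, rfl⟩
  · rintro n ⟨F, hF, rfl⟩
    exact SCProof.main G (SCProof.noC4_of G hfree) (SCProof.cl_of G F hF) Δ hΔ'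
      (fun v => hΔ ▸ G.degree_le_maxDegree v)
end

section
/- Let k ≥ 3 be an integer and let G be a finite simple graph with maximum degree Δ ≥ 2. If G is C_{2k}-free (contains no cycle on 2k vertices as a subgraph), then ω₂'(G) ≤ 10k²(Δ − 1). -/
open SimpleGraph

namespace SCN

/-- Greedy matching inside a set of edges of a graph with degrees at most `Δ`. -/
theorem exists_matching {V : Type*} [Fintype V] [DecidableEq V] (G : SimpleGraph V)
    [DecidableRel G.Adj] (Δ : ℕ) (hdeg : ∀ v, G.degree v ≤ Δ) (t : ℕ) :
    ∀ F : Finset (Sym2 V), (F : Set (Sym2 V)) ⊆ G.edgeSet → t * (2 * Δ - 1) < F.card + (2 * Δ - 1) →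
      (t = 0 ∨ F.Nonempty) →
      ∃ M ⊆ F, M.card = t ∧ ∀ e ∈ M, ∀ f ∈ M, e ≠ f → ∀ x ∈ e, x ∉ f := by
  induction t with
  | zero => intro F _ _ _; exact ⟨∅, by simp, by simp, by simp⟩
  | succ t ih =>
    intro F hF hc hne
    obtain ⟨e, he⟩ : F.Nonempty := by simpa using hne
    induction e using Sym2.ind with
    | _ u v =>
    have huv : G.Adj u v := by simpa using hF he
    set F' := F.filter (fun f => u ∉ f ∧ v ∉ f) with hF'
    have hsub : F \ F' ⊆ G.incidenceFinset u ∪ G.incidenceFinset v := by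
      intro f hf
      have hfF : f ∈ F := (Finset.mem_sdiff.1 hf).1
      have : f ∈ G.edgeSet := hF hfF
      simp only [hF', Finset.mem_sdiff, Finset.mem_filter] at hf
      simp only [Finset.mem_union, mem_incidenceFinset, incidenceSet, Set.mem_ofPred_eq]
      tauto
    have hcard : (F \ F').card ≤ 2 * Δ - 1 := by
      have h1 := Finset.card_le_card hsub
      have h2 := Finset.card_union_add_card_inter (G.incidenceFinset u) (G.incidenceFinset v)
      have h3 : 0 < (G.incidenceFinset u ∩ G.incidenceFinset v).card := by
        apply Finset.card_pos.2
        refine ⟨s(u, v), ?_⟩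
        simp [incidenceSet, huv]
      rw [card_incidenceFinset_eq_degree, card_incidenceFinset_eq_degree] at h2
      have := hdeg u
      have := hdeg v
      omega
    have hFF : F'.card + (F \ F').card = F.card := by
      have := Finset.card_sdiff_add_card_eq_card (Finset.filter_subset (fun f => u ∉ f ∧ v ∉ f) F)
      rw [← hF'] at this
      omega
    have hc' : t * (2 * Δ - 1) < F'.card + (2 * Δ - 1) := by
      rw [Nat.succ_mul] at hc; omega
    have hne' : t = 0 ∨ F'.Nonempty := by
      rcases Nat.eq_zero_or_pos t with h | h
      · exact Or.inl h
      · right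
        apply Finset.card_pos.1
        have : 1 * (2 * Δ - 1) ≤ t * (2 * Δ - 1) := Nat.mul_le_mul_right _ h
        omega
    obtain ⟨M, hM, hMc, hMd⟩ := ih F' (fun f hf => hF (Finset.filter_subset _ _ hf)) hc' hne'
    have hout : ∀ f ∈ M, u ∉ f ∧ v ∉ f := fun f hf => (Finset.mem_filter.1 (hM hf)).2
    have hnot : s(u, v) ∉ M := fun h => (hout _ h).1 (by simp)
    refine ⟨insert s(u, v) M, ?_, ?_, ?_⟩
    · intro f hf
      rcases Finset.mem_insert.1 hf with rfl | hf
      · exact he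
      · exact Finset.filter_subset _ _ (hM hf)
    · rw [Finset.card_insert_of_notMem hnot, hMc]
    · intro e1 h1 e2 h2 hne x hx hx'
      rcases Finset.mem_insert.1 h1 with rfl | h1' <;> rcases Finset.mem_insert.1 h2 with rfl | h2'
      · exact hne rfl
      · rcases Sym2.mem_iff.1 hx with rfl | rfl
        · exact (hout _ h2').1 hx'
        · exact (hout _ h2').2 hx'
      · rcases Sym2.mem_iff.1 hx' with rfl | rfl
        · exact (hout _ h1').1 hx
        · exact (hout _ h1').2 hx
      · exact hMd e1 h1' e2 h2' hne x hx hx'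

/-- The trivial bound. -/
theorem card_le_two_sq {V : Type*} [Fintype V] [DecidableEq V] (G : SimpleGraph V)
    [DecidableRel G.Adj] (Δ : ℕ) (hdeg : ∀ v, G.degree v ≤ Δ) (F : Finset (Sym2 V))
    (hF : G.IsStrongClique F) : F.card ≤ 2 * Δ ^ 2 := by
  obtain ⟨hF1, hF2⟩ := hF
  rcases F.eq_empty_or_nonempty with rfl | ⟨e, he⟩
  · simp
  induction e using Sym2.ind with
  | _ u v =>
  have huv : G.Adj u v := by simpa using hF1 he
  have hsub : F ⊆ (G.neighborFinset u ∪ G.neighborFinset v).biUnion (fun w => G.incidenceFinset w) := by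
    intro f hf
    have hfe : f ∈ G.edgeSet := hF1 hf
    simp only [Finset.mem_biUnion, Finset.mem_union, mem_neighborFinset, mem_incidenceFinset,
      incidenceSet, Set.mem_ofPred_eq]
    by_cases h : s(u, v) = f
    · subst h
      exact ⟨v, Or.inl huv, hfe, by simp⟩
    · obtain ⟨x, hx, y, hy, hxy⟩ := hF2 _ he _ hf h
      rcases Sym2.mem_iff.1 hx with rfl | rfl
      · rcases hxy with rfl | hxy
        · exact ⟨x, Or.inr huv.symm, hfe, hy⟩
        · exact ⟨y, Or.inl hxy, hfe, hy⟩
      · rcases hxy with rfl | hxy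
        · exact ⟨x, Or.inl huv, hfe, hy⟩
        · exact ⟨y, Or.inr hxy, hfe, hy⟩
  calc F.card ≤ _ := Finset.card_le_card hsub
    _ ≤ (G.neighborFinset u ∪ G.neighborFinset v).card * Δ := by
        apply Finset.card_biUnion_le_card_mul
        intro w _
        rw [card_incidenceFinset_eq_degree]; exact hdeg w
    _ ≤ (2 * Δ) * Δ := by
        apply Nat.mul_le_mul_right
        refine (Finset.card_union_le _ _).trans ?_
        rw [card_neighborFinset_eq_degree, card_neighborFinset_eq_degree]
        have := hdeg u
        have := hdeg v
        omega
    _ = _ := by ring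

/-- Cut lemma: some labelling satisfies at least half of the constraints. -/
theorem exists_label {ι : Type*} [DecidableEq ι] (p : ι → ι → Prop)
    (hp : ∀ i j, p i j → p j i) (s : Finset ι) :
    ∃ f : ι → Prop, s.card * s.card ≤
      2 * ∑ i ∈ s, ∑ j ∈ s, (open Classical in if ((f i ↔ f j) ↔ p i j) ∧ i ≠ j then 1 else 0)
        + s.card := by
  classical
  induction s using Finset.induction_on with
  | empty => exact ⟨fun _ => True, by simp⟩
  | insert a s ha ih =>
    obtain ⟨f, hf⟩ := ih
    have key : ∃ c : Prop, s.card ≤ 2 * ∑ j ∈ s, (if ((c ↔ f j) ↔ p a j) then 1 else 0) := by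
      by_contra hcon
      push Not at hcon
      have h1 : 2 * ∑ j ∈ s, (if ((True ↔ f j) ↔ p a j) then 1 else 0) < s.card := by
        refine lt_of_eq_of_lt ?_ (hcon True)
        congr!
      have h2 : 2 * ∑ j ∈ s, (if ((False ↔ f j) ↔ p a j) then 1 else 0) < s.card := by
        refine lt_of_eq_of_lt ?_ (hcon False)
        congr!
      have h3 : (∑ j ∈ s, (if ((True ↔ f j) ↔ p a j) then 1 else 0)) +
          (∑ j ∈ s, (if ((False ↔ f j) ↔ p a j) then 1 else 0)) = s.card := by
        rw [← Finset.sum_add_distrib, Finset.card_eq_sum_ones]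
        apply Finset.sum_congr rfl
        intro j _
        by_cases h : f j <;> by_cases h' : p a j <;> simp [h, h']
      omega
    obtain ⟨c, hc⟩ := key
    refine ⟨Function.update f a c, ?_⟩
    have hps : ∀ i j, p i j ↔ p j i := fun i j => ⟨hp i j, hp j i⟩
    have hne : ∀ j ∈ s, j ≠ a := fun j hj h => ha (h ▸ hj)
    rw [Finset.card_insert_of_notMem ha, Finset.sum_insert ha, Finset.sum_insert ha]
    have e1 : ∑ j ∈ s, (if ((Function.update f a c a ↔ Function.update f a c j) ↔ p a j) ∧ a ≠ j
        then 1 else 0) = ∑ j ∈ s, (if ((c ↔ f j) ↔ p a j) then 1 else 0) := by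
      apply Finset.sum_congr rfl
      intro j hj
      simp [Function.update_of_ne (hne j hj), (hne j hj).symm]
    have e2 : ∑ i ∈ s, ∑ j ∈ insert a s,
        (if ((Function.update f a c i ↔ Function.update f a c j) ↔ p i j) ∧ i ≠ j then 1 else 0) =
        ∑ j ∈ s, (if ((c ↔ f j) ↔ p a j) then 1 else 0) +
        ∑ i ∈ s, ∑ j ∈ s, (if ((f i ↔ f j) ↔ p i j) ∧ i ≠ j then 1 else 0) := by
      rw [← Finset.sum_add_distrib]
      apply Finset.sum_congr rfl
      intro i hi
      rw [Finset.sum_insert ha]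
      congr 1
      · simp [Function.update_of_ne (hne i hi), hne i hi, hps i a, iff_comm (a := f i)]
      · apply Finset.sum_congr rfl
        intro j hj
        simp [Function.update_of_ne (hne i hi), Function.update_of_ne (hne j hj)]
    rw [e1, e2]
    simp only [ne_eq, not_true_eq_false, and_false, if_false]
    nlinarith

/-- Passing to a bipartite subgraph of large minimum degree. -/
theorem exists_minDegree {ι : Type*} [DecidableEq ι] (R : ι → ι → Prop) [DecidableRel R] (c : ℕ)
    (n : ℕ) : ∀ A B : Finset ι, A.card + B.card = n →
    c * (A.card + B.card) < ∑ j ∈ A, ∑ i ∈ B, (if R i j then 1 else 0) →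
    ∃ A' ⊆ A, ∃ B' ⊆ B, A'.Nonempty ∧ (∀ j ∈ A', c < (B'.filter (fun i => R i j)).card) ∧
      (∀ i ∈ B', c < (A'.filter (fun j => R i j)).card) := by
  induction n with
  | zero =>
    intro A B h0 h
    have : A = ∅ := Finset.card_eq_zero.1 (by omega)
    subst this
    simp at h
  | succ n ih =>
    intro A B hn h
    by_cases hA : ∀ j ∈ A, c < (B.filter (fun i => R i j)).card
    · by_cases hB : ∀ i ∈ B, c < (A.filter (fun j => R i j)).card
      · refine ⟨A, subset_rfl, B, subset_rfl, ?_, hA, hB⟩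
        rw [Finset.nonempty_iff_ne_empty]
        rintro rfl
        simp at h
      · push Not at hB
        obtain ⟨i, hi, hd⟩ := hB
        have hcard := Finset.card_erase_add_one hi
        have hsum : ∑ j ∈ A, ∑ i ∈ B, (if R i j then 1 else 0) =
            ∑ j ∈ A, (if R i j then 1 else 0) +
            ∑ j ∈ A, ∑ i ∈ B.erase i, (if R i j then 1 else 0) := by
          rw [← Finset.sum_add_distrib]
          apply Finset.sum_congr rfl
          intro j _
          exact (Finset.add_sum_erase B (fun i => if R i j then 1 else 0) hi).symm
        rw [← Finset.card_filter] at hsum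
        obtain ⟨A', hA', B', hB', h3⟩ := ih A (B.erase i) (by omega) (by
          rw [← hcard] at h
          have : c * (A.card + ((B.erase i).card + 1)) = c * (A.card + (B.erase i).card) + c := by
            ring
          omega)
        exact ⟨A', hA', B', hB'.trans (Finset.erase_subset _ _), h3⟩
    · push Not at hA
      obtain ⟨j, hj, hd⟩ := hA
      have hcard := Finset.card_erase_add_one hj
      have hsum := (Finset.add_sum_erase A (fun j => ∑ i ∈ B, (if R i j then 1 else 0)) hj)
      simp only [← Finset.card_filter] at hsum h
      obtain ⟨A', hA', B', hB', h3⟩ := ih (A.erase j) B (by omega) (by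
          simp only [← Finset.card_filter]
          rw [← hcard] at h
          have : c * ((A.erase j).card + 1 + B.card) = c * ((A.erase j).card + B.card) + c := by
            ring
          omega)
      exact ⟨A', hA'.trans (Finset.erase_subset _ _), B', hB', h3⟩

/-- Greedy alternating path. `b t` for `t ≥ 1` joins `a (t-1)` and `a t`. -/
theorem exists_path {ι : Type*} [DecidableEq ι] (R : ι → ι → Prop) [DecidableRel R] (c : ℕ)
    (A B : Finset ι) (i₀ : ι) (hi₀ : i₀ ∉ B) (hA0 : A.Nonempty)
    (hR0 : ∀ j ∈ A, R i₀ j)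
    (hA : ∀ j ∈ A, c < (B.filter (fun i => R i j)).card)
    (hB : ∀ i ∈ B, c < (A.filter (fun j => R i j)).card) (n : ℕ) (hn : n ≤ c) :
    ∃ a b : ℕ → ι, b 0 = i₀ ∧ (∀ t ≤ n, a t ∈ A) ∧ (∀ t ≤ n, 1 ≤ t → b t ∈ B) ∧
      (∀ s ≤ n, ∀ t ≤ n, a s = a t → s = t) ∧ (∀ s ≤ n, ∀ t ≤ n, b s = b t → s = t) ∧
      (∀ t ≤ n, R (b t) (a t)) ∧ (∀ t < n, R (b (t + 1)) (a t)) := by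
  induction n with
  | zero =>
    obtain ⟨j, hj⟩ := hA0
    refine ⟨fun _ => j, fun _ => i₀, rfl, fun _ _ => hj, ?_, ?_, ?_, fun _ _ => hR0 j hj, ?_⟩
    · intro t h1 h2; omega
    · intro s hs t ht _; omega
    · intro s hs t ht _; omega
    · intro t ht; omega
  | succ n ih =>
    obtain ⟨a, b, hb0, haA, hbB, hai, hbi, hR1, hR2⟩ := ih (by omega)
    have hex1 : ∃ i ∈ B.filter (fun i => R i (a n)), i ∉ (Finset.Icc 1 n).image b := by
      apply Finset.exists_mem_notMem_of_card_lt_card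
      have := hA _ (haA n le_rfl)
      have h2 : ((Finset.Icc 1 n).image b).card ≤ n := by
        simpa using (Finset.card_image_le (s := Finset.Icc 1 n) (f := b))
      omega
    obtain ⟨i, hi, hinew⟩ := hex1
    obtain ⟨hiB, hiR⟩ := Finset.mem_filter.1 hi
    have hex2 : ∃ j ∈ A.filter (fun j => R i j), j ∉ (Finset.range (n + 1)).image a := by
      apply Finset.exists_mem_notMem_of_card_lt_card
      have := hB _ hiB
      have h2 : ((Finset.range (n + 1)).image a).card ≤ n + 1 := by
        simpa using (Finset.card_image_le (s := Finset.range (n + 1)) (f := a))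
      omega
    obtain ⟨j, hj, hjnew⟩ := hex2
    obtain ⟨hjA, hjR⟩ := Finset.mem_filter.1 hj
    have hjn : ∀ t ≤ n, a t ≠ j := fun t ht h =>
      hjnew (Finset.mem_image.2 ⟨t, Finset.mem_range.2 (by omega), h⟩)
    have hin : ∀ t ≤ n, b t ≠ i := by
      intro t ht h
      rcases Nat.eq_zero_or_pos t with rfl | h0
      · exact hi₀ (by rw [← hb0, h]; exact hiB)
      · exact hinew (Finset.mem_image.2 ⟨t, Finset.mem_Icc.2 ⟨h0, ht⟩, h⟩)
    refine ⟨fun t => if t ≤ n then a t else j, fun t => if t ≤ n then b t else i,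
      by simp [hb0], ?_, ?_, ?_, ?_, ?_, ?_⟩
    · intro t ht
      dsimp only
      split_ifs with h
      · exact haA t h
      · exact hjA
    · intro t ht h1
      dsimp only
      split_ifs with h
      · exact hbB t h h1
      · exact hiB
    · intro s hs t ht
      dsimp only
      split_ifs with h h' h'
      · exact hai s h t h'
      · intro e; exact absurd e (hjn s h)
      · intro e; exact absurd e.symm (hjn t h')
      · intro _; omega
    · intro s hs t ht
      dsimp only
      split_ifs with h h' h'
      · exact hbi s h t h'
      · intro e; exact absurd e (hin s h)
      · intro e; exact absurd e.symm (hin t h')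
      · intro _; omega
    · intro t ht
      dsimp only
      split_ifs with h
      · exact hR1 t h
      · exact hjR
    · intro t ht
      dsimp only
      rw [if_pos (show t ≤ n by omega)]
      split_ifs with h
      · exact hR2 t (by omega)
      · have : t = n := by omega
        subst this
        exact hiR

/-- Assemble an even cycle from alternating sequences. -/
theorem contains_cycle {V : Type*} (G : SimpleGraph V) (k : ℕ) (hk : 3 ≤ k) (X Y : ℕ → V)
    (hX : ∀ s < k, ∀ t < k, X s = X t → s = t) (hY : ∀ s < k, ∀ t < k, Y s = Y t → s = t)
    (hXY : ∀ s < k, ∀ t < k, X s ≠ Y t)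
    (h1 : ∀ t < k, G.Adj (X t) (Y t)) (h2 : ∀ t, t + 1 < k → G.Adj (X (t + 1)) (Y t))
    (h3 : G.Adj (X 0) (Y (k - 1))) : G.ContainsSub (cycleGraph (2 * k)) := by
  let f : ℕ → V := fun n => if n % 2 = 0 then X (n / 2) else Y (n / 2)
  have hstep : ∀ n, n + 1 < 2 * k → G.Adj (f n) (f (n + 1)) := by
    intro n hn
    rcases Nat.even_or_odd' n with ⟨t, rfl | rfl⟩
    · have e1 : (2 * t) % 2 = 0 := by omega
      have e2 : (2 * t + 1) % 2 ≠ 0 := by omega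
      have e3 : (2 * t) / 2 = t := by omega
      have e4 : (2 * t + 1) / 2 = t := by omega
      simp only [f, if_pos e1, if_neg e2, e3, e4]
      exact h1 t (by omega)
    · have e1 : (2 * t + 1 + 1) % 2 = 0 := by omega
      have e2 : (2 * t + 1) % 2 ≠ 0 := by omega
      have e3 : (2 * t + 1 + 1) / 2 = t + 1 := by omega
      have e4 : (2 * t + 1) / 2 = t := by omega
      simp only [f, if_pos e1, if_neg e2, e3, e4]
      exact (h2 t (by omega)).symm
  have hwrap : G.Adj (f 0) (f (2 * k - 1)) := by
    have e2 : (2 * k - 1) % 2 ≠ 0 := by omega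
    have e4 : (2 * k - 1) / 2 = k - 1 := by omega
    simp only [f, if_neg e2, e4]
    simpa using h3
  have hall : ∀ m n, m < 2 * k → n < 2 * k → (m + 1 = n ∨ (m = 2 * k - 1 ∧ n = 0)) →
      G.Adj (f m) (f n) := by
    rintro m n hm hn (rfl | ⟨rfl, rfl⟩)
    · exact hstep m hn
    · exact hwrap.symm
  refine ⟨fun i => f i.1, ?_, ?_⟩
  · intro p q hpq
    have hp := p.2
    have hq := q.2
    apply Fin.ext
    simp only [f] at hpq
    split_ifs at hpq with a b b
    · have := hX _ (by omega) _ (by omega) hpq; omega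
    · exact absurd hpq (hXY _ (by omega) _ (by omega))
    · exact absurd hpq.symm (hXY _ (by omega) _ (by omega))
    · have := hY _ (by omega) _ (by omega) hpq; omega
  · intro p q hpq
    have hp := p.2
    have hq := q.2
    have key : ∀ p q : Fin (2 * k), (p - q).1 = 1 → (q.1 + 1 = p.1 ∨ (q.1 = 2 * k - 1 ∧ p.1 = 0)) := by
      intro p q h
      have hp := p.2
      have hq := q.2
      rw [Fin.sub_def] at h
      simp only at h
      rcases le_or_gt q.1 p.1 with hle | hlt
      · have : 2 * k - q.1 + p.1 = (p.1 - q.1) + 2 * k := by omega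
        rw [this, Nat.add_mod_right, Nat.mod_eq_of_lt (by omega)] at h
        omega
      · rw [Nat.mod_eq_of_lt (by omega)] at h
        omega
    rw [cycleGraph_adj'] at hpq
    rcases hpq with h | h
    · exact (hall _ _ hq hp (key p q h)).symm
    · exact hall _ _ hp hq (key q p h)

/-- Averaging: a vertex with many edges leaving its neighbourhood. -/
theorem exists_root {ι : Type*} [Fintype ι] [DecidableEq ι] (R : ι → ι → Prop) [DecidableRel R]
    (k : ℕ) (hk : 3 ≤ k) (hm : Fintype.card ι = 5 * k ^ 2)
    (hS : Fintype.card ι * (Fintype.card ι + 3) ≤ 4 * ∑ j, ∑ i, (if R i j then 1 else 0)) :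
    ∃ i, (k - 1) * ((Finset.univ.filter (fun j => R i j)).card + (Fintype.card ι - 1)) <
      ∑ j ∈ Finset.univ.filter (fun j => R i j), ∑ l ∈ Finset.univ.erase i,
        (if R l j then 1 else 0) := by
  by_contra hcon
  push Not at hcon
  set m := Fintype.card ι with hmdef
  have hm1 : 1 ≤ m := by rw [hm]; nlinarith
  let d : ι → ℤ := fun j => ∑ i, (if R i j then 1 else 0)
  have hi : ∀ i, ∑ j, (if R i j then d j - k else 0) ≤ ((k : ℤ) - 1) * (m - 1) := by
    intro i
    have h := hcon i
    have h' : ((∑ j ∈ Finset.univ.filter (fun j => R i j), ∑ l ∈ Finset.univ.erase i,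
        (if R l j then 1 else 0) : ℕ) : ℤ) =
        ∑ j ∈ Finset.univ.filter (fun j => R i j), (d j - 1) := by
      push_cast
      apply Finset.sum_congr rfl
      intro j hj
      have := Finset.add_sum_erase Finset.univ (fun l => if R l j then (1 : ℤ) else 0)
        (Finset.mem_univ i)
      simp only [if_pos (Finset.mem_filter.1 hj).2] at this
      simp only [d]
      linarith
    have h2 : ((∑ j ∈ Finset.univ.filter (fun j => R i j), ∑ l ∈ Finset.univ.erase i,
        (if R l j then 1 else 0) : ℕ) : ℤ) ≤ (((k - 1) *
        ((Finset.univ.filter (fun j => R i j)).card + (m - 1)) : ℕ) : ℤ) := by exact_mod_cast h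
    rw [h'] at h2
    rw [Nat.cast_mul, Nat.cast_add, Nat.cast_sub hm1, Nat.cast_sub (by omega : 1 ≤ k)] at h2
    rw [← Finset.sum_filter]
    rw [Finset.sum_sub_distrib] at h2 ⊢
    simp only [Finset.sum_const, nsmul_eq_mul] at h2 ⊢
    push_cast at h2
    linarith
  have hsum : ∑ i, ∑ j, (if R i j then d j - k else 0) ≤ (m : ℤ) * (((k : ℤ) - 1) * (m - 1)) := by
    have := Finset.sum_le_sum (fun i (_ : i ∈ (Finset.univ : Finset ι)) => hi i)
    simpa [hmdef] using this
  rw [Finset.sum_comm] at hsum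
  have hsum2 : ∑ j, ∑ i, (if R i j then d j - k else 0) = ∑ j, (d j ^ 2 - k * d j) := by
    apply Finset.sum_congr rfl
    intro j _
    have : ∑ i, (if R i j then d j - k else 0) = (d j - k) * ∑ i, (if R i j then 1 else 0) := by
      rw [Finset.mul_sum]
      apply Finset.sum_congr rfl
      intro i _
      split_ifs <;> simp
    rw [this]
    change (d j - k) * d j = _
    ring
  rw [hsum2, Finset.sum_sub_distrib, ← Finset.mul_sum] at hsum
  have hcs : (∑ j, d j) ^ 2 ≤ (m : ℤ) * ∑ j, d j ^ 2 := by
    have := sq_sum_le_card_mul_sum_sq (s := (Finset.univ : Finset ι)) (f := d)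
    simpa [hmdef] using this
  have hS' : (m : ℤ) * (m + 3) ≤ 4 * ∑ j, d j := by
    simp only [d]
    exact_mod_cast hS
  generalize (∑ j, d j) = S at *
  generalize (∑ j, d j ^ 2) = Q at *
  have hmz : (m : ℤ) = 5 * (k : ℤ) ^ 2 := by exact_mod_cast hm
  have hkz : (3 : ℤ) ≤ k := by exact_mod_cast hk
  generalize (m : ℤ) = M at *
  generalize (k : ℤ) = K at *
  have hMpos : 0 < M := by rw [hmz]; positivity
  have hM4 : 0 < M + 3 - 4 * K := by rw [hmz]; nlinarith
  have a1 : S ^ 2 - K * M * S ≤ M ^ 2 * ((K - 1) * (M - 1)) := by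
    have := mul_le_mul_of_nonneg_left hsum hMpos.le
    nlinarith
  have a2 : (M * (M + 3)) * (M * (M + 3 - 4 * K)) ≤ (4 * S) * (4 * S - 4 * K * M) := by
    apply mul_le_mul hS' (by linarith) (by positivity)
    have : 0 ≤ M * (M + 3) := by positivity
    linarith
  have a3 : M ^ 2 * ((M + 3) * (M + 3 - 4 * K)) ≤ M ^ 2 * (16 * ((K - 1) * (M - 1))) := by
    nlinarith
  have a4 := le_of_mul_le_mul_left a3 (by positivity)
  rw [hmz] at a4
  nlinarith [sq_nonneg (K * (K - 2)), mul_self_nonneg K]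

end SCN

/-- Theorem 1.5(2): if `k ≥ 3` and `G` is `C_{2k}`-free with maximum degree `Δ ≥ 2`,
then `ω₂'(G) ≤ 10k²(Δ - 1)`. -/
theorem strongCliqueNumber_le_of_evenCycleFree {V : Type*} [Fintype V] [DecidableEq V]
    (k : ℕ) (hk : 3 ≤ k) (G : SimpleGraph V) [DecidableRel G.Adj]
    (Δ : ℕ) (hΔ : G.maxDegree = Δ) (hΔ' : 2 ≤ Δ)
    (hfree : ¬ G.ContainsSub (cycleGraph (2 * k))) :
    G.strongCliqueNumber ≤ 10 * k ^ 2 * (Δ - 1) := by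
  classical
  unfold SimpleGraph.strongCliqueNumber
  refine csSup_le (Set.nonempty_of_mem (x := 0) ⟨∅, by simp [SimpleGraph.IsStrongClique], rfl⟩) ?_
  rintro n ⟨F, hF, rfl⟩
  by_contra hlt
  push Not at hlt
  apply hfree
  have hdeg : ∀ v, G.degree v ≤ Δ := fun v => hΔ ▸ G.degree_le_maxDegree v
  have hb := SCN.card_le_two_sq G Δ hdeg F hF
  obtain ⟨D, rfl⟩ : ∃ D, Δ = D + 1 := ⟨Δ - 1, by omega⟩
  rw [Nat.add_sub_cancel] at hlt
  have hbig : 5 * k ^ 2 < 2 * (D + 1) := by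
    by_contra hc
    push Not at hc
    nlinarith
  have hne : F.Nonempty := Finset.card_pos.1 (by omega)
  obtain ⟨M, hMF, hMc, hMd⟩ := SCN.exists_matching G (D + 1) hdeg (5 * k ^ 2) F hF.1 (by
    have : 2 * (D + 1) - 1 = 2 * D + 1 := by omega
    rw [this]
    nlinarith) (Or.inr hne)
  -- endpoints
  let a : M → V := fun e => (Quot.out e.1).1
  let b : M → V := fun e => (Quot.out e.1).2
  have hab : ∀ e : M, e.1 = s(a e, b e) := fun e => (Quot.out_eq e.1).symm
  have hadj : ∀ e : M, G.Adj (a e) (b e) := by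
    intro e
    have : e.1 ∈ G.edgeSet := hF.1 (hMF e.2)
    rw [hab e] at this
    simpa using this
  have hdis : ∀ e f : M, ∀ x, x ∈ e.1 → x ∈ f.1 → e = f := by
    intro e f x hx hy
    by_contra h
    exact hMd e.1 e.2 f.1 f.2 (fun h' => h (Subtype.ext h')) x hx hy
  have ha : ∀ e : M, a e ∈ e.1 := fun e => by rw [hab e]; simp
  have hbm : ∀ e : M, b e ∈ e.1 := fun e => by rw [hab e]; simp
  have hconn : ∀ e f : M, e ≠ f → G.Adj (a e) (a f) ∨ G.Adj (b e) (b f) ∨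
      G.Adj (a e) (b f) ∨ G.Adj (b e) (a f) := by
    intro e f hef
    obtain ⟨x, hx, y, hy, hxy⟩ := hF.2 e.1 (hMF e.2) f.1 (hMF f.2) (fun h => hef (Subtype.ext h))
    rcases hxy with rfl | hxy
    · exact absurd (hdis e f x hx hy) hef
    · rw [hab e] at hx
      rw [hab f] at hy
      rcases Sym2.mem_iff.1 hx with rfl | rfl <;> rcases Sym2.mem_iff.1 hy with rfl | rfl <;> tauto
  let p : M → M → Prop := fun e f => G.Adj (a e) (b f) ∨ G.Adj (b e) (a f)
  obtain ⟨f, hf⟩ := SCN.exists_label p (fun i j h => by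
    rcases h with h | h
    · exact Or.inr h.symm
    · exact Or.inl h.symm) Finset.univ
  let x : M → V := fun e => if f e then a e else b e
  let y : M → V := fun e => if f e then b e else a e
  have hxm : ∀ e, x e ∈ e.1 := by
    intro e; simp only [x]; split_ifs
    · exact ha e
    · exact hbm e
  have hym : ∀ e, y e ∈ e.1 := by
    intro e; simp only [y]; split_ifs
    · exact hbm e
    · exact ha e
  have hxy : ∀ e, G.Adj (x e) (y e) := by
    intro e; simp only [x, y]; split_ifs
    · exact hadj e
    · exact (hadj e).symm
  let R : M → M → Prop := fun e f => G.Adj (x e) (y f)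
  have hcard : Fintype.card M = 5 * k ^ 2 := by simpa using hMc
  have hgood : ∀ e g : M, ((f e ↔ f g) ↔ p e g) ∧ e ≠ g → R e g ∨ R g e := by
    rintro e g ⟨h, hne⟩
    have hc := hconn e g hne
    simp only [R, x, y]
    simp only [p] at h
    by_cases h1 : f e <;> by_cases h2 : f g <;> simp only [h1, h2, if_true, if_false] at h ⊢ <;>
      simp only [G.adj_comm (a g), G.adj_comm (b g)] <;> tauto
  have hS : Fintype.card M * (Fintype.card M + 3) ≤
      4 * ∑ j, ∑ i, (if R i j then 1 else 0) := by
    rw [Finset.card_univ] at hf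
    have hle : ∑ i, ∑ j, (if ((f i ↔ f j) ↔ p i j) ∧ i ≠ j then 1 else 0) +
        2 * ∑ i : M, ∑ j : M, (if i = j then 1 else 0) ≤
        ∑ i, ∑ j, (if R i j then 1 else 0) + ∑ i, ∑ j, (if R j i then 1 else 0) := by
      rw [Finset.mul_sum, ← Finset.sum_add_distrib, ← Finset.sum_add_distrib]
      apply Finset.sum_le_sum
      intro i _
      rw [Finset.mul_sum, ← Finset.sum_add_distrib, ← Finset.sum_add_distrib]
      apply Finset.sum_le_sum
      intro j _
      by_cases hij : i = j
      · subst hij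
        have : R i i := hxy i
        simp [this]
      · by_cases hg : ((f i ↔ f j) ↔ p i j) ∧ i ≠ j
        · rw [if_pos hg, if_neg hij]
          rcases hgood i j hg with h | h
          · rw [if_pos h]; omega
          · rw [if_pos h]; omega
        · rw [if_neg hg, if_neg hij]; omega
    have hdiag : ∑ i : M, ∑ j : M, (if i = j then 1 else 0) = Fintype.card M := by simp
    have hcomm : ∑ i, ∑ j, (if R i j then 1 else 0) = ∑ j, ∑ i, (if R i j then 1 else 0) :=
      Finset.sum_comm
    rw [hdiag, hcomm] at hle
    have hf' : Fintype.card M * Fintype.card M ≤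
      2 * ∑ i, ∑ j, (if ((f i ↔ f j) ↔ p i j) ∧ i ≠ j then 1 else 0) + Fintype.card M := by
      convert hf
    nlinarith
  obtain ⟨i₀, hi₀⟩ := SCN.exists_root R k hk hcard hS
  obtain ⟨A, hAs, B, hBs, hAne, hA, hB⟩ := SCN.exists_minDegree R (k - 1) _
    (Finset.univ.filter (fun j => R i₀ j)) (Finset.univ.erase i₀) rfl (by
      rwa [Finset.card_erase_of_mem (Finset.mem_univ _), Finset.card_univ])
  have hR0 : ∀ j ∈ A, R i₀ j := fun j hj => (Finset.mem_filter.1 (hAs hj)).2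
  obtain ⟨u, v, hv0, huA, -, hui, hvi, hR1, hR2⟩ := SCN.exists_path R (k - 1) A B i₀
    (fun h => Finset.notMem_erase _ _ (hBs h)) hAne hR0 hA hB (k - 1) le_rfl
  have hxi : ∀ e g, x e = x g → e = g := fun e g h => hdis e g (x e) (hxm e) (h ▸ hxm g)
  have hyi : ∀ e g, y e = y g → e = g := fun e g h => hdis e g (y e) (hym e) (h ▸ hym g)
  refine SCN.contains_cycle G k hk (fun t => x (v t)) (fun t => y (u t)) ?_ ?_ ?_ ?_ ?_ ?_
  · intro s hs t ht h
    exact hvi s (by omega) t (by omega) (hxi _ _ h)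
  · intro s hs t ht h
    exact hui s (by omega) t (by omega) (hyi _ _ h)
  · intro s hs t ht h
    have h' : x (v s) = y (u t) := h
    have e : v s = u t := hdis _ _ (x (v s)) (hxm _) (h' ▸ hym _)
    have := hxy (v s)
    rw [h', e] at this
    exact G.irrefl this
  · intro t ht
    exact hR1 t (by omega)
  · intro t ht
    exact hR2 t (by omega)
  · have := hR0 _ (huA (k - 1) le_rfl)
    rw [← hv0] at this
    exact this
end

section
/- Let k ≥ 2 be an integer and let G be a finite simple graph with maximum degree Δ. If G contains no cycle on 2k vertices, no cycle on 2k+1 vertices, and no cycle on 2k+2 vertices as a subgraph, then ω₂'(G) ≤ (2k − 1)(Δ − 1) + 2. -/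
open SimpleGraph

/-- A list of vertices forming a closed cycle. -/
def CycList {V : Type*} (G : SimpleGraph V) (L : List V) : Prop :=
  L.Nodup ∧ L.IsChain G.Adj ∧ ∀ x ∈ L.getLast?, ∀ y ∈ L.head?, G.Adj x y

theorem CycList.swap {V : Type*} {G : SimpleGraph V} {A B : List V} (h : CycList G (A ++ B)) :
    CycList G (B ++ A) := by
  obtain ⟨h1, h2, h3⟩ := h
  rw [List.isChain_append] at h2
  obtain ⟨hA, hB, hAB⟩ := h2
  refine ⟨List.nodup_append_comm.1 h1, ?_, ?_⟩
  · rw [List.isChain_append]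
    refine ⟨hB, hA, fun x hx y hy => h3 x ?_ y ?_⟩
    · rw [List.getLast?_append]
      rw [Option.mem_def] at hx ⊢
      rw [hx]; rfl
    · rw [List.head?_append]
      rw [Option.mem_def] at hy ⊢
      rw [hy]; rfl
  · intro x hx y hy
    rcases A with _ | ⟨a, A⟩
    · simp only [List.append_nil, List.nil_append] at *
      exact h3 x hx y hy
    rcases B with _ | ⟨b, B⟩
    · simp only [List.append_nil, List.nil_append] at *
      exact h3 x hx y hy
    refine hAB x ?_ y ?_
    · rw [List.getLast?_append] at hx
      rw [List.getLast?_cons] at *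
      simpa using hx
    · simpa using hy

theorem CycList.splice {V : Type*} {G : SimpleGraph V} {x y : V} {D B p : List V}
    (h : CycList G (x :: (D ++ y :: B))) (hp : List.IsChain G.Adj (x :: (p ++ [y])))
    (hn : p.Nodup) (hd : ∀ z ∈ p, z ∉ x :: (D ++ y :: B)) :
    CycList G (x :: (p ++ y :: B)) := by
  obtain ⟨h1, h2, h3⟩ := h
  refine ⟨?_, ?_, ?_⟩
  · simp only [List.nodup_cons, List.nodup_append, List.mem_append, List.mem_cons] at *
    grind
  · have e1 : x :: (p ++ y :: B) = (x :: p) ++ y :: B := rfl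
    have e2 : x :: (D ++ y :: B) = (x :: D) ++ y :: B := rfl
    rw [e1, List.isChain_split]
    rw [e2, List.isChain_split] at h2
    exact ⟨hp, h2.2⟩
  · intro a ha b hb
    refine h3 a ?_ b hb
    have e1 : x :: (p ++ y :: B) = (x :: p) ++ y :: B := rfl
    have e2 : x :: (D ++ y :: B) = (x :: D) ++ y :: B := rfl
    rw [e1, List.getLast?_append] at ha
    rw [e2, List.getLast?_append]
    rw [List.getLast?_cons] at *
    simpa using ha

theorem CycList.rot {V : Type*} [DecidableEq V] {G : SimpleGraph V} {L : List V} (h : CycList G L)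
    {x : V} (hx : x ∈ L) : ∃ T, CycList G (x :: T) ∧ (x :: T).length = L.length ∧
      (∀ z, z ∈ x :: T ↔ z ∈ L) ∧ (x :: T).formPerm = L.formPerm := by
  obtain ⟨A, B, rfl⟩ := List.mem_iff_append.1 hx
  refine ⟨B ++ A, h.swap, by simp; omega, by intro z; simp; tauto, ?_⟩
  have : (A ++ x :: B) ~r ((x :: B) ++ A) := List.isRotated_append
  exact (List.formPerm_eq_of_isRotated h.1 this).symm

theorem CycList.contains {V : Type*} {G : SimpleGraph V} {L : List V} (h : CycList G L)
    {n : ℕ} (hn : L.length = n) (h2 : 2 ≤ n) : G.ContainsSub (cycleGraph n) := by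
  obtain ⟨h1, hc, hl⟩ := h
  obtain ⟨m, rfl⟩ := Nat.exists_eq_add_of_le' h2
  have key : ∀ b : Fin (m + 2), G.Adj (L[b.1]) (L[(b + 1).1]) := by
    intro b
    rcases Nat.lt_or_ge (b.1 + 1) (m + 2) with hb | hb
    · have e : (b + 1).1 = b.1 + 1 := by
        rw [Fin.val_add_one_of_lt]
        rw [Fin.lt_def]; simp; omega
      simp only [e]
      exact (List.isChain_iff_getElem.1 hc) b.1 (by omega)
    · have hb' : b = Fin.last (m + 1) := by ext; simp; omega
      subst hb'
      simp only [Fin.last_add_one]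
      apply hl
      · rw [List.getLast?_eq_getElem?]; simp [hn]
      · rw [List.head?_eq_getElem?]; simp
  refine ⟨fun i => L[i.1], ?_, ?_⟩
  · intro i j hij
    exact Fin.ext ((List.Nodup.getElem_inj_iff h1).1 hij)
  · intro a b hab
    rw [cycleGraph_adj] at hab
    rcases hab with hab | hab
    · have : a = b + 1 := by rw [← hab]; abel
      subst this
      exact (key b).symm
    · have : b = a + 1 := by rw [← hab]; abel
      subst this
      exact key a

/-- Anchor vertices on a cycle `L` with respect to an edge `uv` off `L`. -/
def TAnch {V : Type*} (G : SimpleGraph V) (u v : V) (c : V) : Prop := G.Adj c u ∨ G.Adj c v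

def PAnch {V : Type*} (G : SimpleGraph V) (M : Finset (Sym2 V)) (L : List V) (u v : V) (c : V) : Prop :=
  ∃ x, x ∉ L ∧ x ≠ u ∧ x ≠ v ∧ s(c, x) ∈ M ∧ G.Adj c x ∧ (G.Adj x u ∨ G.Adj x v)

theorem reach_core {V : Type*} {G : SimpleGraph V} {u v a b : V} (huv : G.Adj u v)
    (ha : G.Adj a u ∨ G.Adj a v) (hb : G.Adj b u ∨ G.Adj b v) :
    ∃ p : List V, p.Nodup ∧ (∀ z ∈ p, z = u ∨ z = v) ∧ 1 ≤ p.length ∧ p.length ≤ 2 ∧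
      List.IsChain G.Adj (a :: (p ++ [b])) := by
  have hne := huv.ne
  rcases ha with ha | ha <;> rcases hb with hb | hb
  · exact ⟨[u], by simp, by simp, by simp, by simp, by simp [ha, hb.symm]⟩
  · exact ⟨[u, v], by simp [hne], by simp, by simp, by simp, by simp [ha, hb.symm, huv]⟩
  · exact ⟨[v, u], by simp [hne.symm], by simp, by simp, by simp, by simp [ha, hb.symm, huv.symm]⟩
  · exact ⟨[v], by simp, by simp, by simp, by simp, by simp [ha, hb.symm]⟩

/-- disjointness of a set of edges -/
def DisjE {V : Type*} (M : Finset (Sym2 V)) : Prop :=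
  ∀ e ∈ M, ∀ f ∈ M, e ≠ f → ∀ v, v ∈ e → v ∉ f

theorem chain_left {V : Type*} {G : SimpleGraph V} {a c b : V} {p : List V} (h : G.Adj c a)
    (hp : List.IsChain G.Adj (a :: (p ++ [b]))) :
    List.IsChain G.Adj (c :: ((a :: p) ++ [b])) := by
  simp only [List.cons_append, List.isChain_cons_cons]
  exact ⟨h, hp⟩

theorem chain_right {V : Type*} {G : SimpleGraph V} {a c b : V} {p : List V} (h : G.Adj b c)
    (hp : List.IsChain G.Adj (a :: (p ++ [b]))) :
    List.IsChain G.Adj (a :: ((p ++ [b]) ++ [c])) := by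
  have e : a :: ((p ++ [b]) ++ [c]) = (a :: (p ++ [b])) ++ [c] := rfl
  rw [e, List.isChain_append]
  refine ⟨hp, by simp, ?_⟩
  intro x hx y hy
  have e2 : a :: (p ++ [b]) = (a :: p) ++ [b] := rfl
  rw [e2, List.getLast?_append] at hx
  simp at hx hy
  subst hx; subst hy; exact h

theorem reach {V : Type*} {G : SimpleGraph V} {M : Finset (Sym2 V)} (hM : DisjE M) {L : List V}
    {u v c d : V} (huv : G.Adj u v) (hu : u ∉ L) (hv : v ∉ L) (hcd : c ≠ d)
    (ac : TAnch G u v c ∨ PAnch G M L u v c) (ad : TAnch G u v d ∨ PAnch G M L u v d) :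
    ∃ p : List V, p.Nodup ∧ (∀ z ∈ p, z ∉ L) ∧ 1 ≤ p.length ∧ p.length ≤ 4 ∧
      (TAnch G u v c ∨ TAnch G u v d → p.length ≤ 3) ∧
      (¬ TAnch G u v c ∨ ¬ TAnch G u v d → 2 ≤ p.length) ∧
      List.IsChain G.Adj (c :: (p ++ [d])) := by
  by_cases tc : TAnch G u v c <;> by_cases td : TAnch G u v d
  · obtain ⟨p, h1, h2, h3, h4, h5⟩ := reach_core huv tc td
    refine ⟨p, h1, ?_, h3, by omega, fun _ => by omega, by tauto, h5⟩
    intro z hz; rcases h2 z hz with rfl | rfl <;> assumption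
  · obtain ⟨x, x1, x2, x3, x4, x5, x6⟩ := ad.resolve_left td
    obtain ⟨p, h1, h2, h3, h4, h5⟩ := reach_core huv tc x6
    refine ⟨p ++ [x], ?_, ?_, by simp, by simp; omega, fun _ => by simp; omega,
      fun _ => by simp; omega, chain_right x5.symm h5⟩
    · simp only [List.nodup_append]; grind
    · intro z hz; simp at hz; grind
  · obtain ⟨x, x1, x2, x3, x4, x5, x6⟩ := ac.resolve_left tc
    obtain ⟨p, h1, h2, h3, h4, h5⟩ := reach_core huv x6 td
    refine ⟨x :: p, ?_, ?_, by simp, by simp; omega, fun _ => by simp; omega,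
      fun _ => by simp; omega, chain_left x5 h5⟩
    · simp only [List.nodup_cons]; grind
    · intro z hz; simp at hz; grind
  · obtain ⟨x, x1, x2, x3, x4, x5, x6⟩ := ac.resolve_left tc
    obtain ⟨y, y1, y2, y3, y4, y5, y6⟩ := ad.resolve_left td
    have hxy : x ≠ y := by
      rintro rfl
      have hne : s(c, x) ≠ s(d, x) := by
        intro h; rw [Sym2.congr_left] at h; exact hcd h
      exact hM _ x4 _ y4 hne x (by simp) (by simp)
    obtain ⟨p, h1, h2, h3, h4, h5⟩ := reach_core huv x6 y6
    refine ⟨x :: (p ++ [y]), ?_, ?_, by simp, by simp; omega, fun h => by tauto,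
      fun _ => by simp, ?_⟩
    · simp only [List.nodup_cons, List.nodup_append]; grind
    · intro z hz; simp at hz; grind
    · exact chain_left x5 (chain_right y5.symm h5)

theorem exists_path {V : Type*} {G : SimpleGraph V} (es : List (Sym2 V)) : ∀ (e : Sym2 V),
    (e :: es).Pairwise (fun e f => (∀ v ∈ e, v ∉ f) ∧ ∃ x ∈ e, ∃ y ∈ f, G.Adj x y) →
    (∀ g ∈ e :: es, g ∈ G.edgeSet) → ∀ x ∈ e, ∀ y, (∀ g ∈ (e :: es).getLast?, y ∈ g) →
    ∃ L : List V, L.head? = some x ∧ L.getLast? = some y ∧ L.IsChain G.Adj ∧ L.Nodup ∧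
      (∀ z ∈ L, ∃ g ∈ e :: es, z ∈ g) ∧ (∀ g ∈ e :: es, ∃ z ∈ L, z ∈ g) ∧
      L.length ≤ 2 * (es.length + 1) := by
  induction es with
  | nil =>
    intro e _ hG x hx y hy
    have hy : y ∈ e := hy e (by simp)
    by_cases hxy : x = y
    · subst hxy
      exact ⟨[x], by simp, by simp, by simp, by simp, by simpa using hx,
        by simpa using hx, by simp⟩
    · have he : e = s(x, y) := (Sym2.mem_and_mem_iff hxy).1 ⟨hx, hy⟩
      subst he
      have := hG s(x, y) (by simp)
      exact ⟨[x, y], by simp, by simp, by simpa using this, by simpa using hxy, by simp,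
        by simp, by simp⟩
  | cons e' es ih =>
    intro e hp hG x hx y hy
    rw [List.pairwise_cons] at hp
    obtain ⟨hd, o, ho, i, hi, hoi⟩ := hp.1 e' (by simp)
    obtain ⟨L, l1, l2, l3, l4, l5, l6, l7⟩ := ih e' hp.2
      (fun g hg => hG g (List.mem_cons_of_mem _ hg)) i hi y
      (fun g hg => hy g (by rw [List.getLast?_cons_cons]; exact hg))
    have hdis : ∀ z ∈ L, z ∉ e := by
      intro z hz hze
      obtain ⟨g, hg, hzg⟩ := l5 z hz
      exact (hp.1 g hg).1 z hze hzg
    have hch : ∀ w ∈ L.head?, G.Adj o w := by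
      intro w hw; rw [l1] at hw; simp at hw; subst hw; exact hoi
    by_cases hxo : x = o
    · subst hxo
      refine ⟨x :: L, by simp, by simp [List.getLast?_cons, l2],
        List.isChain_cons.2 ⟨hch, l3⟩, ?_, ?_, ?_, ?_⟩
      · simp only [List.nodup_cons]; exact ⟨fun h => hdis _ h hx, l4⟩
      · intro z hz
        rcases List.mem_cons.1 hz with rfl | hz
        · exact ⟨e, by simp, hx⟩
        · obtain ⟨g, hg, hzg⟩ := l5 z hz; exact ⟨g, List.mem_cons_of_mem _ hg, hzg⟩
      · intro g hg
        rcases List.mem_cons.1 hg with rfl | hg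
        · exact ⟨x, by simp, hx⟩
        · obtain ⟨z, hz, hzg⟩ := l6 g hg; exact ⟨z, List.mem_cons_of_mem _ hz, hzg⟩
      · simp; omega
    · have he : e = s(x, o) := (Sym2.mem_and_mem_iff hxo).1 ⟨hx, ho⟩
      have hadj : G.Adj x o := by
        have := hG e (by simp); rw [he] at this; simpa using this
      refine ⟨x :: o :: L, by simp, by simp [List.getLast?_cons, l2],
        List.isChain_cons_cons.2 ⟨hadj, List.isChain_cons.2 ⟨hch, l3⟩⟩, ?_, ?_, ?_, ?_⟩
      · simp only [List.nodup_cons, List.mem_cons, not_or]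
        exact ⟨⟨hxo, fun h => hdis _ h hx⟩, fun h => hdis _ h ho, l4⟩
      · intro z hz
        rcases List.mem_cons.1 hz with rfl | hz
        · exact ⟨e, by simp, hx⟩
        rcases List.mem_cons.1 hz with rfl | hz
        · exact ⟨e, by simp, ho⟩
        · obtain ⟨g, hg, hzg⟩ := l5 z hz; exact ⟨g, List.mem_cons_of_mem _ hg, hzg⟩
      · intro g hg
        rcases List.mem_cons.1 hg with rfl | hg
        · exact ⟨x, by simp, hx⟩
        · obtain ⟨z, hz, hzg⟩ := l6 g hg
          exact ⟨z, List.mem_cons_of_mem _ (List.mem_cons_of_mem _ hz), hzg⟩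
      · simp; omega

theorem exists_cyc {V : Type*} {G : SimpleGraph V} {F M : Finset (Sym2 V)}
    (hF : G.IsStrongClique F) (hMF : M ⊆ F) (hM : DisjE M) (h2 : 2 ≤ M.card) :
    ∃ L, CycList G L ∧ L.length ≤ 2 * M.card ∧ ∀ e ∈ M, ∃ z ∈ L, z ∈ e := by
  have hconn : ∀ e ∈ M, ∀ f ∈ M, e ≠ f → ∃ x ∈ e, ∃ y ∈ f, G.Adj x y := by
    intro e he f hf hne
    obtain ⟨x, hx, y, hy, h⟩ := hF.2 e (hMF he) f (hMF hf) hne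
    rcases h with rfl | h
    · exact absurd hy (hM e he f hf hne x hx)
    · exact ⟨x, hx, y, hy, h⟩
  have hlen := M.length_toList
  have hnd := M.nodup_toList
  have hmem : ∀ e, e ∈ M.toList ↔ e ∈ M := fun e => Finset.mem_toList
  generalize M.toList = es at hlen hnd hmem
  rcases es with _ | ⟨e, es⟩
  · simp at hlen; omega
  have hes : es ≠ [] := by rintro rfl; simp at hlen; omega
  have hlast : es.getLast hes ∈ es := List.getLast_mem hes
  have hne : es.getLast hes ≠ e := by
    intro h; rw [h] at hlast; exact (List.nodup_cons.1 hnd).1 hlast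
  obtain ⟨y, hy, x, hx, hyx⟩ := hconn _ ((hmem _).1 (List.mem_cons_of_mem _ hlast)) e
    ((hmem _).1 (by simp)) hne
  have hpw : (e :: es).Pairwise
      (fun e f => (∀ v ∈ e, v ∉ f) ∧ ∃ x ∈ e, ∃ y ∈ f, G.Adj x y) := by
    refine List.Pairwise.imp_of_mem ?_ hnd
    intro a b ha hb hab
    exact ⟨hM a ((hmem _).1 ha) b ((hmem _).1 hb) hab, hconn a ((hmem _).1 ha) b ((hmem _).1 hb) hab⟩
  have hed : ∀ g ∈ e :: es, g ∈ G.edgeSet := fun g hg => hF.1 (hMF ((hmem g).1 hg))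
  have hyl : ∀ g ∈ (e :: es).getLast?, y ∈ g := by
    intro g hg
    rw [List.getLast?_cons, List.getLast?_eq_some_getLast hes] at hg
    simp at hg
    subst hg; exact hy
  obtain ⟨L, l1, l2, l3, l4, l5, l6, l7⟩ := exists_path es e hpw hed x hx y hyl
  refine ⟨L, ⟨l4, l3, ?_⟩, ?_, ?_⟩
  · intro a ha b hb
    rw [l2] at ha; rw [l1] at hb; simp at ha hb; subst ha; subst hb; exact hyx
  · simp at hlen; omega
  · intro g hg; exact l6 g ((hmem g).2 hg)

theorem cover_main {V : Type*} [DecidableEq V] {G : SimpleGraph V} {F M : Finset (Sym2 V)} {k : ℕ}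
    (h1 : ¬ G.ContainsSub (cycleGraph (2 * k)))
    (h2 : ¬ G.ContainsSub (cycleGraph (2 * k + 1)))
    (h3 : ¬ G.ContainsSub (cycleGraph (2 * k + 2)))
    (hF : G.IsStrongClique F) (hMF : M ⊆ F) (hM : DisjE M) (hn3 : 3 ≤ M.card) (hnk : k ≤ M.card)
    (hk : 2 ≤ k)
    {L : List V} (hL : CycList G L) (hlen : L.length ≤ 2 * k - 1)
    (ht : ∀ e ∈ M, ∃ z ∈ L, z ∈ e)
    (hmax : ∀ L', CycList G L' → L.length < L'.length → L'.length ≤ 2 * k - 1 →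
      (∀ z ∈ L, z ∈ L') → False) :
    ∀ f ∈ F, ∃ z ∈ L, z ∈ f := by
  classical
  have hno : ∀ L', CycList G L' → 2 * k ≤ L'.length → L'.length ≤ 2 * k + 2 → False := by
    intro L' hL' ha hb
    have : L'.length = 2 * k ∨ L'.length = 2 * k + 1 ∨ L'.length = 2 * k + 2 := by omega
    rcases this with h | h | h
    · exact h1 (hL'.contains h (by omega))
    · exact h2 (hL'.contains h (by omega))
    · exact h3 (hL'.contains h (by omega))
  intro f hf
  by_contra hcon
  push Not at hcon
  induction f using Sym2.ind with
  | _ u v =>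
  have hu : u ∉ L := fun h => hcon u h (by simp)
  have hv : v ∉ L := fun h => hcon v h (by simp)
  have huv : G.Adj u v := by simpa using hF.1 hf
  let A : V → Prop := fun c => TAnch G u v c ∨ PAnch G M L u v c
  have hA : ∀ e ∈ M, ∃ c ∈ L, c ∈ e ∧ A c := by
    intro e he
    obtain ⟨c, hcL, hce⟩ := ht e he
    obtain ⟨x, rfl⟩ := Sym2.mem_iff_exists.1 hce
    have hcx : G.Adj c x := by simpa using hF.1 (hMF he)
    have hne : s(c, x) ≠ s(u, v) := by
      intro h; apply hcon c hcL; rw [← h]; simp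
    obtain ⟨a, ha, b, hb, hab⟩ := hF.2 _ (hMF he) _ hf hne
    by_cases hT : TAnch G u v c
    · exact ⟨c, hcL, by simp, Or.inl hT⟩
    have hxu : x ≠ u := by rintro rfl; exact hT (Or.inl hcx)
    have hxv : x ≠ v := by rintro rfl; exact hT (Or.inr hcx)
    have hcu : c ≠ u := by rintro rfl; exact hu hcL
    have hcv : c ≠ v := by rintro rfl; exact hv hcL
    have hx : G.Adj x u ∨ G.Adj x v := by
      simp only [Sym2.mem_iff] at ha hb
      unfold TAnch at hT
      rcases ha with rfl | rfl <;> rcases hb with rfl | rfl <;> tauto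
    by_cases hxL : x ∈ L
    · exact ⟨x, hxL, by simp, Or.inl hx⟩
    · exact ⟨c, hcL, by simp, Or.inr ⟨x, hxL, hxu, hxv, he, hcx, hx⟩⟩
  let S := L.toFinset.filter A
  have hScard : M.card ≤ S.card := by
    have : Nonempty V := ⟨u⟩
    choose! g hg using hA
    refine Finset.card_le_card_of_injOn g ?_ ?_
    · intro e he
      have := hg e he
      simp only [S, Finset.coe_filter, List.mem_toFinset, Set.mem_ofPred_eq]
      exact ⟨this.1, this.2.2⟩
    · intro e he e' he' hee
      by_contra hne
      refine hM e he e' he' hne (g e) (hg e he).2.1 ?_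
      rw [hee]; exact (hg e' he').2.1
  have hLcard : L.toFinset.card = L.length := List.toFinset_card_of_nodup hL.1
  have hSL : S.card ≤ L.toFinset.card := Finset.card_filter_le _ _
  have stepA : ∀ x y B, CycList G (x :: y :: B) → (x :: y :: B).length = L.length →
      (∀ z, z ∈ x :: y :: B ↔ z ∈ L) → A x → A y →
      ¬ TAnch G u v x ∧ ¬ TAnch G u v y ∧ L.length = 2 * k - 1 := by
    intro x y B hc hl hm ax ay
    have hxy : x ≠ y := by
      rintro rfl; have := hc.1; simp at this
    obtain ⟨p, p1, p2, p3, p4, p5, p6, p7⟩ := reach hM huv hu hv hxy ax ay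
    have hc' := CycList.splice (D := []) hc p7 p1 (fun z hz h => p2 z hz ((hm z).1 h))
    have hl' : (x :: (p ++ y :: B)).length = L.length + p.length := by
      simp at hl ⊢; omega
    by_cases hlt : L.length + p.length ≤ 2 * k + 2
    · exfalso
      by_cases hle : L.length + p.length ≤ 2 * k - 1
      · refine hmax _ hc' (by omega) (by omega) ?_
        intro z hz
        have := (hm z).2 hz
        simp at this ⊢; tauto
      · exact hno _ hc' (by omega) (by omega)
    · refine ⟨fun h => ?_, fun h => ?_, by omega⟩
      · have := p5 (Or.inl h); omega
      · have := p5 (Or.inr h); omega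
  have stepB : ∀ x w y B, CycList G (x :: w :: y :: B) → (x :: w :: y :: B).length = L.length →
      (∀ z, z ∈ x :: w :: y :: B ↔ z ∈ L) → L.length = 2 * k - 1 → A x → A y →
      ¬ TAnch G u v x ∨ ¬ TAnch G u v y → False := by
    intro x w y B hc hl hm hk1 ax ay hT
    have hxy : x ≠ y := by
      rintro rfl; have := hc.1; simp at this
    obtain ⟨p, p1, p2, p3, p4, p5, p6, p7⟩ := reach hM huv hu hv hxy ax ay
    have hc' := CycList.splice (D := [w]) hc p7 p1 (fun z hz h => p2 z hz ((hm z).1 h))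
    have hl' : (x :: (p ++ y :: B)).length + 1 = L.length + p.length := by
      simp at hl ⊢; omega
    have := p6 hT
    exact hno _ hc' (by omega) (by omega)
  have key : ∀ x ∈ L, A x → A (L.formPerm x) →
      ¬ A (L.formPerm (L.formPerm x)) ∧
        (4 ≤ L.length → ¬ A (L.formPerm (L.formPerm (L.formPerm x)))) := by
    intro x hx ax ay
    obtain ⟨T, hc, hl, hm, hσ⟩ := hL.rot hx
    have g0 := List.formPerm_apply_lt_getElem _ hc.1
    rw [hσ] at g0
    rcases T with _ | ⟨y, _ | ⟨z, B⟩⟩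
    · simp at hl; omega
    · simp at hl; omega
    have e0 : L.formPerm x = y := by simpa using g0 0 (by simp)
    have e1 : L.formPerm y = z := g0 1 (by simp)
    rw [e0] at ay
    rw [e0, e1]
    obtain ⟨tx, ty, hk1⟩ := stepA x y (z :: B) hc hl hm ax ay
    refine ⟨fun az => stepB x y z B hc hl hm hk1 ax az (Or.inl tx), fun h4 => ?_⟩
    rcases B with _ | ⟨w, B⟩
    · simp at hl; omega
    have e2 : L.formPerm z = w := g0 2 (by simp)
    rw [e2]
    intro aw
    have hc2 : CycList G ((y :: z :: w :: B) ++ [x]) := CycList.swap (A := [x]) hc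
    refine stepB y z w (B ++ [x]) hc2 (by simp at hl ⊢; omega) ?_ hk1 ay aw (Or.inl ty)
    intro t; rw [← hm t]
    exact (List.perm_append_comm (l₁ := y :: z :: w :: B) (l₂ := [x])).mem_iff
  have hinj := L.formPerm.injective
  by_cases hl3 : L.length = 3
  · have hS : S = L.toFinset := Finset.eq_of_subset_of_card_le (Finset.filter_subset _ _) (by omega)
    have hall : ∀ x ∈ L, A x := by
      intro x hx
      have : x ∈ S := by rw [hS]; simpa using hx
      exact (Finset.mem_filter.1 this).2
    obtain ⟨x, hx⟩ := List.exists_mem_of_length_pos (l := L) (by omega)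
    have hx1 := List.formPerm_apply_mem_of_mem hx
    have hx2 := List.formPerm_apply_mem_of_mem hx1
    exact (key x hx (hall _ hx) (hall _ hx1)).1 (hall _ hx2)
  · have hle : S.card ≤ (L.toFinset \ S).card := by
      refine Finset.card_le_card_of_injOn
        (fun x => if A (L.formPerm x) then L.formPerm (L.formPerm (L.formPerm x))
          else L.formPerm x) ?_ ?_
      · intro x hx
        have hx' := Finset.mem_filter.1 hx
        have hxL : x ∈ L := by simpa using hx'.1
        have hx1 := List.formPerm_apply_mem_of_mem hxL
        have hx2 := List.formPerm_apply_mem_of_mem hx1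
        have hx3 := List.formPerm_apply_mem_of_mem hx2
        simp only [Finset.coe_sdiff, Set.mem_sdiff, Finset.mem_coe, S, Finset.mem_filter,
          List.mem_toFinset, not_and]
        split_ifs with h
        · exact ⟨hx3, fun _ => (key x hxL hx'.2 h).2 (by omega)⟩
        · exact ⟨hx1, fun _ => h⟩
      · intro x hx y hy hxy
        have hx' := Finset.mem_filter.1 hx
        have hy' := Finset.mem_filter.1 hy
        have hxL : x ∈ L := by simpa using hx'.1
        have hyL : y ∈ L := by simpa using hy'.1
        dsimp only at hxy
        split_ifs at hxy with ha hb hb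
        · exact hinj (hinj (hinj hxy))
        · have := hinj hxy
          exact absurd (this ▸ hy'.2) (key x hxL hx'.2 ha).1
        · have := hinj hxy
          exact absurd (this ▸ hx'.2) (key y hyL hy'.2 hb).1
        · exact hinj hxy
    have hsub : S ⊆ L.toFinset := Finset.filter_subset _ _
    have := Finset.card_sdiff_add_card_eq_card hsub
    omega

theorem count_cyc {V : Type*} [Fintype V] [DecidableEq V] {G : SimpleGraph V} [DecidableRel G.Adj]
    {F : Finset (Sym2 V)} (hF : (F : Set (Sym2 V)) ⊆ G.edgeSet) {L : List V} (hL : CycList G L)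
    (h3 : 3 ≤ L.length) (ht : ∀ f ∈ F, ∃ z ∈ L, z ∈ f) :
    F.card ≤ L.length * (G.maxDegree - 1) := by
  have hσ : ∀ x ∈ L, L.formPerm x ∈ L ∧ G.Adj x (L.formPerm x) ∧
      L.formPerm (L.formPerm x) ≠ x := by
    intro x hx
    refine ⟨List.formPerm_apply_mem_of_mem hx, ?_⟩
    obtain ⟨T, hc, hl, hm, hs⟩ := hL.rot hx
    have g0 := List.formPerm_apply_lt_getElem _ hc.1
    rw [hs] at g0
    rcases T with _ | ⟨y, _ | ⟨z, B⟩⟩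
    · simp at hl; omega
    · simp at hl; omega
    have e0 : L.formPerm x = y := g0 0 (by simp)
    have e1 : L.formPerm y = z := g0 1 (by simp)
    rw [e0, e1]
    refine ⟨?_, ?_⟩
    · have := hc.2.1; rw [List.isChain_cons_cons] at this; exact this.1
    · rintro rfl; have := hc.1; simp at this
  have hsub : F ⊆ L.toFinset.biUnion
      (fun x => (G.incidenceFinset x).erase s(x, L.formPerm x)) := by
    intro f hf
    obtain ⟨z, hz, hzf⟩ := ht f hf
    rw [Finset.mem_biUnion]
    by_cases h : f = s(z, L.formPerm z)
    · refine ⟨L.formPerm z, by simpa using (hσ z hz).1, ?_⟩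
      rw [Finset.mem_erase, mem_incidenceFinset]
      refine ⟨?_, hF hf, by rw [h]; simp⟩
      intro h'
      rw [h, Sym2.eq_swap, Sym2.congr_right] at h'
      exact (hσ z hz).2.2 h'.symm
    · refine ⟨z, by simpa using hz, ?_⟩
      rw [Finset.mem_erase, mem_incidenceFinset]
      exact ⟨h, hF hf, hzf⟩
  refine (Finset.card_le_card hsub).trans ?_
  refine (Finset.card_biUnion_le_card_mul _ _ (G.maxDegree - 1) ?_).trans ?_
  · intro x hx
    have hx : x ∈ L := by simpa using hx
    rw [Finset.card_erase_of_mem, card_incidenceFinset_eq_degree]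
    · have := G.degree_le_maxDegree x; omega
    · rw [mem_incidenceFinset, mem_incidenceSet]; exact (hσ x hx).2.1
  · exact Nat.mul_le_mul_right _ (List.toFinset_card_le L)

theorem count_trivial {V : Type*} [Fintype V] [DecidableEq V] {G : SimpleGraph V}
    [DecidableRel G.Adj] {F : Finset (Sym2 V)} (hF : G.IsStrongClique F) (hne : F.Nonempty) :
    F.card ≤ 1 + 2 * ((G.maxDegree - 1) * G.maxDegree) := by
  obtain ⟨e, he⟩ := hne
  induction e using Sym2.ind with
  | _ a b =>
  have hab : G.Adj a b := by simpa using hF.1 he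
  have hmemI : ∀ f ∈ F, ∀ v ∈ f, f ∈ G.incidenceFinset v := by
    intro f hf v hv
    rw [mem_incidenceFinset]; exact ⟨hF.1 hf, hv⟩
  have hbd : ∀ a b, G.Adj a b →
      (((G.neighborFinset a).erase b).biUnion (fun w => G.incidenceFinset w)).card
        ≤ (G.maxDegree - 1) * G.maxDegree := by
    intro a b hab
    refine (Finset.card_biUnion_le_card_mul _ _ G.maxDegree ?_).trans ?_
    · intro x _
      rw [card_incidenceFinset_eq_degree]; exact G.degree_le_maxDegree x
    · refine Nat.mul_le_mul_right _ ?_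
      rw [Finset.card_erase_of_mem (by simpa using hab), card_neighborFinset_eq_degree]
      have := G.degree_le_maxDegree a; omega
  have hsub : F ⊆ {s(a, b)} ∪ (((G.neighborFinset a).erase b).biUnion (fun w => G.incidenceFinset w)
      ∪ ((G.neighborFinset b).erase a).biUnion (fun w => G.incidenceFinset w)) := by
    intro f hf
    by_cases hfe : f = s(a, b)
    · simp [hfe]
    have inc : ∀ a b, f ≠ s(a, b) → a ∈ f →
        f ∈ ((G.neighborFinset a).erase b).biUnion (fun w => G.incidenceFinset w) := by
      intro a b hfe haf
      obtain ⟨w, rfl⟩ := Sym2.mem_iff_exists.1 haf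
      rw [Finset.mem_biUnion]
      refine ⟨w, ?_, hmemI _ hf w (by simp)⟩
      have haw : G.Adj a w := by simpa using hF.1 hf
      rw [Finset.mem_erase, mem_neighborFinset]
      exact ⟨by rintro rfl; exact hfe rfl, haw⟩
    have inc2 : ∀ a b, f ≠ s(a, b) → ∀ y ∈ f, G.Adj a y → y ≠ b →
        f ∈ ((G.neighborFinset a).erase b).biUnion (fun w => G.incidenceFinset w) := by
      intro a b hfe y hy hay hyb
      rw [Finset.mem_biUnion]
      refine ⟨y, ?_, hmemI _ hf y hy⟩
      rw [Finset.mem_erase, mem_neighborFinset]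
      exact ⟨hyb, hay⟩
    have hfe' : f ≠ s(b, a) := by rw [Sym2.eq_swap]; exact hfe
    rw [Finset.mem_union, Finset.mem_union]
    right
    obtain ⟨x, hx, y, hy, h⟩ := hF.2 _ he _ hf (Ne.symm hfe)
    simp only [Sym2.mem_iff] at hx
    rcases hx with rfl | rfl
    · rcases h with rfl | h
      · left; exact inc _ _ hfe hy
      · by_cases hyb : y = b
        · subst hyb; right; exact inc _ _ hfe' hy
        · left; exact inc2 _ _ hfe y hy h hyb
    · rcases h with rfl | h
      · right; exact inc _ _ hfe' hy
      · by_cases hyb : y = a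
        · subst hyb; left; exact inc _ _ hfe hy
        · right; exact inc2 _ _ hfe' y hy h hyb
  have c1 := Finset.card_le_card hsub
  have c2 := Finset.card_union_le ({s(a, b)} : Finset (Sym2 V))
    (((G.neighborFinset a).erase b).biUnion (fun w => G.incidenceFinset w)
      ∪ ((G.neighborFinset b).erase a).biUnion (fun w => G.incidenceFinset w))
  have c3 := Finset.card_union_le
    (((G.neighborFinset a).erase b).biUnion (fun w => G.incidenceFinset w))
    (((G.neighborFinset b).erase a).biUnion (fun w => G.incidenceFinset w))
  have c4 := hbd a b hab
  have c5 := hbd b a hab.symm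
  rw [Finset.card_singleton] at c2
  omega

theorem count_matching {V : Type*} [Fintype V] [DecidableEq V] {G : SimpleGraph V}
    [DecidableRel G.Adj] {F M : Finset (Sym2 V)} (hF : (F : Set (Sym2 V)) ⊆ G.edgeSet) (hMF : M ⊆ F)
    (ht : ∀ f ∈ F, ∃ e ∈ M, ∃ v, v ∈ e ∧ v ∈ f) :
    F.card ≤ M.card * (2 * G.maxDegree - 1) := by
  classical
  have hsub : F ⊆ M.biUnion (fun e => F.filter (fun f => ∃ v, v ∈ e ∧ v ∈ f)) := by
    intro f hf
    obtain ⟨e, he, h⟩ := ht f hf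
    rw [Finset.mem_biUnion]
    exact ⟨e, he, by rw [Finset.mem_filter]; exact ⟨hf, h⟩⟩
  refine (Finset.card_le_card hsub).trans ?_
  refine Finset.card_biUnion_le_card_mul _ _ _ ?_
  intro e he
  have heF := hMF he
  induction e using Sym2.ind with
  | _ a b =>
  have hab : G.Adj a b := by simpa using hF heF
  have hs : F.filter (fun f => ∃ v, v ∈ s(a, b) ∧ v ∈ f) ⊆
      G.incidenceFinset a ∪ (G.incidenceFinset b).erase s(a, b) := by
    intro f hf
    rw [Finset.mem_filter] at hf
    obtain ⟨hf, v, hv, hvf⟩ := hf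
    rw [Finset.mem_union, Finset.mem_erase, mem_incidenceFinset, mem_incidenceFinset]
    by_cases haf : a ∈ f
    · exact Or.inl ⟨hF hf, haf⟩
    · right
      simp only [Sym2.mem_iff] at hv
      rcases hv with rfl | rfl
      · exact absurd hvf haf
      · exact ⟨by rintro rfl; simp at haf, hF hf, hvf⟩
  have c1 := Finset.card_le_card hs
  have c2 := Finset.card_union_le (G.incidenceFinset a) ((G.incidenceFinset b).erase s(a, b))
  rw [Finset.card_erase_of_mem (by
    rw [mem_incidenceFinset, Sym2.eq_swap, mem_incidenceSet]; exact hab.symm),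
    card_incidenceFinset_eq_degree, card_incidenceFinset_eq_degree] at c2
  have := G.degree_le_maxDegree a
  have := G.degree_le_maxDegree b
  have : 0 < G.degree b := by
    rw [← card_neighborFinset_eq_degree, Finset.card_pos]
    exact ⟨a, by simpa using hab.symm⟩
  omega

/-- Edges from a matching edge `ab` to the outside of `Q`. -/
theorem count_out {V : Type*} [Fintype V] [DecidableEq V] {G : SimpleGraph V}
    [DecidableRel G.Adj] {F : Finset (Sym2 V)} (hF : (F : Set (Sym2 V)) ⊆ G.edgeSet)
    {a b : V} (Q : Finset V) (haQ : a ∈ Q) (hbQ : b ∈ Q) (hab : G.Adj a b) (hΔ : 3 ≤ G.maxDegree)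
    (hno : ∀ r r', r ∉ Q → r' ∉ Q → s(a, r) ∈ F → s(b, r') ∈ F → r = r') (X : Finset (Sym2 V))
    (hXF : X ⊆ F) (hX : ∀ e ∈ X, ∃ r, r ∉ Q ∧ (e = s(a, r) ∨ e = s(b, r))) :
    X.card ≤ G.maxDegree - 1 := by
  have one : ∀ a b, a ∈ Q → b ∈ Q → G.Adj a b → (∀ e ∈ X, ∃ r, r ∉ Q ∧ e = s(a, r)) →
      X.card ≤ G.maxDegree - 1 := by
    intro a b haQ hbQ hab h
    have hs : X ⊆ (G.incidenceFinset a).erase s(a, b) := by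
      intro e he
      obtain ⟨r, hr, rfl⟩ := h e he
      rw [Finset.mem_erase, mem_incidenceFinset]
      refine ⟨?_, hF (hXF he), by simp⟩
      intro h; rw [Sym2.congr_right] at h; subst h; exact hr hbQ
    refine (Finset.card_le_card hs).trans ?_
    rw [Finset.card_erase_of_mem (by rw [mem_incidenceFinset, mem_incidenceSet]; exact hab),
      card_incidenceFinset_eq_degree]
    have := G.degree_le_maxDegree a; omega
  by_cases hA : ∃ r, r ∉ Q ∧ s(a, r) ∈ X
  · by_cases hB : ∃ r, r ∉ Q ∧ s(b, r) ∈ X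
    · obtain ⟨r, hr, hra⟩ := hA
      obtain ⟨r', hr', hrb⟩ := hB
      have : r = r' := hno r r' hr hr' (hXF hra) (hXF hrb)
      subst this
      have hs : X ⊆ {s(a, r), s(b, r)} := by
        intro e he
        obtain ⟨t, ht, rfl | rfl⟩ := hX e he
        · have : t = r := hno t r ht hr (hXF he) (hXF hrb)
          simp [this]
        · have : r = t := hno r t hr ht (hXF hra) (hXF he)
          simp [this]
      have := (Finset.card_le_card hs).trans Finset.card_le_two
      omega
    · refine one a b haQ hbQ hab ?_
      intro e he
      obtain ⟨t, ht, rfl | rfl⟩ := hX e he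
      · exact ⟨t, ht, rfl⟩
      · exact absurd ⟨t, ht, he⟩ hB
  · refine one b a hbQ haQ hab.symm ?_
    intro e he
    obtain ⟨t, ht, rfl | rfl⟩ := hX e he
    · exact absurd ⟨t, ht, he⟩ hA
    · exact ⟨t, ht, rfl⟩

theorem disjE_three {V : Type*} [DecidableEq V] {a r b r' c d : V}
    (h : [a, r, b, r', c, d].Nodup) :
    DisjE ({s(a, r), s(b, r'), s(c, d)} : Finset (Sym2 V)) ∧
      ({s(a, r), s(b, r'), s(c, d)} : Finset (Sym2 V)).card = 3 := by
  simp only [List.nodup_cons, List.mem_cons, List.not_mem_nil, or_false, not_or] at h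
  refine ⟨?_, ?_⟩
  · intro e he f hf hne v hv hv'
    simp only [Finset.mem_insert, Finset.mem_singleton] at he hf
    rcases he with rfl | rfl | rfl <;> rcases hf with rfl | rfl | rfl <;>
      simp only [Sym2.mem_iff] at hv hv' <;> grind
  · rw [Finset.card_eq_three]
    refine ⟨_, _, _, ?_, ?_, ?_, rfl⟩ <;>
    · simp only [ne_eq, Sym2.eq_iff]; grind

theorem count_two {V : Type*} [Fintype V] [DecidableEq V] {G : SimpleGraph V}
    [DecidableRel G.Adj] {F : Finset (Sym2 V)} (hF : (F : Set (Sym2 V)) ⊆ G.edgeSet)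
    (h4 : ¬ G.ContainsSub (cycleGraph 4)) (hΔ : 3 ≤ G.maxDegree)
    {a b c d : V} (hnd : [a, b, c, d].Nodup) (hab : s(a, b) ∈ F) (hcd : s(c, d) ∈ F)
    (hmax : ∀ N ⊆ F, DisjE N → N.card ≤ 2)
    (ht : ∀ f ∈ F, a ∈ f ∨ b ∈ f ∨ c ∈ f ∨ d ∈ f) :
    F.card ≤ 2 * G.maxDegree + 2 := by
  classical
  have adj : ∀ x y, s(x, y) ∈ F → G.Adj x y := fun x y h => by simpa using hF h
  let Q : Finset V := {a, b, c, d}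
  have hQ : ∀ r, r ∉ Q ↔ r ≠ a ∧ r ≠ b ∧ r ≠ c ∧ r ≠ d := by intro r; simp [Q]
  have hnd' := hnd
  simp only [List.nodup_cons, List.mem_cons, List.not_mem_nil, or_false, not_or] at hnd'
  let X1 := F.filter (fun e => ∃ r, r ∉ Q ∧ (e = s(a, r) ∨ e = s(b, r)))
  let X2 := F.filter (fun e => ∃ r, r ∉ Q ∧ (e = s(c, r) ∨ e = s(d, r)))
  have c1 : X1.card ≤ G.maxDegree - 1 := by
    refine count_out hF Q (by simp [Q]) (by simp [Q]) (adj _ _ hab) hΔ ?_ X1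
      (Finset.filter_subset _ _) (fun e he => (Finset.mem_filter.1 he).2)
    intro r r' hr hr' h h'
    by_contra hne
    rw [hQ] at hr hr'
    have hd := disjE_three (a := a) (r := r) (b := b) (r' := r') (c := c) (d := d) (by
      simp only [List.nodup_cons, List.mem_cons, List.not_mem_nil, or_false, not_or]; grind)
    have := hmax _ (by intro e he; simp at he; grind) hd.1
    omega
  have c2 : X2.card ≤ G.maxDegree - 1 := by
    refine count_out hF Q (by simp [Q]) (by simp [Q]) (adj _ _ hcd) hΔ ?_ X2
      (Finset.filter_subset _ _) (fun e he => (Finset.mem_filter.1 he).2)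
    intro r r' hr hr' h h'
    by_contra hne
    rw [hQ] at hr hr'
    have hd := disjE_three (a := c) (r := r) (b := d) (r' := r') (c := a) (d := b) (by
      simp only [List.nodup_cons, List.mem_cons, List.not_mem_nil, or_false, not_or]; grind)
    have := hmax _ (by intro e he; simp at he; grind) hd.1
    omega
  have cyc : ∀ x y z w, [x, y, z, w].Nodup → G.Adj x y → G.Adj y z → G.Adj z w → G.Adj w x → False := by
    intro x y z w hn h1 h2 h3 h5
    refine h4 (CycList.contains (L := [x, y, z, w]) ⟨hn, by simp [h1, h2, h3], by simpa using h5⟩ rfl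
      (by norm_num))
  have pair : ∀ e e' : Sym2 V, (e ∈ F → e' ∈ F → False) → (F.filter (fun f => f = e ∨ f = e')).card ≤ 1 := by
    intro e e' h
    rw [Finset.card_le_one]
    intro x hx y hy
    rw [Finset.mem_filter] at hx hy
    grind
  have p1 := pair s(a, c) s(b, d) (fun h h' => cyc a c d b (by
      simp only [List.nodup_cons, List.mem_cons, List.not_mem_nil, or_false, not_or]; grind)
    (adj _ _ h) (adj _ _ hcd) (adj _ _ h').symm (adj _ _ hab).symm)
  have p2 := pair s(a, d) s(b, c) (fun h h' => cyc a d c b (by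
      simp only [List.nodup_cons, List.mem_cons, List.not_mem_nil, or_false, not_or]; grind)
    (adj _ _ h) (adj _ _ hcd).symm (adj _ _ h').symm (adj _ _ hab).symm)
  have hsub : F ⊆ {s(a, b), s(c, d)} ∪ (F.filter (fun f => f = s(a, c) ∨ f = s(b, d)) ∪
      (F.filter (fun f => f = s(a, d) ∨ f = s(b, c)) ∪ (X1 ∪ X2))) := by
    intro f hf
    have key : ∃ x r, f = s(x, r) ∧ (x = a ∨ x = b ∨ x = c ∨ x = d) := by
      rcases ht f hf with h | h | h | h <;> obtain ⟨r, rfl⟩ := Sym2.mem_iff_exists.1 h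
      · exact ⟨a, r, rfl, by simp⟩
      · exact ⟨b, r, rfl, by simp⟩
      · exact ⟨c, r, rfl, by simp⟩
      · exact ⟨d, r, rfl, by simp⟩
    obtain ⟨x, r, rfl, hx⟩ := key
    have hxr := (adj _ _ hf).ne
    simp only [Finset.mem_union, Finset.mem_insert, Finset.mem_singleton, Finset.mem_filter, X1, X2]
    by_cases hr : r ∈ Q
    · simp only [Q, Finset.mem_insert, Finset.mem_singleton] at hr
      rcases hx with rfl | rfl | rfl | rfl <;> rcases hr with rfl | rfl | rfl | rfl <;>
        first
        | exact absurd rfl hxr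
        | (simp [hf]; done)
        | (simp [hf, Sym2.eq_swap]; done)
        | (rw [Sym2.eq_swap] at hf ⊢; simp [hf]; done)
    · rcases hx with rfl | rfl | rfl | rfl
      · exact Or.inr (Or.inr (Or.inr (Or.inl ⟨hf, r, hr, Or.inl rfl⟩)))
      · exact Or.inr (Or.inr (Or.inr (Or.inl ⟨hf, r, hr, Or.inr rfl⟩)))
      · exact Or.inr (Or.inr (Or.inr (Or.inr ⟨hf, r, hr, Or.inl rfl⟩)))
      · exact Or.inr (Or.inr (Or.inr (Or.inr ⟨hf, r, hr, Or.inr rfl⟩)))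
  have d0 := Finset.card_le_card hsub
  have d1 := Finset.card_union_le ({s(a, b), s(c, d)} : Finset (Sym2 V))
    (F.filter (fun f => f = s(a, c) ∨ f = s(b, d)) ∪
      (F.filter (fun f => f = s(a, d) ∨ f = s(b, c)) ∪ (X1 ∪ X2)))
  have d2 := Finset.card_union_le (F.filter (fun f => f = s(a, c) ∨ f = s(b, d)))
      (F.filter (fun f => f = s(a, d) ∨ f = s(b, c)) ∪ (X1 ∪ X2))
  have d3 := Finset.card_union_le (F.filter (fun f => f = s(a, d) ∨ f = s(b, c))) (X1 ∪ X2)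
  have d4 := Finset.card_union_le X1 X2
  have d5 : ({s(a, b), s(c, d)} : Finset (Sym2 V)).card ≤ 2 := Finset.card_le_two
  omega

theorem exists_max_cyc {V : Type*} {G : SimpleGraph V} {M : Finset (Sym2 V)} {b : ℕ} {L : List V}
    (hL : CycList G L) (hlen : L.length ≤ b) (ht : ∀ e ∈ M, ∃ z ∈ L, z ∈ e) :
    ∃ L, CycList G L ∧ L.length ≤ b ∧ (∀ e ∈ M, ∃ z ∈ L, z ∈ e) ∧
      ∀ L', CycList G L' → L.length < L'.length → L'.length ≤ b → (∀ z ∈ L, z ∈ L') → False := by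
  classical
  let P : ℕ → Prop := fun m => ∃ L, CycList G L ∧ L.length = m ∧ ∀ e ∈ M, ∃ z ∈ L, z ∈ e
  have hP : P L.length := ⟨L, hL, rfl, ht⟩
  obtain ⟨L1, hc, hl, h⟩ : P (Nat.findGreatest P b) := Nat.findGreatest_spec hlen hP
  refine ⟨L1, hc, hl ▸ Nat.findGreatest_le b, h, ?_⟩
  intro L' hc' hlt hb hsub
  refine Nat.findGreatest_is_greatest (hl ▸ hlt) hb ⟨L', hc', rfl, ?_⟩
  intro e he
  obtain ⟨z, hz, hze⟩ := h e he
  exact ⟨z, hsub z hz, hze⟩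

theorem card_le_touch {V : Type*} {M : Finset (Sym2 V)} (hM : DisjE M) {L : List V}
    (ht : ∀ e ∈ M, ∃ z ∈ L, z ∈ e) : M.card ≤ L.length := by
  classical
  have ht' : ∀ e : Sym2 V, ∃ z, e ∈ M → z ∈ L ∧ z ∈ e := by
    intro e
    by_cases he : e ∈ M
    · obtain ⟨z, h, h'⟩ := ht e he
      exact ⟨z, fun _ => ⟨h, h'⟩⟩
    · exact ⟨e.out.1, fun h => absurd h he⟩
  choose g hgg using ht'
  have hg := fun e he => (hgg e he).1
  have hg' := fun e he => (hgg e he).2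
  calc M.card ≤ L.toFinset.card := by
        apply Finset.card_le_card_of_injOn g
        · intro e he
          simpa using hg e he
        · intro e he f hf hef
          by_contra hne
          exact hM e he f hf hne (g e) (hg' e he) (hef ▸ hg' f hf)
    _ ≤ L.length := List.toFinset_card_le L

theorem clique_bound_s5 {V : Type*} [Fintype V] [DecidableEq V]
    (k : ℕ) (hk : 2 ≤ k) (G : SimpleGraph V) [DecidableRel G.Adj]
    (h1 : ¬ G.ContainsSub (cycleGraph (2 * k)))
    (h2 : ¬ G.ContainsSub (cycleGraph (2 * k + 1)))
    (h3 : ¬ G.ContainsSub (cycleGraph (2 * k + 2)))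
    {F : Finset (Sym2 V)} (hF : G.IsStrongClique F) :
    F.card ≤ (2 * k - 1) * (G.maxDegree - 1) + 2 := by
  classical
  rcases F.eq_empty_or_nonempty with rfl | hne
  · simp
  have hpos : 1 ≤ G.maxDegree := by
    obtain ⟨e, he⟩ := hne
    induction e using Sym2.ind with
    | _ a b =>
    have hab : G.Adj a b := by simpa using hF.1 he
    have : 0 < G.degree a := (G.degree_pos_iff_exists_adj a).2 ⟨b, hab⟩
    exact le_trans this (G.degree_le_maxDegree a)
  obtain ⟨M, hMm, hMmax⟩ := Finset.exists_max_image (F.powerset.filter fun N => DisjE N)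
    Finset.card ⟨∅, Finset.mem_filter.2 ⟨by simp, fun e he => by simp at he⟩⟩
  simp only [Finset.mem_filter, Finset.mem_powerset] at hMm hMmax
  obtain ⟨hMF, hM⟩ := hMm
  have hmeet : ∀ f ∈ F, ∃ e ∈ M, ∃ v, v ∈ e ∧ v ∈ f := by
    intro f hf
    by_contra hno
    push Not at hno
    have hfM : f ∉ M := by
      intro h
      induction f using Sym2.ind with
      | _ a b => exact hno _ h a (by simp) (by simp)
    have := hMmax (insert f M) ⟨Finset.insert_subset hf hMF, by
      intro e he g hg hne v hv hvg
      rw [Finset.mem_insert] at he hg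
      rcases he with rfl | he <;> rcases hg with rfl | hg
      · exact hne rfl
      · exact hno g hg v hvg hv
      · exact hno e he v hv hvg
      · exact hM e he g hg hne v hv hvg⟩
    rw [Finset.card_insert_of_notMem hfM] at this
    omega
  have htriv := count_trivial hF hne
  have hmat := count_matching hF.1 hMF hmeet
  by_cases hbig : max k 3 ≤ M.card
  · obtain ⟨M', hM', hc'⟩ := Finset.exists_subset_card_eq hbig
    have hD' : DisjE M' := fun e he f hf => hM e (hM' he) f (hM' hf)
    have hn3 : 3 ≤ M'.card := hc' ▸ le_max_right _ _
    have hnk : k ≤ M'.card := hc' ▸ le_max_left _ _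
    obtain ⟨L0, hL0, hl0, ht0⟩ := exists_cyc hF (hM'.trans hMF) hD' (by omega)
    have hno : ∀ n, L0.length = n → 2 ≤ n → G.ContainsSub (cycleGraph n) :=
      fun n h h' => hL0.contains h h'
    have hlen : L0.length ≤ 2 * k - 1 := by
      have a1 : L0.length ≠ 2 * k := fun h => h1 (hno _ h (by omega))
      have a2 : L0.length ≠ 2 * k + 1 := fun h => h2 (hno _ h (by omega))
      have a3 : L0.length ≠ 2 * k + 2 := fun h => h3 (hno _ h (by omega))
      omega
    obtain ⟨L, hL, hl, ht, hmax⟩ := exists_max_cyc hL0 hlen ht0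
    have hcov := cover_main h1 h2 h3 hF (hM'.trans hMF) hD' hn3 hnk hk hL hl ht hmax
    have := count_cyc hF.1 hL (hn3.trans (card_le_touch hD' ht)) hcov
    have := Nat.mul_le_mul_right (G.maxDegree - 1) hl
    omega
  · obtain ⟨j, rfl⟩ : ∃ j, k = j + 2 := ⟨k - 2, by omega⟩
    obtain ⟨d, hd⟩ : ∃ d, G.maxDegree = d + 1 := ⟨G.maxDegree - 1, by omega⟩
    have e1 : 2 * (j + 2) - 1 = 2 * j + 3 := by omega
    have e2 : 2 * (d + 1) - 1 = 2 * d + 1 := by omega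
    by_cases hsm : M.card ≤ j + 1
    · rw [hd] at htriv hmat ⊢
      rw [e1]
      rw [e2] at hmat
      simp only [Nat.add_sub_cancel] at *
      by_cases hdj : d ≤ j
      · nlinarith
      · have := Nat.mul_le_mul_right (2 * d + 1) hsm
        nlinarith
    · have hj : j = 0 := by omega
      subst hj
      have hc2 : M.card = 2 := by omega
      by_cases hd3 : 3 ≤ G.maxDegree
      · obtain ⟨e, f, hef, rfl⟩ := Finset.card_eq_two.1 hc2
        have hdis := hM e (by simp) f (by simp) hef
        have heF : e ∈ F := hMF (by simp)
        have hfF : f ∈ F := hMF (by simp)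
        induction e using Sym2.ind with
        | _ a b =>
        induction f using Sym2.ind with
        | _ c d' =>
        have hab : G.Adj a b := by simpa using hF.1 heF
        have hcd : G.Adj c d' := by simpa using hF.1 hfF
        have da := hdis a (by simp)
        have db := hdis b (by simp)
        simp only [Sym2.mem_iff, not_or] at da db
        have := count_two hF.1 h1 hd3 (a := a) (b := b) (c := c) (d := d')
          (by simp [hab.ne, hcd.ne, da, db]) heF hfF
          (fun N hN hD => hc2 ▸ hMmax N ⟨hN, hD⟩) (by
            intro f hf
            obtain ⟨e, he, v, hve, hvf⟩ := hmeet f hf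
            simp only [Finset.mem_insert, Finset.mem_singleton] at he
            rcases he with rfl | rfl <;> rw [Sym2.mem_iff] at hve <;>
              rcases hve with rfl | rfl <;> simp [hvf])
        omega
      · rw [hd] at htriv ⊢
        have : d = 0 ∨ d = 1 := by omega
        rcases this with rfl | rfl <;> simp at htriv ⊢ <;> omega

/-- Theorem 1.5(3): if `k ≥ 2` and `G` is `{C_{2k}, C_{2k+1}, C_{2k+2}}`-free with
maximum degree `Δ`, then `ω₂'(G) ≤ (2k - 1)(Δ - 1) + 2`. -/
theorem strongCliqueNumber_le_of_threeConsecutiveCycleFree {V : Type*} [Fintype V] [DecidableEq V]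
    (k : ℕ) (hk : 2 ≤ k) (G : SimpleGraph V) [DecidableRel G.Adj]
    (Δ : ℕ) (hΔ : G.maxDegree = Δ)
    (h1 : ¬ G.ContainsSub (cycleGraph (2 * k)))
    (h2 : ¬ G.ContainsSub (cycleGraph (2 * k + 1)))
    (h3 : ¬ G.ContainsSub (cycleGraph (2 * k + 2))) :
    G.strongCliqueNumber ≤ (2 * k - 1) * (Δ - 1) + 2 := by
  subst hΔ
  refine csSup_le ⟨0, ∅, ⟨by simp, by simp⟩, rfl⟩ ?_
  rintro n ⟨F, hF, rfl⟩
  exact clique_bound_s5 k hk G h1 h2 h3 hF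
end

section
/- Let k ≥ 2 be an integer and let G be a finite simple graph with maximum degree Δ. If G contains no cycle on 3 vertices, no cycle on 5 vertices, no cycle on 2k vertices, and no cycle on 2k+2 vertices as a subgraph, then ω₂'(G) ≤ max{kΔ, 2k(k − 1)}. -/
open SimpleGraph

/-- A closed sequence of distinct vertices gives a copy of the cycle graph. -/
lemma containsSub_cycle {V : Type*} (G : SimpleGraph V) (n : ℕ) (g : ℕ → V)
    (hn : 0 < n)
    (hinj : ∀ i < n, ∀ j < n, g i = g j → i = j)
    (hadj : ∀ i, i + 1 < n → G.Adj (g i) (g (i + 1)))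
    (hlast : G.Adj (g (n - 1)) (g 0)) : G.ContainsSub (cycleGraph n) := by
  have key : ∀ a b : Fin n, (a - b).val = 1 → G.Adj (g b) (g a) := by
    intro a b h
    have ha := a.2
    have hb := b.2
    rw [Fin.sub_def] at h
    simp only at h
    by_cases hab : b.val ≤ a.val
    · have : n - b.val + a.val = (a.val - b.val) + n := by omega
      rw [this, Nat.add_mod_right, Nat.mod_eq_of_lt (by omega)] at h
      have h' : a.val = b.val + 1 := by omega
      rw [h']
      exact hadj _ (by omega)
    · rw [Nat.mod_eq_of_lt (by omega)] at h
      have h1 : b.val = n - 1 := by omega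
      have h2 : a.val = 0 := by omega
      rw [h1, h2]
      exact hlast
  refine ⟨fun i => g i, ?_, ?_⟩
  · intro a b h
    exact Fin.ext (hinj _ a.2 _ b.2 h)
  · intro a b h
    rw [cycleGraph_adj'] at h
    rcases h with h | h
    · exact (key _ _ h).symm
    · exact key _ _ h

lemma no_tri {V : Type*} (G : SimpleGraph V) (h1 : ¬ G.ContainsSub (cycleGraph 3))
    {a b c : V} (hab : G.Adj a b) (hbc : G.Adj b c) (hca : G.Adj c a) : False := by
  apply h1
  have := hab.ne
  have := hbc.ne
  have := hca.ne
  refine containsSub_cycle G 3 (fun i => match i with | 0 => a | 1 => b | _ => c)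
    (by norm_num) ?_ ?_ ?_
  · intro i hi j hj
    interval_cases i <;> interval_cases j <;> simp <;> tauto
  · intro i hi
    have : i < 2 := by omega
    interval_cases i <;> simpa
  · simpa

lemma no_five {V : Type*} (G : SimpleGraph V) (h1 : ¬ G.ContainsSub (cycleGraph 3))
    (h2 : ¬ G.ContainsSub (cycleGraph 5))
    {a b c d e : V} (hab : G.Adj a b) (hbc : G.Adj b c) (hcd : G.Adj c d) (hde : G.Adj d e)
    (hea : G.Adj e a) : False := by
  have hac : a ≠ c := by rintro rfl; exact no_tri G h1 hcd hde hea
  have had : a ≠ d := by rintro rfl; exact no_tri G h1 hab hbc hcd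
  have hbd : b ≠ d := by rintro rfl; exact no_tri G h1 hab hde hea
  have hbe : b ≠ e := by rintro rfl; exact no_tri G h1 hbc hcd hde
  have hce : c ≠ e := by rintro rfl; exact no_tri G h1 hab hbc hea
  apply h2
  have := hab.ne
  have := hbc.ne
  have := hcd.ne
  have := hde.ne
  have := hea.ne
  refine containsSub_cycle G 5
    (fun i => match i with | 0 => a | 1 => b | 2 => c | 3 => d | _ => e)
    (by norm_num) ?_ ?_ ?_
  · intro i hi j hj
    interval_cases i <;> interval_cases j <;> simp <;> tauto
  · intro i hi
    have : i < 4 := by omega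
    interval_cases i <;> simpa
  · simpa

lemma insert_chain {ι : Type*} (R : ι → ι → Prop) (hR : ∀ i j, R i j ∨ R j i) (x : ι) :
    ∀ (l : List ι) (a : ι), (a :: l).IsChain R → R a x →
      ∃ l' : List ι, l'.Perm (x :: l) ∧ (a :: l').IsChain R := by
  intro l
  induction l with
  | nil => intro a _ h; exact ⟨[x], List.Perm.refl _, by simpa using h⟩
  | cons b l ih =>
    intro a hc hax
    rw [List.isChain_cons_cons] at hc
    rcases hR x b with h | h
    · exact ⟨x :: b :: l, List.Perm.refl _, by
        rw [List.isChain_cons_cons, List.isChain_cons_cons]; exact ⟨hax, h, hc.2⟩⟩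
    · obtain ⟨l', hp, hl⟩ := ih b hc.2 h
      refine ⟨b :: l', (hp.cons b).trans (List.Perm.swap x b l), ?_⟩
      rw [List.isChain_cons_cons]
      exact ⟨hc.1, hl⟩

lemma exists_chain {ι : Type*} (R : ι → ι → Prop) (hR : ∀ i j, R i j ∨ R j i) (l : List ι) :
    ∃ l' : List ι, l'.Perm l ∧ l'.IsChain R := by
  induction l with
  | nil => exact ⟨[], List.Perm.refl _, List.isChain_nil⟩
  | cons x l ih =>
    obtain ⟨l', hp, hl⟩ := ih
    cases l' with
    | nil => exact ⟨[x], hp.cons x, List.isChain_singleton x⟩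
    | cons a t =>
      rcases hR x a with h | h
      · exact ⟨x :: a :: t, hp.cons x, by rw [List.isChain_cons_cons]; exact ⟨h, hl⟩⟩
      · obtain ⟨m, hm, hc⟩ := insert_chain R hR x t a hl h
        exact ⟨a :: m, ((hm.cons a).trans (List.Perm.swap x a t)).trans (hp.cons x), hc⟩

/-- A matching of size `k+1` inside a strong clique yields `C_{2k}` or `C_{2k+2}`. -/
lemma no_matching {V : Type*} (G : SimpleGraph V) (k : ℕ) (hk : 2 ≤ k)
    (h3 : ¬ G.ContainsSub (cycleGraph (2 * k)))
    (h4 : ¬ G.ContainsSub (cycleGraph (2 * k + 2)))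
    (p q : Fin (k + 1) → V) (hp : p.Injective) (hq : q.Injective)
    (hpq : ∀ i j, p i ≠ q j) (hadj : ∀ i, G.Adj (p i) (q i))
    (htot : ∀ i j, G.Adj (q i) (p j) ∨ G.Adj (q j) (p i)) : False := by
  obtain ⟨l, hl, hc⟩ := exists_chain (fun i j => G.Adj (q i) (p j)) htot (List.finRange (k + 1))
  have hlen : l.length = k + 1 := by rw [hl.length_eq, List.length_finRange]
  have hnd : l.Nodup := hl.nodup_iff.2 (List.nodup_finRange _)
  let σ : ℕ → Fin (k + 1) := fun i => l.getD i 0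
  have hσ : ∀ i (h : i < l.length), σ i = l[i] := fun i h => List.getD_eq_getElem _ _ h
  have hσinj : ∀ i < k + 1, ∀ j < k + 1, σ i = σ j → i = j := by
    intro i hi j hj h
    rw [hσ i (by omega), hσ j (by omega)] at h
    exact (hnd.getElem_inj_iff).1 h
  have hσc : ∀ i, i + 1 < k + 1 → G.Adj (q (σ i)) (p (σ (i + 1))) := by
    intro i hi
    rw [hσ i (by omega), hσ (i + 1) (by omega)]
    exact (List.isChain_iff_getElem.1 hc) i (by omega)
  let g : ℕ → V := fun m => if m % 2 = 0 then p (σ (m / 2)) else q (σ (m / 2))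
  have ginj : ∀ i < 2 * k + 2, ∀ j < 2 * k + 2, g i = g j → i = j := by
    intro i hi j hj h
    simp only [g] at h
    split_ifs at h with h1 h2 h2
    · have := hσinj _ (by omega) _ (by omega) (hp h)
      omega
    · exact absurd h (hpq _ _)
    · exact absurd h.symm (hpq _ _)
    · have := hσinj _ (by omega) _ (by omega) (hq h)
      omega
  have gadj : ∀ i, i + 1 < 2 * k + 2 → G.Adj (g i) (g (i + 1)) := by
    intro i hi
    simp only [g]
    rcases Nat.mod_two_eq_zero_or_one i with h | h
    · have e : (i + 1) / 2 = i / 2 := by omega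
      rw [if_pos h, if_neg (by omega), e]
      exact hadj _
    · have e : (i + 1) / 2 = i / 2 + 1 := by omega
      rw [if_neg (by omega), if_pos (by omega), e]
      exact hσc _ (by omega)
  rcases htot (σ k) (σ 0) with h | h
  · apply h4
    refine containsSub_cycle G _ g (by omega) ginj gadj ?_
    have e1 : (2 * k + 2 - 1) % 2 = 1 := by omega
    have e2 : (2 * k + 2 - 1) / 2 = k := by omega
    simp only [g, e1, e2]
    simpa using h
  · apply h3
    refine containsSub_cycle G _ (fun i => g (i + 1)) (by omega) ?_ ?_ ?_
    · intro i hi j hj h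
      have := ginj _ (by omega) _ (by omega) h
      omega
    · intro i hi
      exact gadj _ (by omega)
    · have e0 : 2 * k - 1 + 1 = 2 * k := by omega
      have e1 : (2 * k) % 2 = 0 := by omega
      have e2 : (2 * k) / 2 = k := by omega
      simp only [g, e0, e1, e2]
      simpa using h.symm

/-- One side of the bipartition determined by an edge `uv`. -/
def SidePred {V : Type*} (G : SimpleGraph V) (u v x : V) : Prop :=
  G.Adj u x ∨ (¬ G.Adj v x ∧ ∃ b, G.Adj v b ∧ G.Adj b x)

lemma side_disj {V : Type*} (G : SimpleGraph V) (h1 : ¬ G.ContainsSub (cycleGraph 3))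
    (h2 : ¬ G.ContainsSub (cycleGraph 5)) {u v x : V} (huv : G.Adj u v)
    (hP : SidePred G u v x) (hQ : SidePred G v u x) : False := by
  rcases hP with h | ⟨h, b, hb, hbx⟩ <;> rcases hQ with h' | ⟨h', a, ha, hax⟩
  · exact no_tri G h1 huv h' h.symm
  · exact h' h
  · exact h h'
  · exact no_five G h1 h2 ha hax hbx.symm hb.symm huv.symm

lemma side_indep {V : Type*} (G : SimpleGraph V) (h1 : ¬ G.ContainsSub (cycleGraph 3))
    (h2 : ¬ G.ContainsSub (cycleGraph 5)) {u v x y : V} (huv : G.Adj u v)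
    (hx : SidePred G u v x) (hy : SidePred G u v y) (hxy : G.Adj x y) : False := by
  rcases hx with h | ⟨h, b, hb, hbx⟩ <;> rcases hy with h' | ⟨h', a, ha, hay⟩
  · exact no_tri G h1 h hxy h'.symm
  · exact no_five G h1 h2 h hxy hay.symm ha.symm huv.symm
  · exact no_five G h1 h2 h' hxy.symm hbx.symm hb.symm huv.symm
  · exact no_five G h1 h2 hb hbx hxy hay.symm ha.symm

/-- König-type statement, from Hall: either a matching of size `k+1` or a cover of size `≤ k`. -/
lemma konig {V : Type*} [Fintype V] [DecidableEq V] (t : V → Finset V) (k : ℕ) :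
    (∃ p q : Fin (k + 1) → V, p.Injective ∧ q.Injective ∧ ∀ i, q i ∈ t (p i)) ∨
    (∃ A B : Finset V, A.card + B.card ≤ k ∧ ∀ x, ∀ y ∈ t x, x ∈ A ∨ y ∈ B) := by
  by_cases hV : Fintype.card V ≤ k
  · right
    exact ⟨Finset.univ, ∅, by simpa using hV, fun x y _ => Or.inl (Finset.mem_univ x)⟩
  push Not at hV
  let d := Fintype.card V - (k + 1)
  let T : V → Finset (V ⊕ Fin d) := fun x => (t x).disjSum Finset.univ
  by_cases hall : ∀ S : Finset V, S.card ≤ (S.biUnion T).card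
  · left
    obtain ⟨f, hf, hfT⟩ := (Finset.all_card_le_biUnion_card_iff_exists_injective T).1 hall
    let M : Finset V := Finset.univ.filter fun x => (f x).isLeft
    have hMc : k + 1 ≤ M.card := by
      have hc : (Finset.univ.filter fun x => ¬ (f x).isLeft).card ≤ d := by
        have := Finset.card_le_card_of_injOn (s := Finset.univ.filter fun x => ¬ (f x).isLeft)
          (t := (Finset.univ : Finset (Fin d)).map ⟨Sum.inr, Sum.inr_injective⟩) f (by
            intro x hx
            simp at hx
            rw [Sum.isRight_iff] at hx
            obtain ⟨y, hy⟩ := hx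
            simp [hy]) hf.injOn
        simpa using this
      have hs := Finset.card_filter_add_card_filter_not (s := (Finset.univ : Finset V))
        (fun x => ((f x).isLeft : Prop))
      rw [Finset.card_univ] at hs
      change k + 1 ≤ (Finset.univ.filter fun x => ((f x).isLeft : Prop)).card
      omega
    obtain ⟨M', hM', hM'c⟩ := Finset.exists_subset_card_eq hMc
    let e := (M'.equivFinOfCardEq hM'c).symm
    have hleft : ∀ i, ∃ y, f (e i : V) = Sum.inl y := by
      intro i
      have := hM' (e i).2
      simp [M] at this
      exact Sum.isLeft_iff.1 this
    choose q hq using hleft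
    refine ⟨fun i => e i, q, fun i j h => e.injective (Subtype.ext h), ?_, ?_⟩
    · intro i j h
      have : f (e i : V) = f (e j : V) := by rw [hq, hq, h]
      exact e.injective (Subtype.ext (hf this))
    · intro i
      have := hfT (e i)
      rw [hq] at this
      simpa [T] using this
  · right
    push Not at hall
    obtain ⟨S, hS⟩ := hall
    refine ⟨Sᶜ, S.biUnion t, ?_, ?_⟩
    · have hne : S.Nonempty := by
        rw [Finset.nonempty_iff_ne_empty]; rintro rfl; simp at hS
      have : S.biUnion T = (S.biUnion t).disjSum Finset.univ := by
        ext z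
        rcases z with z | z
        · simp [T]
        · simpa [T] using (show ∃ a, a ∈ S from hne)
      rw [this, Finset.card_disjSum] at hS
      have hcc := Finset.card_compl S
      have := Finset.card_le_univ S
      simp only [Finset.card_univ, Fintype.card_fin] at hS
      omega
    · intro x y hy
      by_cases hx : x ∈ S
      · right; exact Finset.mem_biUnion.2 ⟨x, hx, hy⟩
      · left; simpa using hx

/-- The main bound: every strong clique has at most `kΔ` edges. -/
lemma strongClique_card_le {V : Type*} [Fintype V] [DecidableEq V]
    (k : ℕ) (hk : 2 ≤ k) (G : SimpleGraph V) [DecidableRel G.Adj]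
    (h1 : ¬ G.ContainsSub (cycleGraph 3))
    (h2 : ¬ G.ContainsSub (cycleGraph 5))
    (h3 : ¬ G.ContainsSub (cycleGraph (2 * k)))
    (h4 : ¬ G.ContainsSub (cycleGraph (2 * k + 2)))
    (F : Finset (Sym2 V)) (hF : G.IsStrongClique F) : F.card ≤ k * G.maxDegree := by
  classical
  obtain ⟨hE, hS⟩ := hF
  rcases F.eq_empty_or_nonempty with rfl | ⟨e₀, he₀⟩
  · simp
  obtain ⟨u, v, rfl⟩ : ∃ u v, e₀ = s(u, v) := by
    induction e₀ using Sym2.ind with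
    | _ u v => exact ⟨u, v, rfl⟩
  have huv : G.Adj u v := hE he₀
  let P := SidePred G u v
  let Q := SidePred G v u
  have hPA : ∀ x y, G.Adj x y → G.Adj u x → P x ∧ Q y := by
    intro x y hxy hx
    exact ⟨Or.inl hx, Or.inr ⟨fun hy => no_tri G h1 hx hxy hy.symm, x, hx, hxy⟩⟩
  have hQB : ∀ x y, G.Adj x y → G.Adj v x → Q x ∧ P y := by
    intro x y hxy hx
    exact ⟨Or.inl hx, Or.inr ⟨fun hy => no_tri G h1 hx hxy hy.symm, x, hx, hxy⟩⟩
  have hor : ∀ x y, s(x, y) ∈ F → (P x ∧ Q y) ∨ (P y ∧ Q x) := by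
    intro x y hxy
    have hadj : G.Adj x y := hE hxy
    have main : ∃ z w, G.Adj z w ∧ (z = u ∨ z = v) ∧ (w = x ∨ w = y) := by
      by_cases heq : s(u, v) = s(x, y)
      · rcases Sym2.eq_iff.1 heq with ⟨rfl, rfl⟩ | ⟨rfl, rfl⟩
        · exact ⟨u, v, huv, by simp, by simp⟩
        · exact ⟨u, v, huv, by simp, by simp⟩
      · obtain ⟨z, hz, w, hw, hzw⟩ := hS _ he₀ _ hxy heq
        rw [Sym2.mem_iff] at hz hw
        rcases hzw with rfl | hzw
        · rcases hw with rfl | rfl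
          · exact ⟨z, y, hadj, hz, by simp⟩
          · exact ⟨z, x, hadj.symm, hz, by simp⟩
        · exact ⟨z, w, hzw, hz, hw⟩
    obtain ⟨z, w, hzw, rfl | rfl, rfl | rfl⟩ := main
    · exact Or.inl (hPA _ _ hadj hzw)
    · exact Or.inr (hPA _ _ hadj.symm hzw)
    · exact Or.inr (hQB _ _ hadj hzw).symm
    · exact Or.inl (hQB _ _ hadj.symm hzw).symm
  have hdis : ∀ x, P x → Q x → False := fun x => side_disj G h1 h2 huv
  have hPi : ∀ x y, P x → P y → G.Adj x y → False := fun x y => side_indep G h1 h2 huv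
  have hQi : ∀ x y, Q x → Q y → G.Adj x y → False := fun x y => side_indep G h1 h2 huv.symm
  let t : V → Finset V := fun x => Finset.univ.filter fun y => P x ∧ Q y ∧ s(x, y) ∈ F
  rcases konig t k with ⟨p, q, hp, hq, hm⟩ | ⟨A, B, hAB, hcov⟩
  · exfalso
    have hm' : ∀ i, P (p i) ∧ Q (q i) ∧ s(p i, q i) ∈ F := by
      intro i
      simpa [t] using hm i
    have hpq : ∀ i j, p i ≠ q j := by
      intro i j h
      exact hdis _ (hm' i).1 (h ▸ (hm' j).2.1)
    refine no_matching G k hk h3 h4 p q hp hq hpq (fun i => hE (hm' i).2.2) ?_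
    intro i j
    by_cases hij : i = j
    · subst hij
      left
      have : G.Adj (p i) (q i) := hE (hm' i).2.2
      exact this.symm
    have hne : s(p i, q i) ≠ s(p j, q j) := by
      intro h
      rcases Sym2.eq_iff.1 h with ⟨h, _⟩ | ⟨h, _⟩
      · exact hij (hp h)
      · exact hpq _ _ h
    obtain ⟨x, hx, y, hy, hxy⟩ := hS _ (hm' i).2.2 _ (hm' j).2.2 hne
    rw [Sym2.mem_iff] at hx hy
    rcases hx with rfl | rfl <;> rcases hy with rfl | rfl <;> rcases hxy with hxy | hxy
    · exact absurd (hp hxy) hij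
    · exact (hPi _ _ (hm' i).1 (hm' j).1 hxy).elim
    · exact absurd hxy (hpq _ _)
    · exact Or.inr hxy.symm
    · exact absurd hxy.symm (hpq _ _)
    · exact Or.inl hxy
    · exact absurd (hq hxy) hij
    · exact (hQi _ _ (hm' i).2.1 (hm' j).2.1 hxy).elim
  · have hsub : F ⊆ (A ∪ B).biUnion fun x => G.incidenceFinset x := by
      intro e he
      induction e using Sym2.ind with
      | _ x y =>
        have hadj : s(x, y) ∈ G.edgeSet := hE he
        rw [Finset.mem_biUnion]
        rcases hor x y he with ⟨hx, hy⟩ | ⟨hy, hx⟩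
        · rcases hcov x y (by simp [t, hx, hy, he]) with h | h
          · exact ⟨x, by simp [h], by simpa [incidenceSet] using hadj⟩
          · exact ⟨y, by simp [h], by simpa [incidenceSet] using hadj⟩
        · rcases hcov y x (by simp [t, hx, hy, Sym2.eq_swap, he]) with h | h
          · exact ⟨y, by simp [h], by simpa [incidenceSet] using hadj⟩
          · exact ⟨x, by simp [h], by simpa [incidenceSet] using hadj⟩
    calc F.card ≤ ((A ∪ B).biUnion fun x => G.incidenceFinset x).card := Finset.card_le_card hsub
      _ ≤ (A ∪ B).card * G.maxDegree := by
          apply Finset.card_biUnion_le_card_mul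
          intro x _
          rw [card_incidenceFinset_eq_degree]
          exact G.degree_le_maxDegree x
      _ ≤ k * G.maxDegree :=
          Nat.mul_le_mul_right _ ((Finset.card_union_le A B).trans hAB)

/-- Theorem 1.7: if `k ≥ 2` and `G` is `{C₃, C₅, C_{2k}, C_{2k+2}}`-free with maximum
degree `Δ`, then `ω₂'(G) ≤ max {kΔ, 2k(k - 1)}`. -/
theorem strongCliqueNumber_le_of_fourCycleLengthsFree {V : Type*} [Fintype V] [DecidableEq V]
    (k : ℕ) (hk : 2 ≤ k) (G : SimpleGraph V) [DecidableRel G.Adj]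
    (Δ : ℕ) (hΔ : G.maxDegree = Δ)
    (h1 : ¬ G.ContainsSub (cycleGraph 3))
    (h2 : ¬ G.ContainsSub (cycleGraph 5))
    (h3 : ¬ G.ContainsSub (cycleGraph (2 * k)))
    (h4 : ¬ G.ContainsSub (cycleGraph (2 * k + 2))) :
    G.strongCliqueNumber ≤ max (k * Δ) (2 * k * (k - 1)) := by
  unfold SimpleGraph.strongCliqueNumber
  refine csSup_le ⟨0, ∅, ⟨by simp, by simp⟩, rfl⟩ ?_
  rintro n ⟨F, hF, rfl⟩
  rw [← hΔ]
  exact (strongClique_card_le k hk G h1 h2 h3 h4 F hF).trans (le_max_left _ _)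
end

section
/- Let κ ≥ 3 be an integer and let G be a finite simple graph with maximum degree Δ. If G contains no path on κ+1 vertices as a subgraph, then ω₂'(G) ≤ (κ − 2)(Δ − 1) + 2. -/
open SimpleGraph

namespace StrongCliquePath

variable {V : Type*} [Fintype V] [DecidableEq V]

/-- A chain of distinct vertices longer than `κ` gives a copy of the path on `κ+1` vertices. -/
lemma length_le (G : SimpleGraph V) (κ : ℕ) (hfree : ¬ G.ContainsSub (pathGraph (κ + 1)))
    (l : List V) (hc : l.IsChain G.Adj) (hn : l.Nodup) : l.length ≤ κ := by
  by_contra hlt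
  have hlt : κ + 1 ≤ l.length := by omega
  apply hfree
  refine ⟨fun i => l[i.1]'(by omega), ?_, ?_⟩
  · intro i j hij
    exact Fin.ext ((List.Nodup.getElem_inj_iff hn).1 hij)
  · intro a b hab
    rw [List.isChain_iff_getElem] at hc
    rw [pathGraph_adj] at hab
    rcases hab with h | h
    · have := hc a.1 (by omega)
      simpa [h] using this
    · have := hc b.1 (by omega)
      simpa [h] using this.symm

/-- Number of edges meeting the vertices of a path. -/
lemma card_meet (G : SimpleGraph V) [DecidableRel G.Adj] (m : List V) :
    ∀ b : V, (b :: m).IsChain G.Adj →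
      (G.edgeFinset.filter (fun e => ∃ v ∈ b :: m, v ∈ e)).card
        ≤ (m.length + 1) * (G.maxDegree - 1) + 1 := by
  induction m with
  | nil =>
    intro b _
    have h1 : G.edgeFinset.filter (fun e => ∃ v ∈ [b], v ∈ e) ⊆ G.incidenceFinset b := by
      intro e he
      simp at he
      simp [incidenceSet, he]
    have h2 := Finset.card_le_card h1
    rw [card_incidenceFinset_eq_degree] at h2
    have h3 := G.degree_le_maxDegree b
    simp only [List.length_nil]
    omega
  | cons c m ih =>
    intro b hb
    rw [List.isChain_cons_cons] at hb
    have h1 : G.edgeFinset.filter (fun e => ∃ v ∈ b :: c :: m, v ∈ e) ⊆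
        G.edgeFinset.filter (fun e => ∃ v ∈ c :: m, v ∈ e) ∪
          (G.incidenceFinset b).erase s(b, c) := by
      intro e he
      simp only [Finset.mem_filter, mem_edgeFinset] at he
      obtain ⟨he, v, hv, hve⟩ := he
      rw [Finset.mem_union]
      by_cases hx : ∃ v ∈ c :: m, v ∈ e
      · left
        simp only [Finset.mem_filter, mem_edgeFinset]
        exact ⟨he, hx⟩
      · right
        rcases List.mem_cons.1 hv with rfl | hv
        · rw [Finset.mem_erase]
          refine ⟨?_, by simp [incidenceSet, he, hve]⟩
          rintro rfl
          exact hx ⟨c, by simp, by simp⟩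
        · exact absurd ⟨v, hv, hve⟩ hx
    have h2 := (Finset.card_le_card h1).trans (Finset.card_union_le _ _)
    rw [Finset.card_erase_of_mem (by simp [incidenceSet, hb.1]),
      card_incidenceFinset_eq_degree] at h2
    have h3 := G.degree_le_maxDegree b
    have h4 := ih c hb.2
    have h5 : (m.length + 1 + 1) * (G.maxDegree - 1)
      = (m.length + 1) * (G.maxDegree - 1) + (G.maxDegree - 1) := by ring
    simp only [List.length_cons]
    omega

/-- A path, listed from an end, whose first edge lies in `F`. -/
def Good (G : SimpleGraph V) (F : Finset (Sym2 V)) (a b : V) (t : List V) : Prop :=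
  (a :: b :: t).IsChain G.Adj ∧ (a :: b :: t).Nodup ∧ s(a, b) ∈ F

lemma exists_max (G : SimpleGraph V) (κ : ℕ) (hfree : ¬ G.ContainsSub (pathGraph (κ + 1)))
    (F : Finset (Sym2 V)) (hF : G.IsStrongClique F) (hne : F.Nonempty) :
    ∃ a b t, Good G F a b t ∧ ∀ a' b' t', Good G F a' b' t' → t'.length ≤ t.length := by
  classical
  let P : ℕ → Prop := fun n => ∃ a b t, Good G F a b t ∧ t.length = n
  have hP0 : P 0 := by
    obtain ⟨e, he⟩ := hne
    induction e with
    | _ x y =>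
      have : G.Adj x y := hF.1 he
      exact ⟨x, y, [], ⟨by simp [this], by simp [this.ne], he⟩, rfl⟩
  obtain ⟨a, b, t, hg, ht⟩ := Nat.findGreatest_spec (P := P) (Nat.zero_le κ) hP0
  refine ⟨a, b, t, hg, fun a' b' t' hg' => ?_⟩
  rw [ht]
  apply Nat.le_findGreatest
  · have := length_le G κ hfree _ hg'.1 hg'.2.1
    simp at this
    omega
  · exact ⟨a', b', t', hg', rfl⟩

section maximal
variable {G : SimpleGraph V} {F : Finset (Sym2 V)} {a b : V} {t : List V}

/-- `F`-neighbours of the front end lie on the path. -/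
lemma front (hF : G.IsStrongClique F) (hg : Good G F a b t)
    (hmax : ∀ a' b' t', Good G F a' b' t' → t'.length ≤ t.length)
    {w : V} (hw : s(a, w) ∈ F) : w ∈ a :: b :: t := by
  by_contra hn
  have hadj : G.Adj a w := hF.1 hw
  have := hmax w a (b :: t) ⟨List.isChain_cons_cons.2 ⟨hadj.symm, hg.1⟩,
    List.nodup_cons.2 ⟨hn, hg.2.1⟩, by rwa [Sym2.eq_swap]⟩
  simp at this

/-- Neighbours of the back end lie on the path. -/
lemma back (hg : Good G F a b t)
    (hmax : ∀ a' b' t', Good G F a' b' t' → t'.length ≤ t.length)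
    {z w : V} (hz : (a :: b :: t).getLast? = some z) (hw : G.Adj z w) : w ∈ a :: b :: t := by
  by_contra hn
  have h1 : ((a :: b :: t) ++ [w]).IsChain G.Adj := by
    rw [List.isChain_append]
    refine ⟨hg.1, by simp, ?_⟩
    intro x hx y hy
    rw [hz] at hx
    simp at hx hy
    subst hx; subst hy; exact hw
  have h2 : ((a :: b :: t) ++ [w]).Nodup := by
    rw [List.nodup_append]
    refine ⟨hg.2.1, by simp, ?_⟩
    intro x hx y hy
    simp only [List.mem_singleton] at hy
    subst hy
    rintro rfl
    exact hn hx
  have := hmax a b (t ++ [w]) ⟨by simpa using h1, by simpa using h2, hg.2.2⟩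
  simp at this

/-- Every edge of `F` meets the path. -/
lemma meets (hF : G.IsStrongClique F) (hg : Good G F a b t)
    (hmax : ∀ a' b' t', Good G F a' b' t' → t'.length ≤ t.length)
    {f : Sym2 V} (hf : f ∈ F) : ∃ v ∈ a :: b :: t, v ∈ f := by
  by_contra hn
  push Not at hn
  have hne : s(a, b) ≠ f := by
    rintro rfl
    exact hn a (by simp) (by simp)
  obtain ⟨x, hx, y, hy, hxy⟩ := hF.2 _ hg.2.2 f hf hne
  obtain ⟨z, rfl⟩ := Sym2.mem_iff_exists.1 hy
  have hyz : G.Adj y z := hF.1 hf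
  have hy' : y ∉ a :: b :: t := fun h => hn y h (by simp)
  have hz' : z ∉ a :: b :: t := fun h => hn z h (by simp)
  have hxp : x ∈ a :: b :: t := by
    rcases Sym2.mem_iff.1 hx with rfl | rfl <;> simp
  have hadj : G.Adj x y := by
    rcases hxy with rfl | h
    · exact absurd hxp hy'
    · exact h
  obtain ⟨hc, hnd, -⟩ := hg
  have hF' : s(z, y) ∈ F := by rwa [Sym2.eq_swap]
  rcases Sym2.mem_iff.1 hx with rfl | rfl
  · have := hmax z y (x :: b :: t) ⟨List.isChain_cons_cons.2 ⟨hyz.symm,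
      List.isChain_cons_cons.2 ⟨hadj.symm, hc⟩⟩,
      List.nodup_cons.2 ⟨by simp only [List.mem_cons] at hz' ⊢; 
                            rintro (h | h); exacts [hyz.ne h.symm, hz' h],
        List.nodup_cons.2 ⟨hy', hnd⟩⟩, hF'⟩
    simp at this
  · have hsub : ∀ v, v ∉ a :: x :: t → v ∉ x :: t := fun v hv h => hv (List.mem_cons_of_mem _ h)
    have := hmax z y (x :: t) ⟨List.isChain_cons_cons.2 ⟨hyz.symm,
      List.isChain_cons_cons.2 ⟨hadj.symm, (List.isChain_cons_cons.1 hc).2⟩⟩,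
      List.nodup_cons.2 ⟨by rw [List.mem_cons]; rintro (h | h)
                            exacts [hyz.ne h.symm, hsub z hz' h],
        List.nodup_cons.2 ⟨hsub y hy', (List.nodup_cons.1 hnd).2⟩⟩, hF'⟩
    simp at this

end maximal

lemma card_le (G : SimpleGraph V) [DecidableRel G.Adj] (κ : ℕ) (hκ : 3 ≤ κ)
    (hfree : ¬ G.ContainsSub (pathGraph (κ + 1)))
    (F : Finset (Sym2 V)) (hF : G.IsStrongClique F) :
    F.card ≤ (κ - 2) * (G.maxDegree - 1) + 2 := by
  rcases F.eq_empty_or_nonempty with rfl | hne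
  · simp
  obtain ⟨a, b, t, hg, hmax⟩ := exists_max G κ hfree F hF hne
  rcases List.eq_nil_or_concat' t with rfl | ⟨m, z, rfl⟩
  · have h1 : F ⊆ {s(a, b)} := by
      intro f hf
      obtain ⟨v, hv, hvf⟩ := meets hF hg hmax hf
      obtain ⟨w, rfl⟩ := Sym2.mem_iff_exists.1 hvf
      have hadj : G.Adj v w := hF.1 hf
      simp only [List.mem_cons, List.not_mem_nil, or_false] at hv
      rcases hv with rfl | rfl
      · have := front hF hg hmax hf
        simp [hadj.ne.symm] at this
        simp [this]
      · have := back hg hmax (z := v) (by simp) hadj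
        simp [hadj.ne.symm] at this
        simp [this, Sym2.eq_swap]
    have := Finset.card_le_card h1
    simp at this
    omega
  · have h1 : F ⊆ G.edgeFinset.filter (fun e => ∃ v ∈ b :: m, v ∈ e) ∪ {s(a, z)} := by
      intro f hf
      obtain ⟨v, hv, hvf⟩ := meets hF hg hmax hf
      rw [Finset.mem_union, Finset.mem_filter, mem_edgeFinset]
      by_cases hx : ∃ v ∈ b :: m, v ∈ f
      · exact Or.inl ⟨hF.1 hf, hx⟩
      right
      obtain ⟨w, rfl⟩ := Sym2.mem_iff_exists.1 hvf
      have hadj : G.Adj v w := hF.1 hf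
      have hv' : v ∉ b :: m := fun h => hx ⟨v, h, by simp⟩
      have hw' : w ∉ b :: m := fun h => hx ⟨w, h, by simp⟩
      simp only [List.mem_cons, List.mem_append, not_or, List.not_mem_nil, or_false]
        at hv hv' hw'
      have hv2 : v = a ∨ v = z := by tauto
      rcases hv2 with rfl | rfl
      · have := front hF hg hmax hf
        simp [hadj.ne.symm, hw'] at this
        simp [this]
      · have := back hg hmax (z := v) (by simp [List.getLast?_cons]) hadj
        simp [hadj.ne.symm, hw'] at this
        simp [this, Sym2.eq_swap]
    have h2 := (Finset.card_le_card h1).trans (Finset.card_union_le _ _)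
    have hc : (b :: m).IsChain G.Adj := by
      have := (List.isChain_cons_cons.1 hg.1).2
      rw [← List.cons_append] at this
      exact (List.isChain_append.1 this).1
    have h3 := card_meet G m b hc
    have h4 := length_le G κ hfree _ hg.1 hg.2.1
    simp at h4 h2
    have h5 : (m.length + 1) * (G.maxDegree - 1) ≤ (κ - 2) * (G.maxDegree - 1) :=
      Nat.mul_le_mul_right _ (by omega)
    simp only [List.mem_cons] at h3
    simp only [exists_eq_or_imp] at h2 h3
    omega

end StrongCliquePath

/-- Theorem 4.1(1): if `κ ≥ 3` and `G` is `P_{κ+1}`-free with maximum degree `Δ`,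
then `ω₂'(G) ≤ (κ - 2)(Δ - 1) + 2`. -/
theorem strongCliqueNumber_le_of_pathFree {V : Type*} [Fintype V] [DecidableEq V]
    (κ : ℕ) (hκ : 3 ≤ κ) (G : SimpleGraph V) [DecidableRel G.Adj]
    (Δ : ℕ) (hΔ : G.maxDegree = Δ)
    (hfree : ¬ G.ContainsSub (pathGraph (κ + 1))) :
    G.strongCliqueNumber ≤ (κ - 2) * (Δ - 1) + 2 := by 
  subst hΔ
  apply csSup_le'
  rintro n ⟨F, hF, rfl⟩
  exact StrongCliquePath.card_le G κ hκ hfree F hF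
end
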